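/- The covering radius of RM(5,9) in RM(6,9) is at most 32; that is, every Boolean function on 9 variables of degree at most 6 has distance at most 32 to RM(5,9). -/

import Mathlib

open MvPolynomial

/-- A Boolean function on `m` variables over 𝔽₂. -/
abbrev BF (m : ℕ) := (Fin m → ZMod 2) → ZMod 2

/-- The unique multilinear polynomial over 𝔽₂ representing the Boolean function `f`
(obtained by interpolation: `∏ i (Xᵢ + vᵢ + 1)` is the indicator of the input `v`). -/
noncomputable def repPoly {m : ℕ} (f : BF m) : MvPolynomial (Fin m) (ZMod 2) :=
  ∑ v : Fin m → ZMod 2, f v • ∏ i : Fin m, (X i + C (v i + 1))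

/-- The degree of a Boolean function: the total degree of its multilinear representative. -/
noncomputable def deg {m : ℕ} (f : BF m) : ℕ := (repPoly f).totalDegree

/-- The weight of a Boolean function: the number of inputs on which it takes the value 1. -/
noncomputable def wt {m : ℕ} (f : BF m) : ℕ :=
  (Finset.univ.filter fun v => f v = 1).card

/-- The distance from `f` to the Reed–Muller code `RM(r,m)`: the minimum weight of
`f + p` over Boolean functions `p` of degree at most `r`. -/
noncomputable def distRM (m r : ℕ) (f : BF m) : ℕ :=
  sInf {w | ∃ p : BF m, deg p ≤ r ∧ wt (f + p) = w}

namespace Cover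

/-! ### Kernel-friendly arithmetic -/

/-- Evaluate `n` before passing it on (this matters only for kernel reduction). -/
def force {α : Type} (n : ℕ) (k : ℕ → α) : α :=
  Nat.rec (motive := fun _ => α) (k (nat_lit 0)) (fun m _ => k (Nat.succ m)) n

theorem force_eq {α : Type} (n : ℕ) (k : ℕ → α) : force n k = k n := by
  cases n <;> rfl

/-- The bit of `c` at position `i`, as a number. -/
def bitAt (c i : ℕ) : ℕ := Nat.land (Nat.shiftRight c i) (nat_lit 1)

/-- Boolean version of `Nat.testBit`. -/
def tb (c i : ℕ) : Bool := Nat.beq (bitAt c i) (nat_lit 1)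

def lowMask : ℕ := 726838724464839811802665264931518344399002025747803519065095998166524185752147651896588095253284568238103810248567287661793714745868287

def cubMask : ℕ := 726838724464839811763263258735123865184586998611241664320355097393768402919119177681353760993282076861050082480640275340731558262237312

def cubs : List ℕ := [7, 11, 13, 14, 19, 21, 22, 25, 26, 28, 35, 37, 38, 41, 42, 44, 49, 50, 52, 56, 67, 69, 70, 73, 74, 76, 81, 82, 84, 88, 97, 98, 100, 104, 112, 131, 133, 134, 137, 138, 140, 145, 146, 148, 152, 161, 162, 164, 168, 176, 193, 194, 196, 200, 208, 224, 259, 261, 262, 265, 266, 268, 273, 274, 276, 280, 289, 290, 292, 296, 304, 321, 322, 324, 328, 336, 352, 385, 386, 388, 392, 400, 416, 448]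

/-- Positions `S < 512` whose `i`-th binary digit is `0`. -/
def loPos (i : ℕ) : ℕ := Nat.div (Nat.sub (Nat.pow (nat_lit 2) (nat_lit 512)) (nat_lit 1)) (Nat.add (Nat.pow (nat_lit 2) (Nat.pow (nat_lit 2) i)) (nat_lit 1))

/-- Positions `S < 512` whose `i`-th binary digit is `1`. -/
def hiPos (i : ℕ) : ℕ := Nat.shiftLeft (loPos i) (Nat.pow (nat_lit 2) i)

/-- The code of a point: bit `S` is set iff `S` is a subset of `p` and `|S| ≤ 3`. -/
def mono (p : ℕ) : ℕ :=
  force p fun p => Nat.land (Nat.rec (motive := fun _ => ℕ) (nat_lit 1)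
    (fun i m => force m fun m => Nat.xor m (Nat.mul (bitAt p i) (Nat.shiftLeft m (Nat.pow (nat_lit 2) i)))) (nat_lit 9)) lowMask

/-- The elementary move `l_a ↦ l_a + l_b` on points. -/
def move (a b p : ℕ) : ℕ := Nat.xor p (Nat.shiftLeft (bitAt p b) a)

/-- The elementary move `l_a ↦ l_a + l_b` on codes. -/
def act1 (e c : ℕ) : ℕ :=
  force c fun c =>
    force (Nat.shiftLeft (Nat.land (Nat.land c (hiPos (Nat.mod e (nat_lit 10)))) (loPos (Nat.div e (nat_lit 10))))
        (Nat.pow (nat_lit 2) (Nat.div e (nat_lit 10)))) fun t =>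
      Nat.land (Nat.xor (Nat.xor c t) (Nat.shiftRight t (Nat.pow (nat_lit 2) (Nat.mod e (nat_lit 10))))) lowMask

/-- Fold of a list, by the recursor. -/
def fold {α β : Type} (l : List α) (z : β) (s : α → β → β) : β :=
  List.rec (motive := fun _ => β) z (fun a _ ih => s a ih) l

/-- Evaluate `f a` for all entries of a list. -/
def allOf {α : Type} (l : List α) (f : α → Bool) : Bool := fold l true fun a r => cond (f a) r false

/-- Evaluate the entries of a list before passing it on. -/
def forceList {α : Type} (l : List ℕ) (k : List ℕ → α) : α :=
  fold l (fun k : List ℕ → α => k []) (fun a r k => force a fun a => r fun t => k (a :: t)) k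

/-- Evaluate the entries of a list of pairs before passing it on. -/
def forcePairs {α : Type} (l : List (ℕ × ℕ)) (k : List (ℕ × ℕ) → α) : α :=
  fold l (fun k : List (ℕ × ℕ) → α => k [])
    (fun q r k => force q.1 fun a => force q.2 fun b => r fun t => k ((a, b) :: t)) k

/-- The length of a list. -/
def len {α : Type} (l : List α) : ℕ := fold l (nat_lit 0) fun _ n => Nat.succ n

/-- The code of a list of points. -/
def codeOf (D : List ℕ) : ℕ := fold D (nat_lit 0) fun p c => Nat.xor (mono p) c

/-- A word of elementary moves acting on codes. -/
def act (w : List ℕ) (c : ℕ) : ℕ := fold w (fun c => c) (fun e r c => r (act1 e c)) c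

/-- Each letter `10 a + b` of the word is a move with `a ≠ b` and `a, b < 9`. -/
def validWord (w : List ℕ) : Bool :=
  allOf w fun e => and (Nat.ble (Nat.mod e (nat_lit 10)) (nat_lit 8)) (and (Nat.ble (Nat.div e (nat_lit 10)) (nat_lit 8))
    (not (Nat.beq (Nat.mod e (nat_lit 10)) (Nat.div e (nat_lit 10)))))

/-- The map `f` kills every cubic unit code outside of `F`. -/
def vanishesOff (F : ℕ) (f : ℕ → ℕ) : Bool :=
  allOf cubs fun S => cond (tb F S) true (Nat.beq (f (Nat.shiftLeft (nat_lit 1) S)) (nat_lit 0))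

/-- The bits of `c` at the positions `Ss`, packed into a number. -/
def gather (Ss : List ℕ) (c : ℕ) : ℕ := fold Ss (nat_lit 0) fun S r => Nat.xor (Nat.shiftLeft r (nat_lit 1)) (bitAt c S)

/-- The code whose bits at the positions `Ss` are those of `v`. -/
def scatter (Ss : List ℕ) (v : ℕ) : ℕ :=
  fold Ss (fun _ => (nat_lit 0)) (fun S r v => Nat.xor (Nat.shiftLeft (bitAt v (nat_lit 0)) S) (r (Nat.shiftRight v (nat_lit 1)))) v

/-! ### Bitsets -/

/-- All ones on `2 ^ n` positions. -/
def full (n : ℕ) : ℕ := Nat.sub (Nat.pow (nat_lit 2) (Nat.pow (nat_lit 2) n)) (nat_lit 1)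

/-- The positions below `2 ^ n` whose `i`-th binary digit is `0`. -/
def lo (n i : ℕ) : ℕ :=
  Nat.rec (motive := fun _ => ℕ) (nat_lit 0) (fun n m => cond (Nat.beq i n) (full n)
      (force m fun m => Nat.lor m (Nat.shiftLeft m (Nat.pow (nat_lit 2) n)))) n

/-- Translate a bitset by `2 ^ i`. -/
def flip (n i B : ℕ) : ℕ :=
  force B fun B => Nat.lor (Nat.land (Nat.shiftRight B (Nat.pow (nat_lit 2) i)) (lo n i))
    (Nat.shiftLeft (Nat.land B (lo n i)) (Nat.pow (nat_lit 2) i))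

/-- Translate a bitset by `u < 2 ^ n`. -/
def translate (n u B : ℕ) : ℕ :=
  force u fun u => Nat.rec (motive := fun _ => ℕ) B (fun i B' => cond (tb u i) (flip n i B') B') n

/-- The transvection adding digit `j` to digit `i`, encoded as `100 i + j`. -/
def transvect (e v : ℕ) : ℕ := Nat.xor v (Nat.shiftLeft (bitAt v (Nat.mod e (nat_lit 100))) (Nat.div e (nat_lit 100)))

/-- A product of transvections; the first one of the list acts first. -/
def transvects (ops : List ℕ) (v : ℕ) : ℕ := fold ops (fun v => v) (fun e r v => r (transvect e v)) v

/-- The preimage of a bitset under a transvection. -/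
def transvectSet (n e B : ℕ) : ℕ :=
  force B fun B =>
    force (Nat.land (Nat.xor (Nat.shiftRight B (Nat.pow (nat_lit 2) (Nat.div e (nat_lit 100)))) B)
      (Nat.xor (lo n (Nat.div e (nat_lit 100))) (Nat.land (lo n (Nat.div e (nat_lit 100))) (lo n (Nat.mod e (nat_lit 100)))))) fun t =>
    Nat.xor (Nat.xor B t) (Nat.shiftLeft t (Nat.pow (nat_lit 2) (Nat.div e (nat_lit 100))))

/-- A word of moves together with the affine map it induces on packed states. -/
structure Gen where
  /-- the word of moves -/
  word : List ℕ
  /-- the linear part, as a product of transvections -/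
  ops : List ℕ
  /-- the translation part -/
  shift : ℕ

/-- The affine map of states of a generator. -/
def Gen.map (g : Gen) (v : ℕ) : ℕ := Nat.xor (transvects g.ops v) g.shift

/-- The preimage of a bitset under the affine map of a generator. -/
def Gen.pre (g : Gen) (n B : ℕ) : ℕ := fold g.ops (translate n g.shift B) fun e B => transvectSet n e B

/-- Enlarge a bitset by successive preimages. -/
def saturate (n : ℕ) (gens : List Gen) (sched : List ℕ) (B : ℕ) : ℕ :=
  fold sched (fun B => B) (fun k r B => force B fun B =>
    r (Nat.lor B ((gens.getD k ⟨[], [], (nat_lit 0)⟩).pre n B))) B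

/-- The word preserves the family `(F, c₀)`. -/
def preserves (F c₀ : ℕ) (w : List ℕ) : Bool :=
  and (validWord w) (and (Nat.beq (Nat.land (act w c₀) F) c₀) (vanishesOff F fun c => Nat.land (act w c) F))

/-- A generator preserves the family `(F, c₀)` and induces the claimed map on states. -/
def Gen.check (g : Gen) (F c₀ n : ℕ) (st : ℕ → ℕ) : Bool :=
  and (preserves F c₀ g.word) <|
  and (allOf g.ops fun e => and (Nat.blt (Nat.div e (nat_lit 100)) n) (and (Nat.blt (Nat.mod e (nat_lit 100)) n)
      (not (Nat.beq (Nat.mod e (nat_lit 100)) (Nat.div e (nat_lit 100)))))) <|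
  and (Nat.blt g.shift (Nat.pow (nat_lit 2) n)) <|
  and (Nat.beq (Nat.xor (st (act g.word c₀)) (transvects g.ops (st c₀))) g.shift)
  (vanishesOff F fun c => Nat.xor (st (act g.word c)) (transvects g.ops (st c)))

/-- Each word of the list flips the given bit, keeps the state and preserves the family,
in which the bits treated before are `0`; the continuation receives the final set of fixed bits. -/
def killCheck (c₀ : ℕ) (st : ℕ → ℕ) (kills : List (ℕ × List ℕ)) (F : ℕ) (k : ℕ → Bool) : Bool :=
  fold kills (fun F => k F) (fun q r F =>
    and (preserves F c₀ q.2) <|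
    and (Nat.beq (Nat.xor (st (act q.2 c₀)) (st c₀)) (nat_lit 0)) <|
    and (vanishesOff F fun c => Nat.xor (st (act q.2 c)) (st c)) <|
    and (Nat.beq (Nat.xor (bitAt (act q.2 c₀) q.1) (bitAt c₀ q.1)) (nat_lit 1)) <|
    and (vanishesOff F fun c => Nat.xor (bitAt (act q.2 c) q.1) (bitAt c q.1))
      (r (Nat.lor F (Nat.shiftLeft (nat_lit 1) q.1)))) F

/-- The bitset of a list of states. -/
def bitset (vs : List ℕ) : ℕ := fold vs (nat_lit 0) fun v B => Nat.lor (Nat.shiftLeft (nat_lit 1) v) B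

/-- Reduction of the family `(F, c₀)` to the families `(F', c₀ + scatter Ss v)`, `v ∈ reps`. -/
def stepCheck (F c₀ F' : ℕ) (Ss : List ℕ) (gens : List Gen) (sched : List ℕ)
    (kills : List (ℕ × List ℕ)) (reps : List ℕ) : Bool :=
  force (len Ss) fun n =>
  and (allOf gens fun g => g.check F c₀ n (gather Ss)) <|
  and (Nat.beq (saturate n gens sched (bitset reps)) (full n)) <|
  killCheck c₀ (gather Ss) kills F fun F₁ =>
    and (Nat.beq (Nat.xor (Nat.land c₀ F') (scatter Ss (gather Ss c₀))) c₀)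
      (vanishesOff F₁ fun c => Nat.xor (Nat.land c F') (scatter Ss (gather Ss c)))

/-- The word maps the family `(F, c₀)` into the family `(F', c₁)`. -/
def wordCheck (F c₀ F' c₁ : ℕ) (w : List ℕ) : Bool :=
  and (validWord w) (and (Nat.beq (Nat.land (act w c₀) F') c₁) (vanishesOff F fun c => Nat.land (act w c) F'))

/-- Reduction modulo a list of pairs (pivot position, code). -/
def reduce (L : List (ℕ × ℕ)) (c : ℕ) : ℕ :=
  fold L (fun c => c) (fun q r c => force c fun c => r (Nat.xor c (Nat.mul (bitAt c q.1) q.2))) c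

/-- Echelon form of the translations induced by the given words. -/
def echelon (c₀ : ℕ) (ws : List (List ℕ)) (L : List (ℕ × ℕ)) : List (ℕ × ℕ) :=
  fold ws (fun L => L) (fun w r L => force (reduce L (Nat.xor (act w c₀) c₀)) fun k =>
      cond (Nat.beq k (nat_lit 0)) (r L) (r (L ++ [(Nat.log2 k, k)]))) L

/-- The word acts on the family `(F, c₀)` by a translation. -/
def shiftCheck (F c₀ : ℕ) (w : List ℕ) : Bool :=
  and (validWord w) (and (Nat.beq (Nat.land (Nat.xor (act w c₀) c₀) F) (nat_lit 0))
    (vanishesOff F fun c => Nat.xor (act w c) c))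

/-- All sums `B + v`, for `v` in the states of those options that have the expected
constant part and length. -/
def sumOptions (n k l F : ℕ) (st : ℕ → ℕ) (B : ℕ) (opts : List (List ℕ)) : ℕ :=
  fold opts (nat_lit 0) fun D R => forceList D fun D => force (codeOf D) fun d =>
    cond (and (Nat.beq (Nat.land d F) k) (and (Nat.beq (len D) l) (allOf D fun p => Nat.blt p (nat_lit 512))))
      (Nat.lor R (translate n (st d) B)) R

/-- The states of all codes with constant part `c₀` that are sums of one option from each group. -/
def productSet (n F c₀ : ℕ) (st : ℕ → ℕ) (groups : List (List (List ℕ))) (k l B : ℕ) : ℕ :=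
  fold groups (fun k l B => cond (and (Nat.beq k c₀) (Nat.ble l (nat_lit 32))) B (nat_lit 0))
    (fun opts r k l B =>
      force (Nat.land (codeOf (opts.headD [])) F) fun k₁ =>
      force (len (opts.headD [])) fun l₁ =>
      force B fun B =>
      r (Nat.xor k k₁) (Nat.add l l₁) (sumOptions n k₁ l₁ F st B opts)) k l B

/-- The bits at the positions `T`, folded together modulo 57. -/
def squash (T c : ℕ) : ℕ :=
  force (Nat.land c T) fun c =>
  force (Nat.xor c (Nat.shiftRight c (nat_lit 228))) fun c =>
  force (Nat.xor c (Nat.shiftRight c (nat_lit 114))) fun c =>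
  Nat.land (Nat.xor c (Nat.shiftRight c (nat_lit 57))) (nat_lit 144115188075855871)

/-- The sum of the entries of a table that are selected by the bits of a number. -/
def select (tbl : List (ℕ × ℕ)) (c : ℕ) : ℕ :=
  force c fun c => fold tbl (nat_lit 0) fun q r => Nat.xor (Nat.mul (bitAt c q.1) q.2) r

/-- A cover of the family `(F, c₀)` with free positions `T` by products of options. -/
def coverCheck (F c₀ : ℕ) (T : List ℕ) (shifts : List (List ℕ)) (gens : List Gen) (sched : List ℕ)
    (prods : List (List (List (List ℕ)))) : Bool :=
  and (allOf shifts fun w => shiftCheck F c₀ w) <|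
  forcePairs (echelon c₀ shifts []) fun L =>
  forceList (T.filter fun S => allOf L fun q => not (Nat.beq q.1 S)) fun Ts =>
  force (len Ts) fun n =>
  force (bitset T) fun M =>
  forcePairs (T.map fun S => (Nat.mod S (nat_lit 57), gather Ts (reduce L (Nat.shiftLeft (nat_lit 1) S)))) fun tbl =>
  and (allOf tbl fun q => Nat.blt q.2 (Nat.pow (nat_lit 2) n)) <|
  and (vanishesOff F fun c => Nat.xor (reduce L c) (scatter Ts (select tbl (squash M c)))) <|
  and (allOf gens fun g => g.check F c₀ n fun c => select tbl (squash M c)) <|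
  and (Nat.beq (Nat.land c₀ F) c₀) <|
  Nat.beq (saturate n gens sched (fold prods (nat_lit 0) fun P B => Nat.lor
      (productSet n (Nat.xor lowMask (Nat.land (Nat.xor F cubMask) cubMask)) c₀
        (fun c => select tbl (squash M c)) P (nat_lit 0) (nat_lit 0) (nat_lit 1)) B)) (full n)

/-- The first `n` base-`512` digits of a number. -/
def digits512 (n x : ℕ) : List ℕ :=
  Nat.rec (motive := fun _ => ℕ → List ℕ) (fun _ => [])
    (fun _ r x => force x fun x => Nat.mod x (nat_lit 512) :: r (Nat.div x (nat_lit 512))) n x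

/-- The 32 six-point sets obtained from a six-point set by adding a multiple of `8`
and sums of an even number of its points. -/
def sixes (x : ℕ) : List (List ℕ) :=
  forceList (digits512 (nat_lit 6) x) fun P =>
  fold [0, 3, 5, 6, 9, 10, 12, 15, 17, 18, 20, 23, 24, 27, 29, 30] [] fun c r =>
    force (fold P (fun _ => (nat_lit 0)) (fun p r c => Nat.xor (Nat.mul (bitAt c (nat_lit 0)) p) (r (Nat.shiftRight c (nat_lit 1)))) c) fun s =>
    (fold P (fun _ => []) (fun p r c => Nat.xor (Nat.xor p s) (Nat.mul (nat_lit 8) (bitAt c (nat_lit 0))) :: r (Nat.shiftRight c (nat_lit 1))) c) ::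
    (fold P (fun _ => []) (fun p r c => Nat.xor (nat_lit 8) (Nat.xor (Nat.xor p s) (Nat.mul (nat_lit 8) (bitAt c (nat_lit 0)))) ::
      r (Nat.shiftRight c (nat_lit 1))) c) :: r

/-- Eight-point sets, given by their base-`512` encodings. -/
def octs (xs : List ℕ) : List (List ℕ) := xs.map (digits512 (nat_lit 8))

theorem land_eq (a b : ℕ) : Nat.land a b = a &&& b := rfl

theorem xor_eq (a b : ℕ) : Nat.xor a b = a ^^^ b := rfl

theorem lor_eq (a b : ℕ) : Nat.lor a b = a ||| b := rfl

theorem shiftLeft_eq (a b : ℕ) : Nat.shiftLeft a b = a <<< b := rfl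

theorem shiftRight_eq (a b : ℕ) : Nat.shiftRight a b = a >>> b := rfl

theorem bitAt_eq (c i : ℕ) : bitAt c i = (c.testBit i).toNat := by
  rw [bitAt, land_eq, shiftRight_eq, Nat.testBit, Nat.and_comm]
  have : 1 &&& c >>> i = c >>> i % 2 := by rw [Nat.and_comm, Nat.and_one_is_mod]
  rw [this]
  rcases Nat.mod_two_eq_zero_or_one (c >>> i) with h | h <;> simp [h]

theorem tb_eq (c i : ℕ) : tb c i = c.testBit i := by
  rw [tb, bitAt_eq]; cases c.testBit i <;> rfl

theorem bitAt_xor (a b i : ℕ) : bitAt (a ^^^ b) i = bitAt a i ^^^ bitAt b i := by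
  simp only [bitAt_eq, Nat.testBit_xor]
  cases a.testBit i <;> cases b.testBit i <;> rfl

@[simp] theorem fold_nil {α β : Type} (z : β) (s : α → β → β) : fold [] z s = z := rfl
@[simp] theorem fold_cons {α β : Type} (a : α) (l : List α) (z : β) (s : α → β → β) :
    fold (a :: l) z s = s a (fold l z s) := rfl

@[simp] theorem allOf_iff {α : Type} (l : List α) (f : α → Bool) :
    allOf l f = true ↔ ∀ a ∈ l, f a = true := by
  unfold allOf
  induction l with
  | nil => simp
  | cons a l ih =>
    rw [fold_cons, List.forall_mem_cons, ← ih]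
    cases f a <;> simp

theorem forceList_eq {α : Type} (l : List ℕ) (k : List ℕ → α) : forceList l k = k l := by
  induction l generalizing k with
  | nil => rfl
  | cons a l ih =>
    refine Eq.trans ?_ (ih fun t => k (a :: t))
    unfold forceList
    rw [fold_cons, force_eq]

theorem forcePairs_eq {α : Type} (l : List (ℕ × ℕ)) (k : List (ℕ × ℕ) → α) : forcePairs l k = k l := by
  induction l generalizing k with
  | nil => rfl
  | cons a l ih =>
    refine Eq.trans ?_ (ih fun t => k (a :: t))
    unfold forcePairs
    rw [fold_cons, force_eq, force_eq]

theorem len_eq {α : Type} (l : List α) : len l = l.length := by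
  unfold len
  induction l with
  | nil => rfl
  | cons a l ih => simp [ih]

/-! ### Linear maps of codes -/

/-- Maps of natural numbers that respect bitwise addition. -/
def Additive (f : ℕ → ℕ) : Prop := ∀ a b, f (a ^^^ b) = f a ^^^ f b

theorem Additive.zero {f : ℕ → ℕ} (hf : Additive f) : f 0 = 0 := by
  have := hf 0 0
  simpa using this

theorem Additive.xor {f g : ℕ → ℕ} (hf : Additive f) (hg : Additive g) :
    Additive fun c => Nat.xor (f c) (g c) := fun a b => by
  simp only [xor_eq, hf a b, hg a b]; ac_rfl

theorem Additive.comp {f g : ℕ → ℕ} (hf : Additive f) (hg : Additive g) :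
    Additive fun c => f (g c) := fun a b => by
  simp only [hg a b, hf _ _]

theorem additive_id : Additive fun c => c := fun _ _ => rfl

theorem Additive.land {f : ℕ → ℕ} (hf : Additive f) (F : ℕ) : Additive fun c => Nat.land (f c) F :=
  fun a b => by simp only [hf a b, land_eq, Nat.and_xor_distrib_right]

theorem Additive.shiftLeft {f : ℕ → ℕ} (hf : Additive f) (n : ℕ) :
    Additive fun c => Nat.shiftLeft (f c) n :=
  fun a b => by simp only [hf a b, shiftLeft_eq, Nat.shiftLeft_xor_distrib]

theorem Additive.shiftRight {f : ℕ → ℕ} (hf : Additive f) (n : ℕ) :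
    Additive fun c => Nat.shiftRight (f c) n :=
  fun a b => by simp only [hf a b, shiftRight_eq, Nat.shiftRight_xor_distrib]

theorem additive_bitAt (i : ℕ) : Additive fun c => bitAt c i := fun a b => bitAt_xor a b i

theorem Additive.mul {f : ℕ → ℕ} (hf : Additive f) (h1 : ∀ c, f c ≤ 1) (k : ℕ) :
    Additive fun c => Nat.mul (f c) k := fun a b => by
  have ha := h1 a
  have hb := h1 b
  change f (a ^^^ b) * k = (f a * k) ^^^ (f b * k)
  rw [hf a b]
  interval_cases f a <;> interval_cases f b <;> simp

theorem bitAt_le (c i : ℕ) : bitAt c i ≤ 1 := by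
  rw [bitAt_eq]; exact Bool.toNat_le _

theorem additive_act1 (e : ℕ) : Additive (act1 e) := by
  have : act1 e = fun c => Nat.land (Nat.xor (Nat.xor c (Nat.shiftLeft (Nat.land (Nat.land c (hiPos (Nat.mod e 10))) (loPos (Nat.div e 10)))
        (Nat.pow 2 (Nat.div e 10)))) (Nat.shiftRight (Nat.shiftLeft (Nat.land (Nat.land c (hiPos (Nat.mod e 10))) (loPos (Nat.div e 10)))
        (Nat.pow 2 (Nat.div e 10))) (Nat.pow 2 (Nat.mod e 10)))) lowMask := by
    funext c; simp only [act1, force_eq]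
  rw [this]
  have h := ((additive_id.land (hiPos (Nat.mod e 10))).land (loPos (Nat.div e 10))).shiftLeft
    (Nat.pow 2 (Nat.div e 10))
  exact ((additive_id.xor h).xor (h.shiftRight _)).land _

@[simp] theorem act_nil (c : ℕ) : act [] c = c := rfl
@[simp] theorem act_cons (e : ℕ) (w : List ℕ) (c : ℕ) : act (e :: w) c = act w (act1 e c) := rfl

theorem additive_act (w : List ℕ) : Additive (act w) := by
  induction w with
  | nil => exact additive_id
  | cons e w ih => exact ih.comp (additive_act1 e)

theorem additive_gather (Ss : List ℕ) : Additive (gather Ss) := by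
  induction Ss with
  | nil => exact fun a b => (Nat.xor_self 0).symm
  | cons S Ss ih => exact (ih.shiftLeft 1).xor (additive_bitAt S)

theorem additive_scatter (Ss : List ℕ) : Additive (scatter Ss) := by
  induction Ss with
  | nil => exact fun a b => (Nat.xor_self 0).symm
  | cons S Ss ih =>
    exact ((additive_bitAt 0).shiftLeft S).xor (ih.comp (additive_id.shiftRight 1))

theorem additive_reduce (L : List (ℕ × ℕ)) : Additive (reduce L) := by
  induction L with
  | nil => exact additive_id
  | cons q L ih =>
    have : reduce (q :: L) = fun c => reduce L (Nat.xor c (Nat.mul (bitAt c q.1) q.2)) := by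
      funext c; simp only [reduce, fold_cons, force_eq]
    rw [this]
    exact ih.comp (additive_id.xor ((additive_bitAt q.1).mul (fun c => bitAt_le c q.1) q.2))

theorem additive_transvect (e : ℕ) : Additive (transvect e) :=
  additive_id.xor ((additive_bitAt _).shiftLeft _)

@[simp] theorem transvects_nil (v : ℕ) : transvects [] v = v := rfl
@[simp] theorem transvects_cons (e : ℕ) (l : List ℕ) (v : ℕ) :
    transvects (e :: l) v = transvects l (transvect e v) := rfl

theorem additive_transvects (ops : List ℕ) : Additive (transvects ops) := by
  induction ops with
  | nil => exact additive_id
  | cons e l ih => exact ih.comp (additive_transvect e)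

theorem Additive.eq_zero_of_bits {f : ℕ → ℕ} (hf : Additive f) (d : ℕ)
    (h : ∀ i, d.testBit i = true → f (1 <<< i) = 0) : f d = 0 := by
  obtain ⟨n, hn⟩ : ∃ n, d < 2 ^ n := ⟨d, Nat.lt_two_pow_self⟩
  induction n generalizing d with
  | zero => have : d = 0 := by simpa using hn
            rw [this, hf.zero]
  | succ n ih =>
    by_cases hb : d.testBit n = true
    · have hd : d = (d ^^^ 1 <<< n) ^^^ 1 <<< n := by
        rw [Nat.xor_assoc, Nat.xor_self, Nat.xor_zero]
      have hbit : ∀ i, (d ^^^ 1 <<< n).testBit i = (d.testBit i && decide (i ≠ n)) := by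
        intro i
        rw [Nat.testBit_xor, Nat.one_shiftLeft, Nat.testBit_two_pow]
        by_cases hi : n = i
        · subst hi; simp [hb]
        · simp [hi, Ne.symm hi]
      rw [hd, hf, h n hb, Nat.xor_zero]
      apply ih
      · intro i hi; rw [hbit] at hi; simp at hi; exact h i hi.1
      · apply Nat.lt_pow_two_of_testBit
        intro i hi
        rw [hbit]
        rcases hi.eq_or_lt with rfl | hi
        · simp
        · rw [Nat.testBit_lt_two_pow (lt_of_lt_of_le hn (Nat.pow_le_pow_right (by norm_num) hi))]; rfl
    · refine ih d h ?_
      apply Nat.lt_pow_two_of_testBit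
      intro i hi
      rcases hi.eq_or_lt with rfl | hi
      · simpa using hb
      · exact Nat.testBit_lt_two_pow (lt_of_lt_of_le hn (Nat.pow_le_pow_right (by norm_num) hi))

/-- Codes supported on three-element sets. -/
def Cubic (c : ℕ) : Prop := c &&& cubMask = c

theorem mem_cubs_of_testBit {i : ℕ} (h : cubMask.testBit i = true) : i ∈ cubs := by
  have hi : i < 512 := by
    by_contra hi
    rw [Nat.testBit_lt_two_pow (lt_of_lt_of_le (b := 2 ^ 512) (by decide +kernel)
      (Nat.pow_le_pow_right (by norm_num) (not_lt.1 hi)))] at h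
    exact absurd h (by simp)
  have : (List.range 512).all (fun i => !(tb cubMask i) || cubs.contains i) = true := by decide +kernel
  have := List.all_eq_true.1 this i (List.mem_range.2 hi)
  rw [tb_eq, h] at this
  simpa using this

theorem Cubic.xor {a b : ℕ} (ha : Cubic a) (hb : Cubic b) : Cubic (a ^^^ b) := by
  rw [Cubic, Nat.and_xor_distrib_right, ha, hb]

theorem Cubic.land {a : ℕ} (ha : Cubic a) (F : ℕ) : Cubic (a &&& F) := by
  rw [Cubic, Nat.and_right_comm, ha]

/-- The family of cubic codes that agree with `c₀` on `F`. -/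
def Fam (F c₀ c : ℕ) : Prop := Cubic c ∧ c &&& F = c₀

theorem vanishesOff_sound {F : ℕ} {f : ℕ → ℕ} (hf : Additive f) (hv : vanishesOff F f = true)
    {d : ℕ} (hd : Cubic d) (hF : d &&& F = 0) : f d = 0 := by
  apply hf.eq_zero_of_bits
  intro i hi
  have hi' : i ∈ cubs := by
    apply mem_cubs_of_testBit
    rw [← hd, Nat.testBit_and, Bool.and_eq_true] at hi
    exact hi.2
  have hFi : F.testBit i = false := by
    by_contra hh
    have := congrArg (fun x => x.testBit i) hF
    simp [hi] at this
    exact hh this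
  have := (allOf_iff _ _).1 hv i hi'
  rw [tb_eq, hFi] at this
  simpa [shiftLeft_eq] using this

theorem Fam.const {F c₀ c : ℕ} (hc : Fam F c₀ c) {f : ℕ → ℕ} (hf : Additive f)
    (hv : vanishesOff F f = true) : f c = f c₀ := by
  have h0 : Cubic c₀ := hc.2 ▸ hc.1.land F
  have hx : (c ^^^ c₀) &&& F = 0 := by
    rw [Nat.and_xor_distrib_right, ← hc.2, Nat.and_assoc, Nat.and_self, Nat.xor_self]
  have := vanishesOff_sound hf hv (hc.1.xor h0) hx
  rw [hf] at this
  exact Nat.xor_eq_zero_iff.1 this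

theorem vanishesOff_zero_sound {f : ℕ → ℕ} (hf : Additive f) (hv : vanishesOff 0 f = true)
    {d : ℕ} (hd : Cubic d) : f d = 0 := vanishesOff_sound hf hv hd (Nat.and_zero d)

/-! ### Representable codes -/

/-- Codes of sets of at most 32 points. -/
def Real (c : ℕ) : Prop := ∃ D : List ℕ, D.length ≤ 32 ∧ (∀ p ∈ D, p < 512) ∧ codeOf D = c

/-- The elementary moves. -/
def moves : List ℕ :=
  (List.range 89).filter fun e => and (Nat.ble (Nat.mod e 10) 8) (and (Nat.ble (Nat.div e 10) 8)
    (not (Nat.beq (Nat.mod e 10) (Nat.div e 10))))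

theorem mem_moves {w : List ℕ} (hw : validWord w = true) {e : ℕ} (he : e ∈ w) : e ∈ moves := by
  have h := (allOf_iff _ _).1 hw e he
  rw [moves, List.mem_filter, List.mem_range]
  refine ⟨?_, h⟩
  simp only [Bool.and_eq_true, Nat.ble_eq] at h
  have h1 : e % 10 ≤ 8 := h.1
  have h2 : e / 10 ≤ 8 := h.2.1
  omega

theorem act1_mono {e p : ℕ} (he : e ∈ moves) (hp : p < 512) :
    act1 e (mono p) = mono (move (Nat.div e 10) (Nat.mod e 10) p) ∧
      move (Nat.div e 10) (Nat.mod e 10) p < 512 := by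
  have : (moves.all fun e => (List.range 512).all fun p =>
      force (move (Nat.div e 10) (Nat.mod e 10) p) fun q =>
      and (Nat.beq (act1 e (mono p)) (mono q)) (Nat.blt q 512)) = true := by decide +kernel
  have := List.all_eq_true.1 (List.all_eq_true.1 this e he) p (List.mem_range.2 hp)
  rw [force_eq, Bool.and_eq_true, Nat.beq_eq] at this
  exact ⟨this.1, by simpa [Nat.blt_eq] using this.2⟩

theorem moves_cubic : (moves.all fun e =>
    and (vanishesOff 0 fun c => Nat.xor (Nat.land (act1 e c) cubMask) (act1 e c))
      (vanishesOff 0 fun c => Nat.xor (act1 e (act1 e c)) c)) = true := by decide +kernel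

theorem Cubic.act1 {e c : ℕ} (he : e ∈ moves) (hc : Cubic c) : Cubic (act1 e c) := by
  have h := List.all_eq_true.1 moves_cubic e he
  rw [Bool.and_eq_true] at h
  exact Nat.xor_eq_zero_iff.1 (vanishesOff_zero_sound
    (((additive_act1 e).land cubMask).xor (additive_act1 e)) h.1 hc)

theorem act1_act1 {e c : ℕ} (he : e ∈ moves) (hc : Cubic c) : Cover.act1 e (Cover.act1 e c) = c := by
  have h := List.all_eq_true.1 moves_cubic e he
  rw [Bool.and_eq_true] at h
  exact Nat.xor_eq_zero_iff.1 (vanishesOff_zero_sound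
    (((additive_act1 e).comp (additive_act1 e)).xor additive_id) h.2 hc)

@[simp] theorem codeOf_nil : codeOf [] = 0 := rfl
@[simp] theorem codeOf_cons (p : ℕ) (D : List ℕ) : codeOf (p :: D) = mono p ^^^ codeOf D := rfl

theorem codeOf_append (D E : List ℕ) : codeOf (D ++ E) = codeOf D ^^^ codeOf E := by
  induction D with
  | nil => simp
  | cons p D ih => simp [ih, Nat.xor_assoc]

theorem Real.act1 {e c : ℕ} (he : e ∈ moves) (hc : Real c) : Real (act1 e c) := by
  obtain ⟨D, hl, hp, rfl⟩ := hc
  refine ⟨D.map (move (Nat.div e 10) (Nat.mod e 10)), by simpa using hl, ?_, ?_⟩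
  · intro q hq
    obtain ⟨p, hpD, rfl⟩ := List.mem_map.1 hq
    exact (act1_mono he (hp p hpD)).2
  · clear hl
    induction D with
    | nil => exact (additive_act1 e).zero.symm
    | cons p D ih =>
      rw [List.map_cons, codeOf_cons, codeOf_cons, additive_act1 e,
        (act1_mono he (hp p (by simp))).1, ih fun q hq => hp q (by simp [hq])]

theorem Cubic.act {w : List ℕ} {c : ℕ} (hw : validWord w = true) (hc : Cubic c) : Cubic (act w c) := by
  have hm := fun e he => mem_moves hw (e := e) he
  clear hw
  induction w generalizing c with
  | nil => exact hc
  | cons e w ih => exact ih (hc.act1 (hm e (by simp))) fun x hx => hm x (by simp [hx])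

theorem real_of_real_act {w : List ℕ} {c : ℕ} (hw : validWord w = true) (hc : Cubic c)
    (h : Real (act w c)) : Real c := by
  have hm := fun e he => mem_moves hw (e := e) he
  clear hw
  induction w generalizing c with
  | nil => exact h
  | cons e w ih =>
    rw [← act1_act1 (hm e (by simp)) hc]
    exact (ih (hc.act1 (hm e (by simp))) h fun x hx => hm x (by simp [hx])).act1 (hm e (by simp))

theorem xor_two_pow_of_testBit_false {v i : ℕ} (h : v.testBit i = false) : v ^^^ 2 ^ i = v + 2 ^ i := by
  have e1 : v = 2 ^ i * (v / 2 ^ i) + v % 2 ^ i := (Nat.div_add_mod v (2 ^ i)).symm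
  have hlt : v % 2 ^ i < 2 ^ i := Nat.mod_lt _ (by positivity)
  have h2 : (v / 2 ^ i) % 2 = 0 := by
    rw [Nat.testBit_eq_decide_div_mod_eq] at h
    simp at h; omega
  apply Nat.eq_of_testBit_eq
  intro j
  have e2 : v + 2 ^ i = 2 ^ i * (v / 2 ^ i + 1) + v % 2 ^ i := by
    conv_lhs => rw [e1]
    ring
  rw [e2, Nat.testBit_two_pow_mul_add _ hlt, Nat.testBit_xor, Nat.testBit_two_pow]
  split_ifs with hj
  · rw [Nat.testBit_mod_two_pow]
    have : ¬ i = j := by omega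
    simp [this, hj]
  · obtain ⟨k, rfl⟩ := Nat.exists_eq_add_of_le (not_lt.1 hj)
    have : (v.testBit (i + k)) = (v / 2 ^ i).testBit k := by
      rw [Nat.testBit_div_two_pow, Nat.add_comm]
    rw [this, Nat.add_sub_cancel_left]
    generalize v / 2 ^ i = a at *
    cases k with
    | zero =>
      simp only [Nat.add_zero, Nat.testBit_zero, decide_true]
      have : (a + 1) % 2 = 1 := by omega
      simp [h2, this]
    | succ k =>
      have e3 : (a + 1) / 2 = a / 2 := by omega
      simp only [Nat.testBit_succ, e3]
      simp

theorem xor_two_pow_of_testBit {v i : ℕ} (h : v.testBit i = true) :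
    2 ^ i ≤ v ∧ v ^^^ 2 ^ i = v - 2 ^ i := by
  have hw : (v ^^^ 2 ^ i).testBit i = false := by
    rw [Nat.testBit_xor, h, Nat.testBit_two_pow_self]; rfl
  have := xor_two_pow_of_testBit_false hw
  rw [Nat.xor_assoc, Nat.xor_self, Nat.xor_zero] at this
  omega

theorem testBit_sub_two_pow {v i : ℕ} (hv : 2 ^ i ≤ v) : (v - 2 ^ i).testBit i = !v.testBit i := by
  cases h : v.testBit i with
  | true =>
    rw [← (xor_two_pow_of_testBit h).2, Nat.testBit_xor, h, Nat.testBit_two_pow_self]; rfl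
  | false =>
    by_contra hw
    have hw : (v - 2 ^ i).testBit i = false := by simpa using hw
    have h1 := xor_two_pow_of_testBit_false hw
    have h2 : v = (v - 2 ^ i) ^^^ 2 ^ i := by omega
    rw [h2, Nat.testBit_xor, hw, Nat.testBit_two_pow_self] at h
    simp at h

theorem testBit_sub_two_pow_of_lt {v i n : ℕ} (hv : 2 ^ n ≤ v) (hi : i < n) :
    (v - 2 ^ n).testBit i = v.testBit i := by
  obtain ⟨w, rfl⟩ := Nat.exists_eq_add_of_le hv
  rw [Nat.add_sub_cancel_left]
  exact (Nat.testBit_two_pow_add_gt hi w).symm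

theorem testBit_full (n v : ℕ) : (full n).testBit v = decide (v < 2 ^ n) :=
  Nat.testBit_two_pow_sub_one (2 ^ n) v

theorem lo_succ (n i : ℕ) :
    lo (n + 1) i = cond (Nat.beq i n) (full n) (lo n i ||| lo n i <<< 2 ^ n) := by
  show cond _ _ (force _ _) = _
  rw [force_eq]; rfl

theorem testBit_lo {n i : ℕ} (hi : i < n) (v : ℕ) :
    (lo n i).testBit v = (decide (v < 2 ^ n) && !v.testBit i) := by
  induction n generalizing v with
  | zero => omega
  | succ n ih =>
    rw [lo_succ]
    have hpow : 2 ^ (n + 1) = 2 ^ n + 2 ^ n := by rw [pow_succ]; ring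
    rcases (Nat.lt_succ_iff.1 hi).eq_or_lt with rfl | hi'
    · rw [Nat.beq_refl, cond_true, testBit_full]
      by_cases hv : v < 2 ^ i
      · have : v < 2 ^ (i + 1) := by omega
        simp [hv, this, Nat.testBit_lt_two_pow hv]
      · by_cases hv' : v < 2 ^ (i + 1)
        · have := testBit_sub_two_pow (not_lt.1 hv)
          rw [Nat.testBit_lt_two_pow (by omega)] at this
          simp at this
          simp [hv, ← this]
        · simp [hv, hv']
    · have hb : Nat.beq i n = false := by
        cases h : Nat.beq i n
        · rfl
        · exact absurd (Nat.eq_of_beq_eq_true h) hi'.ne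
      rw [hb, cond_false, Nat.testBit_or, Nat.testBit_shiftLeft, ih hi', ih hi']
      by_cases hv : v < 2 ^ n
      · have : v < 2 ^ (n + 1) := by omega
        have h3 : ¬ 2 ^ n ≤ v := by omega
        simp [hv, this, h3]
      · rw [testBit_sub_two_pow_of_lt (not_lt.1 hv) hi']
        have h3 : 2 ^ n ≤ v := by omega
        have h4 : v - 2 ^ n < 2 ^ n ↔ v < 2 ^ (n + 1) := by omega
        simp [hv, h3, h4]

theorem testBit_flip {n i v : ℕ} (hi : i < n) (hv : v < 2 ^ n) (B : ℕ) :
    (flip n i B).testBit v = B.testBit (v ^^^ 2 ^ i) := by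
  rw [flip, force_eq]
  simp only [land_eq, lor_eq, shiftLeft_eq, shiftRight_eq]
  change (((B >>> 2 ^ i) &&& lo n i) ||| ((B &&& lo n i) <<< 2 ^ i)).testBit v = _
  rw [Nat.testBit_or, Nat.testBit_and, Nat.testBit_shiftRight, Nat.testBit_shiftLeft,
    Nat.testBit_and, testBit_lo hi, testBit_lo hi]
  cases h : v.testBit i with
  | false =>
    rw [xor_two_pow_of_testBit_false h, Nat.add_comm]
    by_cases hle : 2 ^ i ≤ v
    · simp [hv, testBit_sub_two_pow hle, h]
    · simp [hv, hle]
  | true =>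
    obtain ⟨hle, he⟩ := xor_two_pow_of_testBit h
    rw [he]
    have : v - 2 ^ i < 2 ^ n := lt_of_le_of_lt (Nat.sub_le _ _) hv
    simp [hle, testBit_sub_two_pow hle, h, this]

theorem testBit_translate {n u v : ℕ} (hu : u < 2 ^ n) (hv : v < 2 ^ n) (B : ℕ) :
    (translate n u B).testBit v = B.testBit (v ^^^ u) := by
  rw [translate, force_eq]
  suffices h : ∀ m ≤ n, ∀ w < 2 ^ n, (Nat.rec (motive := fun _ => ℕ) B
      (fun i B' => cond (tb u i) (flip n i B') B') m : ℕ).testBit w = B.testBit (w ^^^ (u % 2 ^ m)) by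
    have := h n le_rfl v hv
    rwa [Nat.mod_eq_of_lt hu] at this
  intro m
  induction m with
  | zero => intro _ w _; simp [Nat.mod_one]
  | succ m ih =>
    intro hm w hw
    have key : u % 2 ^ (m + 1) = (u % 2 ^ m) ^^^ (cond (u.testBit m) (2 ^ m) 0) := by
      apply Nat.eq_of_testBit_eq
      intro j
      rw [Nat.testBit_xor, Nat.testBit_mod_two_pow, Nat.testBit_mod_two_pow]
      rcases lt_trichotomy j m with h | h | h
      · cases u.testBit m <;> simp [h, h.ne', Nat.lt_succ_of_lt h]
      · subst h; cases h : u.testBit j <;> simp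
      · have h1 : ¬ j < m := by omega
        have h2 : ¬ j < m + 1 := by omega
        cases u.testBit m <;> simp [h1, h2, h.ne]
    rw [key]
    show Nat.testBit (cond (tb u m) _ _) w = _
    rw [tb_eq]
    cases u.testBit m with
    | false => simpa using ih (by omega) w hw
    | true =>
      rw [cond_true, cond_true, testBit_flip (by omega) hw, ih (by omega)
        _ (Nat.xor_lt_two_pow hw (Nat.pow_lt_pow_right (by norm_num) (by omega)))]
      congr 1; ac_rfl

/-- The transvection `100 i + j` acts on `n` digits. -/
def ValidOp (n e : ℕ) : Prop := e / 100 < n ∧ e % 100 < n ∧ e % 100 ≠ e / 100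

theorem transvect_eq (e v : ℕ) : transvect e v = v ^^^ cond (v.testBit (e % 100)) (2 ^ (e / 100)) 0 := by
  show v ^^^ (bitAt v (e % 100)) <<< (e / 100) = _
  rw [bitAt_eq]
  cases v.testBit (e % 100) <;> simp [Nat.shiftLeft_eq]

theorem transvect_lt {n e v : ℕ} (he : ValidOp n e) (hv : v < 2 ^ n) : transvect e v < 2 ^ n := by
  rw [transvect_eq]
  apply Nat.xor_lt_two_pow hv
  cases v.testBit (e % 100)
  · exact Nat.two_pow_pos n
  · exact Nat.pow_lt_pow_right (by norm_num) he.1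

theorem testBit_transvectSet {n e v : ℕ} (he : ValidOp n e) (hv : v < 2 ^ n) (B : ℕ) :
    (transvectSet n e B).testBit v = B.testBit (transvect e v) := by
  obtain ⟨h1, h2, h3⟩ := he
  rw [transvectSet, force_eq, force_eq, transvect_eq]
  change ((B ^^^ ((B >>> 2 ^ (e / 100) ^^^ B) &&& (lo n (e / 100) ^^^ (lo n (e / 100) &&& lo n (e % 100)))))
    ^^^ ((B >>> 2 ^ (e / 100) ^^^ B) &&& (lo n (e / 100) ^^^ (lo n (e / 100) &&& lo n (e % 100)))) <<<
      2 ^ (e / 100)).testBit v = _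
  simp only [Nat.testBit_xor, Nat.testBit_and, Nat.testBit_shiftRight, Nat.testBit_shiftLeft,
    testBit_lo h1, testBit_lo h2]
  generalize e / 100 = i at *
  generalize e % 100 = j at *
  cases h : v.testBit i with
  | false =>
    rw [show (2 ^ i + v) = v ^^^ 2 ^ i by rw [xor_two_pow_of_testBit_false h, Nat.add_comm]]
    by_cases hle : 2 ^ i ≤ v
    · cases v.testBit j <;> cases hb : B.testBit v <;> simp [hv, testBit_sub_two_pow hle, h, hb]
    · cases v.testBit j <;> cases hb : B.testBit v <;> simp [hv, hle, hb]
  | true =>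
    obtain ⟨hle, hx⟩ := xor_two_pow_of_testBit h
    have hj : (v - 2 ^ i).testBit j = v.testBit j := by
      rw [← hx, Nat.testBit_xor, Nat.testBit_two_pow, decide_eq_false (Ne.symm h3)]; simp
    have : v - 2 ^ i < 2 ^ n := lt_of_le_of_lt (Nat.sub_le _ _) hv
    rw [hj, testBit_sub_two_pow hle, h]
    have h4 : 2 ^ i + (v - 2 ^ i) = v := by omega
    cases v.testBit j <;> simp [hle, this, h4, hx]

theorem transvects_lt {n : ℕ} {ops : List ℕ} (h : ∀ e ∈ ops, ValidOp n e) {v : ℕ} (hv : v < 2 ^ n) :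
    transvects ops v < 2 ^ n := by
  induction ops generalizing v with
  | nil => exact hv
  | cons e l ih => exact ih (fun x hx => h x (by simp [hx])) (transvect_lt (h e (by simp)) hv)

theorem Gen.testBit_pre {g : Gen} {n : ℕ} (h : ∀ e ∈ g.ops, ValidOp n e) (hs : g.shift < 2 ^ n) {v : ℕ}
    (hv : v < 2 ^ n) (B : ℕ) : (g.pre n B).testBit v = B.testBit (g.map v) := by
  obtain ⟨w, ops, s⟩ := g
  unfold Gen.pre Gen.map
  simp only at h hs ⊢
  induction ops generalizing v with
  | nil => exact testBit_translate hs hv B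
  | cons e l ih =>
    rw [fold_cons, testBit_transvectSet (h e (by simp)) hv, transvects_cons]
    exact ih (transvect_lt (h e (by simp)) hv) fun x hx => h x (by simp [hx])

theorem saturate_sound {n : ℕ} {gens : List Gen} {Q : ℕ → Prop}
    (hg : ∀ g ∈ gens, (∀ e ∈ g.ops, ValidOp n e) ∧ g.shift < 2 ^ n ∧ ∀ v < 2 ^ n, Q (g.map v) → Q v)
    (sched : List ℕ) {B : ℕ} (hB : ∀ v < 2 ^ n, B.testBit v = true → Q v) :
    ∀ v < 2 ^ n, (saturate n gens sched B).testBit v = true → Q v := by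
  unfold saturate
  induction sched generalizing B with
  | nil => exact hB
  | cons k l ih =>
    rw [fold_cons, force_eq]
    apply ih
    intro v hv h
    rw [lor_eq, Nat.testBit_or, Bool.or_eq_true] at h
    rcases h with h | h
    · exact hB v hv h
    · by_cases hk : k < gens.length
      · have hmem : gens.getD k ⟨[], [], 0⟩ ∈ gens := by
          rw [List.getD_eq_getElem _ _ hk]; exact List.getElem_mem hk
        obtain ⟨h1, h2, h3⟩ := hg _ hmem
        rw [Gen.testBit_pre h1 h2 hv] at h
        refine h3 v hv (hB _ ?_ h)
        exact Nat.xor_lt_two_pow (transvects_lt h1 hv) h2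
      · rw [List.getD_eq_default _ _ (by omega), Gen.testBit_pre (by simp) (Nat.two_pow_pos n) hv] at h
        simp only [Gen.map, transvects_nil, xor_eq, Nat.xor_zero] at h
        exact hB v hv h

theorem testBit_bitset (vs : List ℕ) (v : ℕ) : (bitset vs).testBit v = decide (v ∈ vs) := by
  unfold bitset
  induction vs with
  | nil => simp
  | cons u vs ih =>
    rw [fold_cons, lor_eq, shiftLeft_eq, Nat.testBit_or, ih, Nat.one_shiftLeft, Nat.testBit_two_pow]
    simp [eq_comm]

/-- Every code of the family `(F, c₀)` is representable. -/
def FamReal (F c₀ : ℕ) : Prop := ∀ c, Fam F c₀ c → Real c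

theorem Fam.cubic_base {F c₀ c : ℕ} (h : Fam F c₀ c) : Cubic c₀ := h.2 ▸ h.1.land F

theorem Fam.base {F c₀ c : ℕ} (h : Fam F c₀ c) : Fam F c₀ c₀ :=
  ⟨h.cubic_base, by rw [← h.2, Nat.and_assoc, Nat.and_self]⟩

theorem fam_act {F c₀ c F' c₁ : ℕ} {w : List ℕ} (hc : Fam F c₀ c) (hw : validWord w = true)
    (h₀ : Nat.land (act w c₀) F' = c₁) (hv : vanishesOff F (fun c => Nat.land (act w c) F') = true) :
    Fam F' c₁ (act w c) :=
  ⟨hc.1.act hw, (hc.const ((additive_act w).land F') hv).trans h₀⟩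

theorem fam_act_of_preserves {F c₀ c : ℕ} {w : List ℕ} (hc : Fam F c₀ c)
    (h : preserves F c₀ w = true) : validWord w = true ∧ Fam F c₀ (act w c) := by
  simp only [preserves, Bool.and_eq_true, Nat.beq_eq] at h
  exact ⟨h.1, fam_act hc h.1 h.2.1 h.2.2⟩

theorem wordCheck_sound {F c₀ F' c₁ : ℕ} {w : List ℕ} (h : wordCheck F c₀ F' c₁ w = true)
    (hF : FamReal F' c₁) : FamReal F c₀ := by
  simp only [wordCheck, Bool.and_eq_true, Nat.beq_eq] at h
  exact fun c hc => real_of_real_act h.1 hc.1 (hF _ (fam_act hc h.1 h.2.1 h.2.2))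

/-- All codes of the family `(F, c₀)` with state `v` are representable. -/
def StateReal (F c₀ : ℕ) (st : ℕ → ℕ) (v : ℕ) : Prop := ∀ c, Fam F c₀ c → st c = v → Real c

theorem Gen.check_sound {g : Gen} {F c₀ n : ℕ} {st : ℕ → ℕ} (hst : Additive st)
    (h : g.check F c₀ n st = true) : (∀ e ∈ g.ops, ValidOp n e) ∧ g.shift < 2 ^ n ∧
      ∀ v < 2 ^ n, StateReal F c₀ st (g.map v) → StateReal F c₀ st v := by
  simp only [Gen.check, Bool.and_eq_true, Nat.beq_eq, allOf_iff, Nat.blt_eq,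
    Bool.not_eq_true'] at h
  obtain ⟨hp, hops, hs, h0, hv⟩ := h
  refine ⟨fun e he => ?_, hs, fun v _ hQ c hc hcv => ?_⟩
  · obtain ⟨h1, h2, h3⟩ := hops e he
    exact ⟨h1, h2, fun hh => by rw [show Nat.mod e _ = Nat.div e _ from hh, Nat.beq_refl] at h3; cases h3⟩
  · obtain ⟨hw, hc'⟩ := fam_act_of_preserves hc hp
    refine real_of_real_act hw hc.1 (hQ _ hc' ?_)
    have := (hc.const ((hst.comp (additive_act g.word)).xor
      ((additive_transvects g.ops).comp hst)) hv).trans h0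
    rw [hcv, xor_eq] at this
    rw [Gen.map, xor_eq, ← this, Nat.xor_comm, Nat.xor_assoc, Nat.xor_self, Nat.xor_zero]

theorem Fam.set_bit {F c₀ c q : ℕ} (hc : Fam F c₀ c) (hq : c.testBit q = c₀.testBit q) :
    Fam (F ||| 1 <<< q) c₀ c := by
  refine ⟨hc.1, Nat.eq_of_testBit_eq fun i => ?_⟩
  have h := congrArg (fun x => x.testBit i) hc.2
  simp only [Nat.testBit_and] at h
  rw [Nat.testBit_and, Nat.testBit_or, Nat.one_shiftLeft, Nat.testBit_two_pow]
  by_cases hi : q = i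
  · subst hi; simp [hq]
  · simpa [hi] using h

theorem killCheck_sound {c₀ : ℕ} {st : ℕ → ℕ} (hst : Additive st) {kills : List (ℕ × List ℕ)} {F : ℕ}
    {k : ℕ → Bool} (h : killCheck c₀ st kills F k = true) :
    ∃ F₁, k F₁ = true ∧ ∀ v, StateReal F₁ c₀ st v → StateReal F c₀ st v := by
  unfold killCheck at h
  induction kills generalizing F with
  | nil => exact ⟨F, h, fun v hv => hv⟩
  | cons q l ih =>
    rw [fold_cons] at h
    simp only [Bool.and_eq_true, Nat.beq_eq] at h
    obtain ⟨hp, hs0, hsv, hb0, hbv, hr⟩ := h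
    obtain ⟨F₁, hk, hF₁⟩ := ih hr
    refine ⟨F₁, hk, fun v hv c hc hcv => ?_⟩
    have hv' := hF₁ v hv
    by_cases hq : c.testBit q.1 = c₀.testBit q.1
    · exact hv' c (hc.set_bit hq) hcv
    · obtain ⟨hw, hc'⟩ := fam_act_of_preserves hc hp
      refine real_of_real_act hw hc.1 (hv' _ (hc'.set_bit ?_) ?_)
      · have h1 := (hc.const (((additive_bitAt q.1).comp (additive_act q.2)).xor
          (additive_bitAt q.1)) hbv).trans hb0
        rw [xor_eq, bitAt_eq, bitAt_eq] at h1
        revert h1 hq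
        cases (act q.2 c).testBit q.1 <;> cases c.testBit q.1 <;> cases c₀.testBit q.1 <;> simp
      · have h1 := (hc.const ((hst.comp (additive_act q.2)).xor hst) hsv).trans hs0
        rw [← hcv]
        exact Nat.xor_eq_zero_iff.1 h1

theorem xor_lt {a b n : ℕ} (ha : a < 2 ^ n) (hb : b < 2 ^ n) : a ^^^ b < 2 ^ n := Nat.xor_lt_two_pow ha hb

theorem gather_lt (Ss : List ℕ) (c : ℕ) : gather Ss c < 2 ^ Ss.length := by
  induction Ss with
  | nil => simp [gather]
  | cons S Ss ih =>
    show (gather Ss c) <<< 1 ^^^ bitAt c S < 2 ^ (Ss.length + 1)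
    apply xor_lt
    · rw [Nat.shiftLeft_eq, pow_succ]; omega
    · exact lt_of_le_of_lt (bitAt_le c S) (Nat.one_lt_two_pow (by omega))

theorem eq_xor_of_xor_eq {a b c : ℕ} (h : a ^^^ b = c) : a = c ^^^ b := by
  rw [← h, Nat.xor_assoc, Nat.xor_self, Nat.xor_zero]

theorem stepCheck_sound {F c₀ F' : ℕ} {Ss : List ℕ} {gens : List Gen} {sched : List ℕ}
    {kills : List (ℕ × List ℕ)} {reps : List ℕ}
    (h : stepCheck F c₀ F' Ss gens sched kills reps = true)
    (hr : ∀ v ∈ reps, FamReal F' (c₀ ^^^ scatter Ss v)) : FamReal F c₀ := by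
  simp only [stepCheck, force_eq, Bool.and_eq_true, Nat.beq_eq, allOf_iff, len_eq] at h
  obtain ⟨hg, hsat, hk⟩ := h
  obtain ⟨F₁, hk, hF₁⟩ := killCheck_sound (additive_gather Ss) hk
  simp only [Bool.and_eq_true, Nat.beq_eq] at hk
  have key : ∀ v < 2 ^ Ss.length, StateReal F c₀ (gather Ss) v := by
    intro v hv
    refine saturate_sound (fun g hgm => Gen.check_sound (additive_gather Ss) (hg g hgm)) sched
      (B := bitset reps) ?_ v hv (by rw [hsat, testBit_full]; simpa using hv)
    intro v _ hvr
    rw [testBit_bitset, decide_eq_true_eq] at hvr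
    refine hF₁ v fun c hc hcv => hr v hvr c ⟨hc.1, ?_⟩
    have h1 := (hc.const ((additive_id.land F').xor
      ((additive_scatter Ss).comp (additive_gather Ss))) hk.2).trans hk.1
    rw [hcv] at h1
    exact eq_xor_of_xor_eq h1
  exact fun c hc => key _ (gather_lt Ss c) c hc rfl

/-! ### Covers -/
theorem reduce_cons (q : ℕ × ℕ) (L : List (ℕ × ℕ)) (c : ℕ) :
    reduce (q :: L) c = reduce L (c ^^^ bitAt c q.1 * q.2) := by
  unfold reduce
  rw [fold_cons, force_eq]; rfl

/-- Translations of the family that do not affect representability. -/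
def Neutral (F c₀ k : ℕ) : Prop := ∀ c, Fam F c₀ c → Fam F c₀ (c ^^^ k) ∧ (Real (c ^^^ k) → Real c)

theorem Neutral.zero (F c₀ : ℕ) : Neutral F c₀ 0 := fun c hc => by simpa using hc

theorem Neutral.xor {F c₀ a b : ℕ} (ha : Neutral F c₀ a) (hb : Neutral F c₀ b) :
    Neutral F c₀ (a ^^^ b) := fun c hc => by
  obtain ⟨h1, h2⟩ := ha c hc
  obtain ⟨h3, h4⟩ := hb _ h1
  rw [Nat.xor_assoc] at h3 h4
  exact ⟨h3, fun h => h2 (h4 h)⟩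

theorem Neutral.bitAt_mul {F c₀ k : ℕ} (h : Neutral F c₀ k) (c i : ℕ) :
    Neutral F c₀ (bitAt c i * k) := by
  have := bitAt_le c i
  interval_cases bitAt c i
  · simpa using Neutral.zero F c₀
  · simpa using h

theorem exists_reduce_eq {F c₀ : ℕ} {L : List (ℕ × ℕ)} (hL : ∀ q ∈ L, Neutral F c₀ q.2) (c : ℕ) :
    ∃ k, Neutral F c₀ k ∧ reduce L c = c ^^^ k := by
  induction L generalizing c with
  | nil => exact ⟨0, Neutral.zero F c₀, (Nat.xor_zero c).symm⟩
  | cons q L ih =>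
    obtain ⟨k, hk, he⟩ := ih (fun q hq => hL q (by simp [hq])) (c ^^^ bitAt c q.1 * q.2)
    refine ⟨_, ((hL q (by simp)).bitAt_mul c q.1).xor hk, ?_⟩
    rw [reduce_cons, he, Nat.xor_assoc]

theorem real_reduce_iff {F c₀ : ℕ} {L : List (ℕ × ℕ)} (hL : ∀ q ∈ L, Neutral F c₀ q.2) {c : ℕ}
    (hc : Fam F c₀ c) : Real (reduce L c) ↔ Real c := by
  obtain ⟨k, hk, he⟩ := exists_reduce_eq hL c
  rw [he]
  refine ⟨(hk c hc).2, fun h => (hk _ (hk c hc).1).2 ?_⟩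
  rwa [Nat.xor_assoc, Nat.xor_self, Nat.xor_zero]

theorem shiftCheck_sound {F c₀ : ℕ} {w : List ℕ} (h : shiftCheck F c₀ w = true) :
    Neutral F c₀ (act w c₀ ^^^ c₀) := by
  simp only [shiftCheck, Bool.and_eq_true, Nat.beq_eq] at h
  intro c hc
  have h1 : act w c = c ^^^ (act w c₀ ^^^ c₀) := by
    rw [Nat.xor_comm c]
    exact eq_xor_of_xor_eq (hc.const ((additive_act w).xor additive_id) h.2.2)
  rw [← h1]
  refine ⟨⟨hc.1.act h.1, ?_⟩, real_of_real_act h.1 hc.1⟩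
  have h2 : (act w c₀ ^^^ c₀) &&& F = 0 := h.2.1
  rw [h1, Nat.and_xor_distrib_right, h2, Nat.xor_zero, hc.2]

theorem echelon_sound {F c₀ : ℕ} {ws : List (List ℕ)} (hw : ∀ w ∈ ws, shiftCheck F c₀ w = true)
    {L : List (ℕ × ℕ)} (hL : ∀ q ∈ L, Neutral F c₀ q.2) :
    ∀ q ∈ echelon c₀ ws L, Neutral F c₀ q.2 := by
  induction ws generalizing L with
  | nil => exact hL
  | cons w ws ih =>
    have ih' := fun L => ih (L := L) fun w hw' => hw w (by simp [hw'])
    have he : echelon c₀ (w :: ws) L = cond (Nat.beq (reduce L (act w c₀ ^^^ c₀)) 0) (echelon c₀ ws L)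
        (echelon c₀ ws (L ++ [(Nat.log2 (reduce L (act w c₀ ^^^ c₀)), reduce L (act w c₀ ^^^ c₀))])) := by
      conv_lhs => unfold echelon
      rw [fold_cons, force_eq]; rfl
    rw [he]
    cases Nat.beq (reduce L (act w c₀ ^^^ c₀)) 0 with
    | true => exact ih' L hL
    | false =>
      apply ih'
      intro q hq
      rcases List.mem_append.1 hq with hq | hq
      · exact hL q hq
      · rw [List.mem_singleton] at hq
        subst hq
        obtain ⟨k, hk, hk'⟩ := exists_reduce_eq hL (act w c₀ ^^^ c₀)
        show Neutral F c₀ (reduce L (act w c₀ ^^^ c₀))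
        rw [hk']
        exact (shiftCheck_sound (hw w (by simp))).xor hk

theorem additive_squash (T : ℕ) : Additive (squash T) := by
  intro a b
  simp only [squash, force_eq]
  have h1 := additive_id.land T
  have h2 := h1.xor (h1.shiftRight 228)
  have h3 := h2.xor (h2.shiftRight 114)
  exact (h3.xor (h3.shiftRight 57)).land _ a b

theorem select_cons (q : ℕ × ℕ) (tbl : List (ℕ × ℕ)) (c : ℕ) :
    select (q :: tbl) c = (bitAt c q.1 * q.2) ^^^ select tbl c := by
  unfold select
  rw [force_eq, force_eq]; rfl

theorem additive_select (tbl : List (ℕ × ℕ)) : Additive (select tbl) := by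
  induction tbl with
  | nil => intro a b; simp only [select, force_eq, fold_nil]; exact (Nat.xor_self 0).symm
  | cons q tbl ih =>
    have : select (q :: tbl) = fun c => Nat.xor (Nat.mul (bitAt c q.1) q.2) (select tbl c) := by
      funext c; exact select_cons q tbl c
    rw [this]
    exact ((additive_bitAt q.1).mul (fun c => bitAt_le c q.1) q.2).xor ih

theorem select_lt {tbl : List (ℕ × ℕ)} {n : ℕ} (h : ∀ q ∈ tbl, q.2 < 2 ^ n) (c : ℕ) :
    select tbl c < 2 ^ n := by
  induction tbl with
  | nil => simp [select, force_eq]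
  | cons q tbl ih =>
    rw [select_cons]
    refine xor_lt ?_ (ih fun q hq => h q (by simp [hq]))
    have := bitAt_le c q.1
    interval_cases bitAt c q.1
    · simp
    · simpa using h q (by simp)

/-- States of sums of at most `l` points whose code has restriction `k` to `O`. -/
def Reach (O : ℕ) (st : ℕ → ℕ) (k l v : ℕ) : Prop :=
  ∃ D : List ℕ, D.length ≤ l ∧ (∀ p ∈ D, p < 512) ∧ codeOf D &&& O = k ∧ st (codeOf D) = v

theorem sumOptions_sound {n k₁ l₁ O : ℕ} {st : ℕ → ℕ} (hst : Additive st) (hlt : ∀ c, st c < 2 ^ n)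
    {k l B : ℕ} (hB : ∀ v < 2 ^ n, B.testBit v = true → Reach O st k l v) (opts : List (List ℕ)) :
    ∀ v < 2 ^ n, (sumOptions n k₁ l₁ O st B opts).testBit v = true →
      Reach O st (k ^^^ k₁) (l + l₁) v := by
  unfold sumOptions
  induction opts with
  | nil => intro v _ h; simp at h
  | cons D opts ih =>
    rw [fold_cons, forceList_eq, force_eq]
    intro v hv h
    cases hc : (and (Nat.beq (Nat.land (codeOf D) O) k₁) (and (Nat.beq (len D) l₁)
      (allOf D fun p => Nat.blt p 512))) with
    | false => rw [hc] at h; exact ih v hv h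
    | true =>
      rw [hc, cond_true, lor_eq, Nat.testBit_or, Bool.or_eq_true] at h
      rcases h with h | h
      · exact ih v hv h
      · rw [testBit_translate (hlt _) hv] at h
        simp only [Bool.and_eq_true, Nat.beq_eq, len_eq, allOf_iff, Nat.blt_eq] at hc
        obtain ⟨E, hl, hp, hk, hs⟩ := hB _ (xor_lt hv (hlt _)) h
        refine ⟨E ++ D, by rw [List.length_append]; omega, ?_, ?_, ?_⟩
        · intro p hpm
          rcases List.mem_append.1 hpm with h | h
          · exact hp p h
          · exact hc.2.2 p h
        · rw [codeOf_append, Nat.and_xor_distrib_right, hk, show codeOf D &&& O = k₁ from hc.1]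
        · rw [codeOf_append, hst, hs, Nat.xor_assoc, Nat.xor_self, Nat.xor_zero]

theorem productSet_sound {n O c₀ : ℕ} {st : ℕ → ℕ} (hst : Additive st) (hlt : ∀ c, st c < 2 ^ n)
    (groups : List (List (List ℕ))) {k l B : ℕ}
    (hB : ∀ v < 2 ^ n, B.testBit v = true → Reach O st k l v) :
    ∀ v < 2 ^ n, (productSet n O c₀ st groups k l B).testBit v = true → Reach O st c₀ 32 v := by
  unfold productSet
  induction groups generalizing k l B with
  | nil =>
    rw [fold_nil]
    intro v hv h
    cases hc : and (Nat.beq k c₀) (Nat.ble l 32) with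
    | false => simp [hc] at h
    | true =>
      simp only [hc, cond_true] at h
      simp only [Bool.and_eq_true, Nat.beq_eq, Nat.ble_eq] at hc
      obtain ⟨D, hl, hp, hk, hs⟩ := hB v hv h
      exact ⟨D, hl.trans hc.2, hp, hk.trans hc.1, hs⟩
  | cons opts groups ih =>
    rw [fold_cons, force_eq, force_eq, force_eq]
    exact ih (sumOptions_sound hst hlt hB opts)

theorem codeOf_and_lowMask (D : List ℕ) : codeOf D &&& lowMask = codeOf D := by
  induction D with
  | nil => simp
  | cons p D ih =>
    rw [codeOf_cons, Nat.and_xor_distrib_right, ih]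
    congr 1
    rw [mono, force_eq, land_eq, Nat.and_assoc, Nat.and_self]

theorem fam_codeOf {F c₀ : ℕ} (h₀ : Fam F c₀ c₀) {D : List ℕ}
    (hD : codeOf D &&& (lowMask ^^^ ((F ^^^ cubMask) &&& cubMask)) = c₀) : Fam F c₀ (codeOf D) := by
  have hsub : ∀ i, cubMask.testBit i = true → lowMask.testBit i = true := by
    intro i hi
    have : cubMask &&& lowMask = cubMask := by decide +kernel
    rw [← this, Nat.testBit_and, Bool.and_eq_true] at hi
    exact hi.2
  have key : ∀ i, (codeOf D).testBit i = true → (cubMask.testBit i = false ∨ F.testBit i = true) →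
      c₀.testBit i = true := by
    intro i hi hor
    have hlow : lowMask.testBit i = true := by
      rw [← codeOf_and_lowMask, Nat.testBit_and, Bool.and_eq_true] at hi
      exact hi.2
    rw [← hD]
    simp only [Nat.testBit_and, Nat.testBit_xor, hi, hlow]
    rcases hor with h | h
    · simp [h]
    · cases h' : cubMask.testBit i <;> simp [h]
  have hc0 : ∀ i, c₀.testBit i = true → (codeOf D).testBit i = true ∧ cubMask.testBit i = true ∧
      F.testBit i = true := by
    intro i hi
    have h1 := h₀.1
    have h2 := h₀.2
    refine ⟨?_, ?_, ?_⟩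
    · rw [← hD, Nat.testBit_and, Bool.and_eq_true] at hi; exact hi.1
    · rw [← h1, Nat.testBit_and, Bool.and_eq_true] at hi; exact hi.2
    · rw [← h2, Nat.testBit_and, Bool.and_eq_true] at hi; exact hi.2
  constructor
  · apply Nat.eq_of_testBit_eq
    intro i
    rw [Nat.testBit_and]
    cases h : (codeOf D).testBit i
    · rfl
    · cases h' : cubMask.testBit i
      · exact absurd (hc0 i (key i h (Or.inl h'))).2.1 (by simp [h'])
      · rfl
  · apply Nat.eq_of_testBit_eq
    intro i
    rw [Nat.testBit_and]
    cases h' : F.testBit i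
    · rw [Bool.and_false]
      by_contra hne
      have := hc0 i (by cases hh : c₀.testBit i <;> simp_all)
      simp [h'] at this
    · cases h : (codeOf D).testBit i
      · cases h2 : c₀.testBit i
        · rfl
        · exact absurd (hc0 i h2).1 (by simp [h])
      · simp [key i h (Or.inr h')]

theorem coverCheck_sound {F c₀ : ℕ} {T : List ℕ} {shifts : List (List ℕ)} {gens : List Gen}
    {sched : List ℕ} {prods : List (List (List (List ℕ)))}
    (h : coverCheck F c₀ T shifts gens sched prods = true) : FamReal F c₀ := by
  simp only [coverCheck, forcePairs_eq, forceList_eq, force_eq, Bool.and_eq_true, Nat.beq_eq,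
    allOf_iff] at h
  obtain ⟨hsh, hlt, hconst, hg, -, hsat⟩ := h
  have hL := echelon_sound hsh (L := []) (by simp)
  generalize echelon c₀ shifts [] = L at *
  generalize (T.filter fun S => allOf L fun q => not (Nat.beq q.1 S)) = Ts at *
  generalize (T.map fun S => (Nat.mod S 57, gather Ts (reduce L (Nat.shiftLeft 1 S)))) = tbl at *
  generalize len Ts = n at *
  have hst : Additive fun c => select tbl (squash (bitset T) c) :=
    (additive_select tbl).comp (additive_squash _)
  have hlt' : ∀ c, select tbl (squash (bitset T) c) < 2 ^ n := fun c =>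
    select_lt (fun q hq => by simpa [Nat.blt_eq] using hlt q hq) _
  intro c hc
  refine saturate_sound (fun g hgm => Gen.check_sound hst (hg g hgm)) sched ?_ _ (hlt' c)
    (by rw [hsat, testBit_full]; simpa using hlt' c) c hc rfl
  clear hsat
  intro v hv hB
  suffices hR : Reach (lowMask ^^^ ((F ^^^ cubMask) &&& cubMask))
      (fun c => select tbl (squash (bitset T) c)) c₀ 32 v by
    intro c hc hcv
    obtain ⟨D, hl, hp, hk, hs⟩ := hR
    have hD := fam_codeOf hc.base hk
    have e1 := hc.const ((additive_reduce L).xor ((additive_scatter Ts).comp hst)) hconst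
    have e2 := hD.const ((additive_reduce L).xor ((additive_scatter Ts).comp hst)) hconst
    simp only [xor_eq] at e1 e2
    have hcv' : select tbl (squash (bitset T) c) = v := hcv
    have hs' : select tbl (squash (bitset T) (codeOf D)) = v := hs
    rw [hcv'] at e1
    rw [hs'] at e2
    rw [← real_reduce_iff hL hc, eq_xor_of_xor_eq e1, ← eq_xor_of_xor_eq e2, real_reduce_iff hL hD]
    exact ⟨D, hl, hp, rfl⟩
  revert hB
  induction prods with
  | nil => intro hB; simp at hB
  | cons P prods ih =>
    rw [fold_cons, lor_eq, Nat.testBit_or, Bool.or_eq_true]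
    rintro (hB | hB)
    · refine productSet_sound hst hlt' P (l := 0) (k := 0) (B := 1) ?_ v hv hB
      intro v _ hv1
      have : v = 0 := by
        by_contra hne
        rw [Nat.testBit_lt_two_pow (Nat.one_lt_two_pow hne)] at hv1
        simp at hv1
      subst this
      exact ⟨[], by simp, by simp, by simp, hst.zero⟩
    · exact ih hB

theorem famReal_zero_of_split {F c₀ S F' c₁ : ℕ} {w : List ℕ}
    (h : wordCheck (F ||| 1 <<< S) (c₀ ||| 1 <<< S) F' c₁ w = true) (hF : FamReal F' c₁)
    (hz : FamReal (F ||| 1 <<< S) c₀) : FamReal F c₀ := by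
  intro c hc
  cases hS : c.testBit S with
  | true =>
    refine wordCheck_sound h hF c ⟨hc.1, ?_⟩
    apply Nat.eq_of_testBit_eq
    intro i
    rw [Nat.and_or_distrib_left, hc.2, Nat.testBit_or, Nat.testBit_or, Nat.testBit_and, Nat.one_shiftLeft,
      Nat.testBit_two_pow]
    by_cases hi : S = i
    · subst hi; simp [hS]
    · simp [hi]
  | false =>
    refine hz c (hc.set_bit ?_)
    rw [hS, ← hc.2, Nat.testBit_and, hS]; rfl

/-- Successively fix the bits of the list to `0`; if a bit is `1`, the word leads to `(F', c₁)`. -/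
def splitCheck (c₀ F' c₁ F₁ : ℕ) (l : List (ℕ × List ℕ)) (F : ℕ) : Bool :=
  fold l (fun F => Nat.beq F F₁) (fun q r F =>
    force (Nat.shiftLeft (nat_lit 1) q.1) fun b => force (Nat.lor F b) fun F =>
      and (wordCheck F (Nat.lor c₀ b) F' c₁ q.2) (r F)) F

theorem splitCheck_sound {c₀ F' c₁ F₁ : ℕ} (hF : FamReal F' c₁) (h₁ : FamReal F₁ c₀)
    {l : List (ℕ × List ℕ)} {F : ℕ} (h : splitCheck c₀ F' c₁ F₁ l F = true) : FamReal F c₀ := by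
  unfold splitCheck at h
  induction l generalizing F with
  | nil => rw [fold_nil, Nat.beq_eq] at h; rwa [h]
  | cons q l ih =>
    rw [fold_cons, force_eq, force_eq, Bool.and_eq_true] at h
    exact famReal_zero_of_split h.1 hF (ih h.2)

/-- Reduction of the families `(F, c₀ + scatter Ss v)` to `(F', c₁)` by words. -/
def wordsCheck (F c₀ F' c₁ : ℕ) (Ss : List ℕ) (l : List (ℕ × List ℕ)) : Bool :=
  allOf l fun q => force (Nat.xor c₀ (scatter Ss q.1)) fun c => wordCheck F c F' c₁ q.2

theorem wordsCheck_sound {F c₀ F' c₁ : ℕ} {Ss : List ℕ} {l : List (ℕ × List ℕ)}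
    (h : wordsCheck F c₀ F' c₁ Ss l = true) (hF : FamReal F' c₁) :
    ∀ v ∈ l.map Prod.fst, FamReal F (c₀ ^^^ scatter Ss v) := by
  simp only [wordsCheck, allOf_iff, force_eq] at h
  intro v hv
  obtain ⟨q, hq, rfl⟩ := List.mem_map.1 hv
  exact wordCheck_sound (h q hq) hF

/-- Explicit point sets for the codes `c₀ + scatter Ss v`. -/
def leavesCheck (F c₀ : ℕ) (Ss : List ℕ) (l : List (ℕ × List ℕ)) : Bool :=
  and (vanishesOff F fun c => c) <|
  allOf l fun q => and (Nat.beq (codeOf q.2) (Nat.xor c₀ (scatter Ss q.1))) <|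
    and (Nat.ble (len q.2) (nat_lit 32)) (allOf q.2 fun p => Nat.blt p (nat_lit 512))

theorem leavesCheck_sound {F c₀ : ℕ} {Ss : List ℕ} {l : List (ℕ × List ℕ)}
    (h : leavesCheck F c₀ Ss l = true) :
    ∀ v ∈ l.map Prod.fst, FamReal F (c₀ ^^^ scatter Ss v) := by
  simp only [leavesCheck, allOf_iff, Bool.and_eq_true, Nat.beq_eq, Nat.ble_eq, Nat.blt_eq, len_eq] at h
  intro v hv c hc
  obtain ⟨q, hq, rfl⟩ := List.mem_map.1 hv
  obtain ⟨h1, h2, h3⟩ := h.2 q hq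
  have : c = c₀ ^^^ scatter Ss q.1 := hc.const additive_id h.1
  exact ⟨q.2, h2, h3, h1.trans this.symm⟩

/-- Covers of the families `(F, c₀ + scatter Ss v)`. -/
def coversCheck (F c₀ : ℕ) (T : List ℕ) (Ss : List ℕ) (shifts : List (List ℕ)) (v : ℕ)
    (gens : List Gen) (sched : List ℕ) (prods : List (List (List (List ℕ)))) : Bool :=
  force (Nat.xor c₀ (scatter Ss v)) fun c => coverCheck F c T shifts gens sched prods

/-- Covers by four groups of six-point sets and one group of eight-point sets, without generators. -/
def simpleCovers (F c₀ : ℕ) (T Ss : List ℕ) (shifts : List (List ℕ)) (oc : List ℕ)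
    (data : List (ℕ × ℕ × List ℕ)) : Bool :=
  allOf data fun q => coversCheck F c₀ T Ss shifts q.1 [] []
    [(q.2.2.map sixes) ++ [(octs oc).take q.2.1]]

theorem simpleCovers_sound {F c₀ : ℕ} {T Ss : List ℕ} {shifts : List (List ℕ)} {oc : List ℕ}
    {data : List (ℕ × ℕ × List ℕ)} (h : simpleCovers F c₀ T Ss shifts oc data = true) :
    ∀ v ∈ data.map Prod.fst, FamReal F (c₀ ^^^ scatter Ss v) := by
  simp only [simpleCovers, coversCheck, force_eq, allOf_iff] at h
  intro v hv
  obtain ⟨q, hq, rfl⟩ := List.mem_map.1 hv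
  exact coverCheck_sound (h q hq)

theorem coversCheck_sound {F c₀ : ℕ} {T Ss : List ℕ} {shifts : List (List ℕ)} {u : ℕ}
    {gens : List Gen} {sched : List ℕ} {prods : List (List (List (List ℕ)))}
    (h : coversCheck F c₀ T Ss shifts u gens sched prods = true) :
    ∀ v ∈ [u], FamReal F (c₀ ^^^ scatter Ss v) := by
  intro v hv
  rw [List.mem_singleton] at hv
  subst hv
  rw [coversCheck, force_eq] at h
  exact coverCheck_sound h

theorem famReal_append {F c₀ : ℕ} {Ss l₁ l₂ : List ℕ}
    (h₁ : ∀ v ∈ l₁, FamReal F (c₀ ^^^ scatter Ss v)) (h₂ : ∀ v ∈ l₂, FamReal F (c₀ ^^^ scatter Ss v)) :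
    ∀ v ∈ l₁ ++ l₂, FamReal F (c₀ ^^^ scatter Ss v) := by
  intro v hv
  rcases List.mem_append.1 hv with hv | hv
  exacts [h₁ v hv, h₂ v hv]

theorem famReal_singleton {F c₀ c₁ u : ℕ} {Ss : List ℕ} (h : FamReal F c₁)
    (hu : Nat.beq (Nat.xor c₀ (scatter Ss u)) c₁ = true) :
    ∀ v ∈ [u], FamReal F (c₀ ^^^ scatter Ss v) := by
  intro v hv
  rw [List.mem_singleton] at hv
  subst hv
  rw [Nat.beq_eq] at hu
  rwa [show c₀ ^^^ scatter Ss v = c₁ from hu]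

/-! ### The case `{1, 2, 3}` -/

/-- Positions of the free bits of the covers. -/
def T6 : List ℕ := [56, 88, 152, 280, 104, 168, 296, 200, 328, 392, 112, 176, 304, 208, 336, 400,
  224, 352, 416, 448]

/-- The complement of `T6`. -/
def F6 : ℕ := 866844136320678542717130597004360804337751397127226111766350896761662814762903482948092286888212630108879435860568192

/-- Fixed bits: all `{i, j, k}` with at least two of `0, 1, 2`, and all `{0, i, j}`. -/
def F5 : ℕ := 78804012392788958428830054273123709496197742721275905000624065560972567175514378241996022681024510152970841308555392

/-- Fixed bits: all `{i, j, k}` with at least two of `0, 1, 2`. -/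
def FB : ℕ := 12042377280680884324051382440903542416775467771386396260305698157379981853354112

/-- Fixed bits: all `{0, 1, k}` and `{0, 2, k}`, and `{1, 2, 3}`. -/
def FB0 : ℕ := 4631683569492647816942839400347516314144410681302460100117576214376916097460352

/-- The bits `{1, i, j}` and `{2, i, j}` with `4 ≤ i < j`. -/
def S20 : List ℕ := [50, 82, 146, 274, 98, 162, 290, 194, 322, 386, 52, 84, 148, 276, 100, 164,
  292, 196, 324, 388]

/-- Words acting on the covered families by translations. -/
def KW : List (List ℕ) := [[30], [40], [50], [60], [70], [80], [31], [32]]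

/-- The code `{1, 2, 3}`. -/
def c123 : ℕ := 16384

/-- The code of a form together with `{1, 2, 3}`. -/
def cA0 : ℕ := 78804012392788958424558080200287227610159478540930893335896586808491443542994421222828690966094859810288443102085120

def cA1 : ℕ := 158456325028528675187121471488

def cA2 : ℕ := 12554203470773361527671578846415332832204711451878022463488

def cA3 : ℕ := 33570816

def cA4 : ℕ := 562949953437696

def cA5 : ℕ := 16384

/-- Eight-point sets. -/
def octA0 : List ℕ := [3749702334974111792134, 3823633707932002561030, 3823633708482834209798,
  3823637093343330573318, 3825369859892736171014, 4712546333188402191366, 4119359200865218468870,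
  4119361177245967719430, 4045429803737245301766, 4119360895221233101830, 4120373366214316530694,
  4046441992705594113030, 4120228969551261871110, 4638614118008907897862, 4564682744500185480198,
  4564683026525991742470, 4415084692692486593542, 4415085540978609101830, 4341154167469886684166,
  4415085258953874484230, 4415520145498065869830, 4341588771989343452166, 4415375748835011210246,
  4638037659459931085830, 4564106285951208668166, 4564106567977014930438, 4710810182325026429958,
  4710808781010366897158, 4636877407501644479494, 4710808498985632279558, 4710091589929418628102,
  4636160216420696210438, 4709947193266363968518, 4342889756483904871430, 4268958382975182453766,
  4268958665000988716038]

/-- Data for covers. -/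
def coverA0_0_data : List (ℕ × ℕ × List ℕ) := [(1, 5, [3155151924167393, 3225658376259299,
  10882772471470981, 8411214444916487]), (16, 10, [5978120119636769, 6048626571728675,
  2442968528497581, 11526699994677119]), (21, 12, [11023780082545449, 11094286534637355,
  17083467291794365, 8412348406357687]), (32, 20, [16954597306659353, 17025103758751259,
  11465535151065629, 3069249071259303]), (208, 8, [12989731510219401, 13060237962311307,
  13419924549859845, 535964635910055]), (1026, 1, [9605980122047369, 1518122205828635,
  4399496804379341, 10943389761310511]), (1028, 4, [4546029861286745, 4614332976449179,
  16250609685973837, 12913725293915895]), (1040, 6, [17499406310089449, 10807368741607267,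
  13990536666295277, 15167199144545951]), (1044, 2, [5687842559021889, 15025595640289211,
  13421016589413357, 5332041878818431]), (1046, 1, [6252484687667825, 10525295697155939,
  11732724017896325, 13779619802807967]), (1056, 6, [8764875281273561, 7735847565571955,
  12284644457503237, 2250140830138031]), (1064, 2, [5672473087747041, 5465895036831547,
  14545265104460757, 12353509139672583]), (1152, 3, [1462986294612601, 11374688746644995,
  4130679052180301, 13790577281683031]), (1154, 1, [9047400411128345, 4629716439893739,
  16817945954396741, 15741138801459143]), (1160, 2, [46306337133153, 6047013714810475,
  5532578984934349, 9275428528996343]), (1162, 2, [914350363947649, 16169129592293291,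
  12026817509890717, 12370568739057271])]

theorem coverA0_0 : simpleCovers F6 cA0 T6 S20 KW octA0 coverA0_0_data = true := by
  decide +kernel

def coverA0_1_data : List (ℕ × ℕ × List ℕ) := [(1168, 5, [11309154776126057, 393319583336419,
  17936129958771429, 2527723452731351]), (1172, 2, [11301452928996041, 4892511574017843,
  12590326866193397, 10967617625657311]), (1176, 1, [61129433158377, 13080060299589579,
  16231397292718685, 12361807005937591]), (1232, 1, [1748357939036937, 5751755225593531,
  4425901235755805, 10946718352653831]), (1236, 2, [1747792098120433, 2650637375305451,
  9209899914746381, 15449231432916983]), (16416, 4, [61097237693361, 6889750737532803,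
  1599607577930517, 16293652057624447]), (16418, 3, [4851727335814001, 2924934408881835,
  6368750076291637, 8152832454446999]), (16426, 1, [3706583859393265, 10826554299754107,
  7495230820744101, 16572358816726767]), (16576, 10, [1458599012774465, 1239412108044147,
  16247291802758061, 3932341026029135]), (21536, 1, [15541687244272481, 7716053067970539,
  13141212373879429, 8444183771508671]), (21542, 1, [61110130876993, 15028360575887107,
  6654105490999965, 550274420649495]), (21546, 2, [16939181565821753, 3488962392856283,
  1600727566236469, 17727387233734239]), (21570, 2, [14985355829060321, 11109691475089075,
  15956519400491861, 12661912464469959]), (21574, 2, [10454810711483065, 4628649106872195,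
  7234602625428109, 10401339173490335]), (21696, 3, [7370708470821449, 17584169996416619,
  7778354054253349, 6473333878968119]), (21697, 1, [15810529595790289, 5486796432259059,
  1318659873491685, 17428293300928399])]

theorem coverA0_1 : simpleCovers F6 cA0 T6 S20 KW octA0 coverA0_1_data = true := by
  decide +kernel

def coverA0_2_data : List (ℕ × ℕ × List ℕ) := [(21760, 1, [9887431474353025, 12775476303841027,
  3298925370227365, 16291999489199823]), (21797, 1, [8482313589949081, 13932685389899635,
  17076369780861829, 5332630299979279]), (32832, 20, [1724702288974361, 17560561580484419,
  17631016520079957, 5061035874475743]), (32976, 1, [6543839211238129, 5189911157065227,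
  11726684194978581, 15471161515122375]), (33024, 1, [5949586474976041, 9968971697604395,
  3020162669480829, 3632212964425367])]

theorem coverA0_2 : simpleCovers F6 cA0 T6 S20 KW octA0 coverA0_2_data = true := by
  decide +kernel

theorem coverA0_state0 : coversCheck F6 cA0 T6 S20 KW 0 [⟨[12, 56], [1113, 1012, 608, 507, 1], 0⟩,
  ⟨[12, 65], [1311, 1210, 806, 705, 100], 0⟩, ⟨[12, 78], [1213, 1011, 708, 506, 203], 0⟩, ⟨[57,
  86], [1112, 1109, 607, 604, 2, 301], 0⟩] [0, 3, 1, 2] [([2014935846798169, 2085442298890075,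
  2155948750981981, 4481019786686151] : List ℕ).map sixes ++ [(octs octA0).take 36]] = true := by
  decide +kernel

theorem famReal_cA0 : FamReal F5 cA0 := stepCheck_sound (F' := F6) (Ss := S20) (gens := [⟨[10],
  [], 528⟩, ⟨[12], [10, 111, 212, 313, 414, 515, 616, 717, 818, 919], 0⟩, ⟨[20], [], 540672⟩,
  ⟨[21], [1000, 1101, 1202, 1303, 1404, 1505, 1606, 1707, 1808, 1909], 0⟩, ⟨[56], [1, 507, 608,
  1011, 1517, 1618], 0⟩, ⟨[65], [100, 705, 806, 1110, 1715, 1816], 0⟩, ⟨[78], [203, 506, 708,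
  1213, 1516, 1718], 0⟩, ⟨[87], [302, 605, 807, 1312, 1615, 1817], 0⟩, ⟨[35, 64], [400, 702, 803,
  1410, 1712, 1813], 0⟩, ⟨[36, 54], [401, 502, 603, 1411, 1512, 1613], 0⟩, ⟨[37, 84], [600, 801,
  902, 1610, 1811, 1912], 0⟩, ⟨[38, 74], [500, 701, 903, 1510, 1711, 1913], 0⟩, ⟨[57, 86], [2,
  407, 609, 1012, 1417, 1619, 301, 604, 907, 1311, 1614, 1917], 0⟩, ⟨[68, 75], [103, 406, 709,
  1113, 1416, 1719, 200, 704, 906, 1210, 1714, 1916], 0⟩]) (sched := [0, 2, 5, 7, 4, 10, 11, 8, 6,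
  3, 1, 9, 13, 7, 12, 4, 5, 6, 3, 13, 7]) (kills := [(28, [41]), (44, [51]), (76, [61]), (140,
  [71]), (268, [81]), (26, [42]), (42, [52]), (74, [62]), (138, [72]), (266, [82])]) (h := by
  decide +kernel) (hr := famReal_append (simpleCovers_sound coverA0_0) <| famReal_append
  (simpleCovers_sound coverA0_1) <| famReal_append (simpleCovers_sound coverA0_2) <|
  coversCheck_sound coverA0_state0)

def octA1 : List ℕ := [2124948269199684803590, 2198879360686902221830, 2198735526978106432518,
  2125092665875647437830, 2272810452169814191110, 2346741543651654515718, 2272522784747919256582,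
  2346310042516660435974, 2125237062538697911302, 2125381459200676740102, 3307850245322030193670,
  3381781336809247611910, 3381637503100451822598, 3307994641997992827910, 3455712428292159581190,
  3529643519773999905798, 3455424760870264646662, 3529212018639005826054, 3308139038661043301382,
  3308283435323022130182, 4490752221444375583750, 4564683312931593001990, 4564539479222797212678,
  4490896618120338217990, 4638614404414504971270, 4712545495896345295878, 4638326736992610036742,
  4712113994761351216134, 4491041014783388691462, 4491185411445367520262]

def coverA1_0_data : List (ℕ × ℕ × List ℕ) := [(4, 14, [6236542933119777, 6307049385211683,
  12580464587434629, 16302443780308743]), (32, 16, [610891653870545, 681398105962451,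
  6681528924285885, 5057745916809015]), (34, 14, [16390491998700097, 16460998450792003,
  10616680991693453, 16865341183196751]), (40, 4, [6233240111555449, 6303746563647355,
  1309875570576381, 1097290034785831]), (192, 4, [17799521520325417, 17870027972417323,
  10314345327430469, 16884603008446311]), (512, 4, [9042484735128129, 9112991187220035,
  13987234964625981, 7868071892786991]), (513, 13, [14681311939994137, 14751818392086043,
  1307731274643997, 9003835181744023]), (1028, 12, [17237696791815017, 9409280548447931,
  12279724497021605, 7008792801480471]), (1056, 14, [14687412880183841, 11095992666400491,
  2428638367935381, 13783457261915687]), (1058, 14, [10189248504615665, 9703951814277059,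
  202152997096189, 17701572376813367]), (1064, 4, [14115626103046937, 9116809392138147,
  16816333168888541, 7287524319743959]), (1152, 12, [9330545043735041, 13067418069780083,
  2148816861485853, 12946706435674039]), (1160, 8, [604296725324417, 11110272281331211,
  5839866654333621, 1125345818075007]), (1216, 2, [14119504345203665, 12519820414101491,
  6113102803757789, 5332617312186087]), (1536, 1, [67148764726113, 14196039878530667,
  1870083199994581, 7599256311373551]), (1538, 8, [2601532778664465, 2104714868004507,
  10027953749773229, 12379947894906543])]

theorem coverA1_0 : simpleCovers F6 cA1 T6 S20 KW octA1 coverA1_0_data = true := by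
  decide +kernel

def coverA1_1_data : List (ℕ × ℕ × List ℕ) := [(4104, 2, [17515870031241729, 15332395918886611,
  5539200750820149, 12096817212534423]), (4128, 13, [11026034927845889, 6894188581778947,
  15658524849159141, 10966470938664847]), (4130, 13, [9614223336797033, 9959642065966619,
  756279040842709, 2514024616767375]), (4136, 1, [5666435443774417, 8021720601380611,
  3866794220968509, 11816392307232567]), (4160, 3, [1467386519962217, 17838734761129635,
  5245620456913429, 13779067800940359]), (4162, 3, [12431733620494945, 12775496671336387,
  1610626360638069, 5627288659791695]), (4168, 3, [11017200156844777, 6877679753025315,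
  17919109993094021, 17709809029582559]), (4288, 11, [14117846552810057, 2950242558097347,
  13156049248115501, 14340347075079743]), (4296, 4, [7354193239486993, 14749108160738867,
  3847027630164485, 14327685425602295]), (4608, 2, [6233762944127985, 1532954864965435,
  4140064604420973, 7847212228669335]), (4609, 5, [3695038970667873, 13914027030550331,
  1870656561437301, 3926857332276751]), (4672, 1, [1173275795579897, 4062372774766131,
  16816871033879541, 16015975954288271]), (4674, 11, [9068335077827497, 10834829577631555,
  2429747499186973, 9819730787188671]), (32832, 5, [5967158283014721, 2087686295688827,
  17934490352994965, 261635386089095]), (32834, 13, [11300318940197417, 11094857681438267,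
  13690935941835285, 530497092235175]), (32836, 5, [3990241740809001, 15308189485286939,
  6932264851454613, 9570092222226359])]

theorem coverA1_1 : simpleCovers F6 cA1 T6 S20 KW octA1 coverA1_1_data = true := by
  decide +kernel

def coverA1_2_data : List (ℕ × ℕ × List ℕ) := [(32896, 18, [12142579257136001, 11107528933639915,
  16230810935253693, 9851008855133831]), (32897, 17, [8222241515246081, 15028944685143595,
  5258763050449805, 16867590672387759]), (32898, 11, [5692817205023297, 17860697084888971,
  207093283244605, 10105605907730271]), (32904, 3, [8784679356731985, 416388955903699,
  8652462491065221, 15184798890643167]), (32960, 5, [13835802518209361, 11105841038772059,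
  2160890068896693, 15738344984006487]), (32962, 11, [3709861955539961, 3235547521660699,
  10596901560195797, 17430001578098287]), (33024, 11, [6806104908952241, 15310955389744747,
  197192393833101, 9549752399974263]), (33025, 1, [55072440738457, 2363074299229931,
  3573219239316373, 17147384142139319]), (33028, 3, [17236619910570697, 7446101549123323,
  8640921997744957, 17441531455422183]), (33280, 3, [10754955871208121, 15315325523252923,
  203234272061973, 6745998776667663]), (33281, 3, [319523268252577, 14747422478374555,
  741995059784317, 8414542075662111]), (33282, 3, [17773738861220385, 16998684248979187,
  4994888788986645, 3638231335460719]), (33288, 1, [10202463114445769, 16172966065498035,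
  17077451011558245, 9264998224076407]), (33290, 1, [3710969014674097, 14213064088798851,
  13426536650037869, 7873576994385863]), (34884, 1, [11585085061214841, 1542273798891283,
  16244535543135053, 2527201574289135]), (34947, 11, [7357463882138505, 10835398675470211,
  16529326224104429, 7288653917126319])]

theorem coverA1_2 : simpleCovers F6 cA1 T6 S20 KW octA1 coverA1_2_data = true := by
  decide +kernel

def coverA1_3_data : List (ℕ × ℕ × List ℕ) := [(34952, 13, [5108950737818377, 4911730485130771,
  15973542427875861, 1104395972272063]), (35008, 11, [17782480187134737, 4070088687605627,
  13706306514303989, 9820238694485855]), (35073, 12, [7380570749772305, 2663265646454523,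
  6386336807557917, 2242989640367919]), (35076, 3, [15261862560453585, 13367026369103379,
  2728260598737573, 17162230810160751]), (35328, 1, [14974872927368145, 7433499032987163,
  16523314368650189, 5599796544761631]), (35329, 1, [332139671778265, 5457119368075203,
  12582664655047277, 17149618588413735]), (41036, 1, [3727421956510209, 11961815146456979,
  12872932522433085, 2804260276248127]), (41152, 1, [4000152396743313, 11673180394399595,
  7798643475380805, 12081917962714919]), (41156, 13, [11879243061789657, 17306002106783459,
  9779979511790589, 7866430160494583]), (41220, 2, [12730254294835921, 3489549794428587,
  6684335712660061, 13479459554168831]), (41472, 5, [6231028203512345, 2382314685126163,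
  13125774101256717, 15736170600132295]), (41474, 16, [7366280317604409, 17006390590396267,
  9477100502657909, 4219889055170487]), (41480, 3, [3994651629920905, 11672652182460307,
  11737111251471005, 10102275166707567]), (41481, 1, [11026031687737953, 7721559209678771,
  17357269288430429, 15450305055338439]), (41482, 1, [6233781239697977, 13063509611763539,
  1866769595104093, 16855473487425255]), (41600, 1, [15808303741629337, 1816082271459187,
  3869000718576605, 4779517946089431])]

theorem coverA1_3 : simpleCovers F6 cA1 T6 S20 KW octA1 coverA1_3_data = true := by
  decide +kernel

def coverA1_4_data : List (ℕ × ℕ × List ℕ) := [(41601, 14, [9620297395565249, 9399934724806219,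
  2721698907786189, 2227017749470887]), (196960, 11, [16643426921960049, 2105771375457995,
  13428728171809781, 7860348446977551]), (196961, 3, [3990811874607905, 15875548195362331,
  490781327895237, 15178751455199231]), (197120, 1, [16091480609604097, 10821072917059315,
  7784339005209421, 14889564889816871]), (197121, 13, [11591188134413289, 12231206125774435,
  16506255838722933, 5053842848595935]), (197124, 1, [13276175741178657, 1532405058692955,
  15396274116709341, 16884088679702215]), (197126, 7, [3718072886498161, 1238834455971579,
  3839877593946645, 8697134763064983])]

theorem coverA1_4 : simpleCovers F6 cA1 T6 S20 KW octA1 coverA1_4_data = true := by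
  decide +kernel

theorem coverA1_state0 : coversCheck F6 cA1 T6 S20 KW 0 [⟨[36, 54], [613, 1211, 310, 209, 301,
  200], 0⟩, ⟨[47, 65], [1013, 1312, 812, 1008, 907, 106, 503, 402], 0⟩, ⟨[56, 58], [1213, 13, 711,
  810, 709, 206, 305, 204], 0⟩] [2, 1, 0] [([11866595463221961, 11937101915313867,
  12007608367405773, 7296297826488207] : List ℕ).map sixes ++ [(octs octA1).take 30]] = true := by
  decide +kernel

theorem coverA1_state1 : coversCheck F6 cA1 T6 S20 KW 1 [] [] [([14703346103649265,
  14773852555741171, 3562218735499789, 17703777880448631] : List ℕ).map sixes ++ [(octs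
  octA1).take 30], ([11584579240956681, 11655085693048587, 17091745780443909, 8414516192640791] :
  List ℕ).map sixes ++ [(octs octA1).take 30], ([7936349179425297, 8006855631517203,
  11184060096830421, 16297492762914327] : List ℕ).map sixes ++ [(octs octA1).take 30]] = true :=
  by decide +kernel

theorem coverA1_state1026 : coversCheck F6 cA1 T6 S20 KW 1026 [⟨[12, 56], [1213, 810, 709, 305,
  204], 0⟩, ⟨[21, 65], [1312, 1008, 907, 503, 402], 0⟩] [1, 0] [([3724711834354249,
  13925567538583227, 10057081087630093, 10391473637629719] : List ℕ).map sixes ++ [(octs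
  octA1).take 30]] = true := by decide +kernel

theorem famReal_cA1 : FamReal F5 cA1 := stepCheck_sound (F' := F6) (Ss := S20) (gens := [⟨[10],
  [], 16⟩, ⟨[12], [10, 111, 212, 313, 414, 515, 616, 717, 818, 919], 0⟩, ⟨[20], [], 16384⟩, ⟨[21],
  [1000, 1101, 1202, 1303, 1404, 1505, 1606, 1707, 1808, 1909], 0⟩, ⟨[47], [5, 107, 309, 1015,
  1117, 1319], 0⟩, ⟨[48], [6, 108, 209, 1016, 1118, 1219], 0⟩, ⟨[56], [1, 507, 608, 1011, 1517,
  1618], 0⟩, ⟨[57], [2, 407, 609, 1012, 1417, 1619], 0⟩, ⟨[58], [3, 408, 509, 1013, 1418, 1519],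
  0⟩, ⟨[65], [100, 705, 806, 1110, 1715, 1816], 0⟩, ⟨[67], [102, 405, 809, 1112, 1415, 1819], 0⟩,
  ⟨[68], [103, 406, 709, 1113, 1416, 1719], 0⟩, ⟨[78], [203, 506, 708, 1213, 1516, 1718], 0⟩,
  ⟨[87], [302, 605, 807, 1312, 1615, 1817], 0⟩, ⟨[35, 64], [400, 702, 803, 1410, 1712, 1813], 0⟩,
  ⟨[36, 54], [401, 502, 603, 1411, 1512, 1613], 0⟩]) (sched := [0, 2, 9, 4, 13, 12, 6, 3, 5, 15,
  11, 14, 8, 13, 1, 10, 9, 3, 7]) (kills := [(28, [41]), (44, [51]), (76, [61]), (140, [71]),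
  (268, [81]), (26, [42]), (42, [52]), (74, [62]), (138, [72]), (266, [82])]) (h := by
  decide +kernel) (hr := famReal_append (simpleCovers_sound coverA1_0) <| famReal_append
  (simpleCovers_sound coverA1_1) <| famReal_append (simpleCovers_sound coverA1_2) <|
  famReal_append (simpleCovers_sound coverA1_3) <| famReal_append (simpleCovers_sound coverA1_4)
  <| famReal_append (coversCheck_sound coverA1_state0) <| famReal_append (coversCheck_sound
  coverA1_state1) <| coversCheck_sound coverA1_state1026)

def octA2 : List ℕ := [1902575432277410978822, 2050439025922026249222, 2050873063087040633862,
  2273100091574405569542, 2198301207788346940422, 2198446452728915303430, 2272811862299917163526,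
  2346162827804225838086, 2345732174944591682566, 2125237910811904056326, 4194448008267827784710,
  4268379381775474371590, 4342310191242262621190, 4416241564749909208070, 4342022523824671042566,
  4415953897332317629446, 4194736801619753053190, 4268668175127399640070, 4490172374208086559750,
  4564103747715733146630, 4638034557171767208966, 4711965930679413795846, 4489597039364296690694,
  4563528412871943277574, 4637171554901779049478, 4711102928409425636358, 4195025594945854000134,
  4268956968453500587014, 4195314388269811657734, 4269245761777458244614]

def coverA2_0_data : List (ℕ × ℕ × List ℕ) := [(1, 15, [14971606598419185, 15042113050511091,
  4118625201240893, 16576186779786983]), (2, 13, [4855002200122081, 4925508652213987,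
  6118610065206045, 12374424610942671]), (8, 4, [16373489324077825, 16443995776169731,
  7809669698890477, 5907087565356791]), (21, 13, [4006140617065361, 4076647069157267,
  8059816085285397, 8429371450568535]), (24, 12, [16387801121882937, 16458307573974843,
  5260436947040797, 12372740902195055]), (1026, 11, [609233823843129, 3798481301755731,
  2151561446087509, 2509047907295223]), (1032, 1, [347553279578905, 955703668688875,
  10340216104864669, 5598701328170695]), (1044, 15, [10177180699353713, 12800173393319915,
  3576023836064565, 529389066379023]), (1048, 11, [11328908475970257, 4899138626885347,
  10612853097908821, 9538242843856631]), (1288, 1, [7940798761267841, 9691864704542683,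
  9475937730357845, 14634989343690415]), (1320, 2, [13016663121482521, 4638511410877987,
  9468252970592949, 3357345769627439]), (2052, 11, [4846219080102713, 13922832682497635,
  10037794537053029, 15756528780611127]), (2056, 3, [45724454900481, 11099286912448491,
  1588639368186781, 4772975607725991]), (2069, 11, [12145859544638441, 11368643592943459,
  1893724828597037, 3075296410337039]), (2072, 3, [342021303022361, 15881068342023899,
  15942729283893981, 17165559359557263]), (2080, 12, [12145305508512761, 9146513486738971,
  2710653363424133, 8976380601507343])]

theorem coverA2_0 : simpleCovers F6 cA2 T6 S20 KW octA2 coverA2_0_data = true := by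
  decide +kernel

def coverA2_1_data : List (ℕ × ℕ × List ℕ) := [(2088, 19, [5970458927649713, 8583024502142563,
  5529281465035501, 7024732509507567]), (2112, 5, [14123297898205697, 9413728093943499,
  15665637327588197, 15735072235585087]), (2116, 11, [1168346173473585, 11364798494013139,
  201583947479869, 14328786057149967]), (8213, 1, [14699466678608529, 5749009629898515,
  14262721712650885, 7848295615344359]), (8256, 11, [7922056675304409, 8846389747144267,
  16532088957573661, 15471215118278199]), (8258, 1, [7370706291933785, 6581939036141283,
  488589820795765, 9256234227908335]), (8272, 1, [5118322412925865, 404878441559987,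
  12295094068968325, 11227599550074871]), (8276, 1, [2314598894523065, 3210785890232083,
  3848639358650965, 13788954809589383]), (8448, 3, [13274537213084329, 17839243764983667,
  15665668432513757, 11238041750220671]), (8449, 1, [8770351402333001, 2390060644050819,
  1593566781971109, 17718043486355215]), (8452, 1, [14407580793451369, 6036038001497691,
  16789912663092101, 3085192033902439]), (8465, 19, [14684079987782201, 1530227472521203,
  13425425318910485, 8976921870036743]), (8469, 1, [7088625781392337, 10532998662260331,
  15110976593910645, 2804787472961183]), (8480, 3, [7354752705114929, 675914504251243,
  15678299918662397, 1672321657941727]), (8481, 1, [13012281206354673, 13906338942666387,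
  3274703887625173, 12086323562966919]), (21544, 11, [17205240831169185, 9708938281789115,
  5826116414970581, 7578332335783759])]

theorem coverA2_1 : simpleCovers F6 cA2 T6 S20 KW octA2 coverA2_1_data = true := by
  decide +kernel

def coverA2_2_data : List (ℕ × ℕ × List ℕ) := [(24644, 1, [2006139682628409, 7994264974583371,
  5265381586745869, 5598701328170695]), (24650, 1, [7645024846496625, 7443368870049579,
  2733744206465789, 1105548074262191]), (24652, 15, [6812678337409545, 4334481417656307,
  10051586780244653, 8444206284382103]), (24837, 2, [9638391050506905, 14485187866826395,
  1025103143320205, 6164902519504735]), (24864, 1, [8794526622073537, 14213082321278915,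
  3018523133070205, 16861517492129287])]

theorem coverA2_2 : simpleCovers F6 cA2 T6 S20 KW octA2 coverA2_2_data = true := by
  decide +kernel

theorem coverA2_state0 : coversCheck F6 cA2 T6 S20 KW 0 [⟨[12, 45], [1113, 1012, 306, 205, 104],
  0⟩, ⟨[12, 54], [1311, 1210, 603, 502, 401], 0⟩] [0, 1] [([12450398437086041, 12520904889177947,
  12591411341269853, 5899392020107159] : List ℕ).map sixes ++ [(octs octA2).take 30]] = true := by
  decide +kernel

theorem famReal_cA2 : FamReal F5 cA2 := stepCheck_sound (F' := F6) (Ss := S20) (gens := [⟨[10],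
  [], 129⟩, ⟨[12], [10, 111, 212, 313, 414, 515, 616, 717, 818, 919], 0⟩, ⟨[20], [], 132096⟩,
  ⟨[21], [1000, 1101, 1202, 1303, 1404, 1505, 1606, 1707, 1808, 1909], 0⟩, ⟨[45], [104, 205, 306,
  1114, 1215, 1316], 0⟩, ⟨[48], [6, 108, 209, 1016, 1118, 1219], 0⟩, ⟨[54], [401, 502, 603, 1411,
  1512, 1613], 0⟩, ⟨[58], [3, 408, 509, 1013, 1418, 1519], 0⟩, ⟨[67], [102, 405, 809, 1112, 1415,
  1819], 0⟩, ⟨[68], [103, 406, 709, 1113, 1416, 1719], 0⟩, ⟨[76], [201, 504, 908, 1211, 1514,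
  1918], 0⟩, ⟨[78], [203, 506, 708, 1213, 1516, 1718], 0⟩, ⟨[46, 75], [4, 207, 308, 1014, 1217,
  1318, 200, 704, 906, 1210, 1714, 1916], 0⟩, ⟨[47, 65], [5, 107, 309, 1015, 1117, 1319, 100, 705,
  806, 1110, 1715, 1816], 0⟩, ⟨[56, 74], [1, 507, 608, 1011, 1517, 1618, 500, 701, 903, 1510,
  1711, 1913], 0⟩, ⟨[57, 64], [2, 407, 609, 1012, 1417, 1619, 400, 702, 803, 1410, 1712, 1813],
  0⟩]) (sched := [0, 2, 6, 4, 10, 11, 9, 7, 8, 3, 5, 1, 14, 13, 15, 10, 4, 6, 3, 8, 12, 6]) (kills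
  := [(28, [41]), (44, [51]), (76, [61]), (140, [71]), (268, [81]), (26, [42]), (42, [52]), (74,
  [62]), (138, [72]), (266, [82])]) (h := by decide +kernel) (hr := famReal_append
  (simpleCovers_sound coverA2_0) <| famReal_append (simpleCovers_sound coverA2_1) <|
  famReal_append (simpleCovers_sound coverA2_2) <| coversCheck_sound coverA2_state0)

def octA3 : List ℕ := [1164273324865390910470, 1755724312926563605510, 2347175300987736300550,
  2938626289048908995590, 3530077277110081690630, 4121528265171254385670, 4712979253232427080710,
  2051448678862523210758, 2347174172893109558278, 2347173044798482816006, 2051449806965756664838,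
  3234350654984868600838, 3530076149015454948358, 3530075020920828206086, 3234351783088102054918,
  4417252631107213990918, 4712978125137800338438, 4712976997043173596166, 4417253759210447444998,
  3825799386856787811334, 4121524880887374158854, 4121523752792747416582, 3825800514960021265414,
  4417250374917960506374, 4712975868948546853894, 4712974740853920111622, 4417251503021193960454,
  4417248118728707021830, 4712973612759293369350, 4712972484664666627078, 4417249246831940475910,
  3825801643063254719494, 4121527137093841067014, 4121526008999214324742, 3825802771166488173574,
  1164129491153365511174, 1090342796334577761286, 1755580479214538206214, 1681793784395750456326,
  2347031467275710901254]

def coverA3_0_data : List (ℕ × ℕ × List ℕ) := [(1152, 14, [614205282030441, 16718320624305899,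
  11733247997631125, 533753782718423]), (1160, 13, [9052407141421897, 10543999107336171,
  4961944292744141, 11796102910938671]), (1216, 13, [7097450775344025, 4634139241002843,
  6960832784448069, 2235286656294871]), (16420, 14, [1188664634094209, 15897521204209531,
  11731034961287933, 16591018329456135]), (16424, 20, [4563613468009273, 3795763730527819,
  9470441185192757, 17448661029785143]), (16580, 2, [16083757199352673, 8298269235779571,
  11744235603983237, 3371607235833647]), (16896, 2, [11309681981498153, 6050859954477027,
  8920137733655245, 9262832436637351]), (16897, 2, [2023746949255993, 13337886129538779,
  15668994850982557, 537599942692639]), (20518, 14, [2593323995349889, 2087632688326179,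
  7502916732054381, 13197934126194399]), (20520, 4, [9358584750494225, 17579225350227531,
  5837153365138397, 10389817927696207]), (20672, 2, [6240946316841873, 4331194700244907,
  16802006229703589, 6745998776667663]), (20993, 2, [631792069776145, 11938158439425619,
  1605634467650517, 2797107098246959]), (196960, 2, [9331646704935465, 14179538654177163,
  6964107703335565, 12080285864472543]), (196961, 2, [51749144916865, 686352317245267,
  8628251777154037, 16870342643375623])]

theorem coverA3_0 : simpleCovers F6 cA3 T6 S20 KW octA3 coverA3_0_data = true := by
  decide +kernel

theorem coverA3_state0 : coversCheck F6 cA3 T6 S20 KW 0 [⟨[12, 46], [1115, 813, 712], 0⟩, ⟨[12,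
  68], [1214, 911, 608, 305, 2], 0⟩, ⟨[12, 76], [1413, 1110, 706, 504, 100], 0⟩, ⟨[12, 87], [1312,
  1009, 807, 403, 201], 0⟩, ⟨[46, 65], [1115, 1514, 813, 712, 1008, 907, 402, 301], 0⟩, ⟨[75, 56],
  [1415, 1513, 1413, 1110, 810, 709, 1108, 906, 706, 504, 204, 103, 502, 300, 100], 0⟩] [0, 1, 4,
  0, 5, 3, 1, 4, 2] [([15543906689430185, 15614413141522091, 15684919593613997, 11224854053195551]
  : List ℕ).map sixes ++ [(octs octA3).take 40], ([14109561520931681, 14180067973023587,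
  14250574425115493, 17428351251427215] : List ℕ).map sixes ++ [(octs octA3).take 40]] = true :=
  by decide +kernel

theorem coverA3_state1 : coversCheck F6 cA3 T6 S20 KW 1 [⟨[12, 76], [1413, 1110, 706, 504, 100],
  0⟩, ⟨[57, 45], [1315, 1114, 814, 1013, 912, 612, 811, 609, 205, 3], 0⟩, ⟨[68, 86], [1214, 1412,
  911, 1109, 608, 806, 305, 503, 2, 200], 0⟩] [1, 0, 2, 0, 2] [([6230513832747969,
  6301020284839875, 6120265829771957, 11236988344594367] : List ℕ).map sixes ++ [(octs octA3).take
  40], ([3979781272400857, 4050287724492763, 13704719488105397, 2529975146077871] : List ℕ).map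
  sixes ++ [(octs octA3).take 40]] = true := by decide +kernel

theorem coverA3_state16 : coversCheck F6 cA3 T6 S20 KW 16 [⟨[12, 87], [1211, 908, 706, 302, 100],
  0⟩, ⟨[37, 78], [314, 113, 1112, 809, 607, 203, 1], 0⟩, ⟨[65, 56], [1413, 1314, 907, 709, 806,
  608, 301, 103, 200, 2], 0⟩, ⟨[65, 67], [1413, 1213, 910, 907, 806, 506, 304, 301, 200], 0⟩] [1,
  3, 2, 0, 2, 1] [([7636240512087017, 7706746964178923, 5826694067206813, 1673995686260535] : List
  ℕ).map sixes ++ [(octs octA3).take 40]] = true := by decide +kernel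

theorem coverA3_state20 : coversCheck F6 cA3 T6 S20 KW 20 [⟨[12, 47], [914, 713, 511], 0⟩, ⟨[45,
  67], [1213, 1013, 913, 912, 811, 910, 506, 304], 0⟩, ⟨[47, 65], [914, 1413, 713, 511, 907, 806,
  301, 200], 0⟩, ⟨[68, 56], [1314, 1114, 1113, 810, 709, 509, 608, 507, 204, 103, 2], 0⟩] [0, 1,
  3, 2, 3] [([3703229448110937, 3773735900202843, 15129099279604605, 16593813336047279] : List
  ℕ).map sixes ++ [(octs octA3).take 40], ([12991924044956241, 13062430497048147,
  3865170716928869, 12074257848577671] : List ℕ).map sixes ++ [(octs octA3).take 40],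
  ([2315689776222961, 2386196228314867, 17377061479246837, 16311739175911415] : List ℕ).map sixes
  ++ [(octs octA3).take 40]] = true := by decide +kernel

theorem coverA3_state192 : coversCheck F6 cA3 T6 S20 KW 192 [⟨[12, 58], [1114, 610, 509, 104, 3],
  0⟩, ⟨[12, 67], [1213, 910, 506, 304, 1], 0⟩, ⟨[12, 76], [1312, 1009, 605, 403, 100], 0⟩, ⟨[12,
  85], [1411, 1006, 905, 401, 300], 0⟩, ⟨[65, 87], [1413, 1211, 908, 907, 906, 806, 706, 302,
  301], 0⟩] [1, 3, 4, 0, 2] [([11013382918841121, 11083889370933027, 13707999865969565,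
  10689429486112703] : List ℕ).map sixes ++ [(octs octA3).take 40]] = true := by decide +kernel

theorem coverA3_state1026 : coversCheck F6 cA3 T6 S20 KW 1026 [⟨[30, 46], [1115, 813, 712], 0⟩,
  ⟨[45, 68], [1214, 1114, 914, 1013, 912, 911, 608, 305, 2], 0⟩, ⟨[45, 78], [1114, 1213, 1013,
  913, 912, 910, 708, 304, 102], 0⟩, ⟨[45, 87], [1114, 1013, 1312, 912, 1009, 807, 403, 201], 0⟩]
  [0, 2, 1, 3] [([47956701454929, 3202553629075107, 10617259721948093, 16024271654276663] : List
  ℕ).map sixes ++ [(octs octA3).take 40], ([4004517071233761, 2928243685312251, 15095544862395317,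
  2242936043421527] : List ℕ).map sixes ++ [(octs octA3).take 40]] = true := by decide +kernel

theorem coverA3_state1040 : coversCheck F6 cA3 T6 S20 KW 1040 [⟨[20, 41], [], 32⟩] [0]
  [([13009491520164489, 17849185572014019, 1323069760400077, 2228687497633319] : List ℕ).map sixes
  ++ [(octs octA3).take 40]] = true := by decide +kernel

theorem coverA3_state1044 : coversCheck F6 cA3 T6 S20 KW 1044 [⟨[30, 56], [1314, 709, 608, 103,
  2], 0⟩, ⟨[38, 78], [214, 13, 1112, 809, 607, 203, 1], 0⟩] [0, 1] [([12701647608562473,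
  17578670246729603, 9769537311623901, 14623474502672383] : List ℕ).map sixes ++ [(octs
  octA3).take 40], ([624655897891593, 5199855063246355, 11747567336774557, 7023622237285911] :
  List ℕ).map sixes ++ [(octs octA3).take 40]] = true := by decide +kernel

theorem coverA3_state16416 : coversCheck F6 cA3 T6 S20 KW 16416 [⟨[12, 67], [1112, 809, 405, 203],
  0⟩, ⟨[21, 76], [1211, 908, 504, 302], 0⟩, ⟨[38, 57], [1113, 113, 609, 407, 3], 0⟩, ⟨[48, 68],
  [713, 1012, 512, 411, 709, 406, 103], 0⟩] [2, 1, 3, 0] [([15816610294284929, 13084425014155155,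
  15657428598569637, 7879085191520151] : List ℕ).map sixes ++ [(octs octA3).take 40],
  ([2308539689579257, 17301627661563731, 13409991376771645, 4189634244165463] : List ℕ).map sixes
  ++ [(octs octA3).take 40], ([10184361972695961, 5764949352482387, 3281874364824085,
  2804830447603455] : List ℕ).map sixes ++ [(octs octA3).take 40]] = true := by decide +kernel

theorem coverA3_state16418 : coversCheck F6 cA3 T6 S20 KW 16418 [⟨[10, 42], [], 16⟩] [0]
  [([17518647839056513, 686309449172699, 15113143448857333, 537620383698687] : List ℕ).map sixes
  ++ [(octs octA3).take 40]] = true := by decide +kernel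

theorem coverA3_state16576 : coversCheck F6 cA3 T6 S20 KW 16576 [⟨[12, 68], [1012, 709, 406, 103],
  0⟩, ⟨[30, 58], [1013, 509, 408, 3], 0⟩, ⟨[56, 78], [1213, 1011, 708, 608, 508, 507, 506, 2, 1],
  0⟩, ⟨[65, 87], [1312, 1110, 807, 806, 805, 705, 605, 201, 200], 0⟩] [0, 1, 2, 3]
  [([4541621081474017, 7452722155431427, 12847045743545061, 1962596009762351] : List ℕ).map sixes
  ++ [(octs octA3).take 40]] = true := by decide +kernel

theorem famReal_cA3 : FamReal F5 cA3 := stepCheck_sound (F' := F6) (Ss := S20) (gens := [⟨[12],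
  [10, 111, 212, 313, 414, 515, 616, 717, 818, 919], 0⟩, ⟨[21], [1000, 1101, 1202, 1303, 1404,
  1505, 1606, 1707, 1808, 1909], 0⟩, ⟨[46], [4, 207, 308, 1014, 1217, 1318], 0⟩, ⟨[47], [5, 107,
  309, 1015, 1117, 1319], 0⟩, ⟨[48], [6, 108, 209, 1016, 1118, 1219], 0⟩, ⟨[56], [1, 507, 608,
  1011, 1517, 1618], 0⟩, ⟨[57], [2, 407, 609, 1012, 1417, 1619], 0⟩, ⟨[58], [3, 408, 509, 1013,
  1418, 1519], 0⟩, ⟨[65], [100, 705, 806, 1110, 1715, 1816], 0⟩, ⟨[67], [102, 405, 809, 1112,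
  1415, 1819], 0⟩, ⟨[68], [103, 406, 709, 1113, 1416, 1719], 0⟩, ⟨[75], [200, 704, 906, 1210,
  1714, 1916], 0⟩, ⟨[76], [201, 504, 908, 1211, 1514, 1918], 0⟩, ⟨[78], [203, 506, 708, 1213,
  1516, 1718], 0⟩, ⟨[85], [300, 804, 905, 1310, 1814, 1915], 0⟩, ⟨[86], [301, 604, 907, 1311,
  1614, 1917], 0⟩, ⟨[87], [302, 605, 807, 1312, 1615, 1817], 0⟩]) (sched := [11, 14, 2, 8, 5, 6,
  3, 15, 10, 9, 12, 4, 7, 1, 14, 0, 11, 16, 13, 2, 1, 8, 5]) (kills := [(28, [41]), (44, [51]),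
  (76, [61]), (140, [71]), (268, [81]), (26, [42]), (42, [52]), (74, [62]), (138, [72]), (266,
  [82])]) (h := by decide +kernel) (hr := famReal_append (simpleCovers_sound coverA3_0) <|
  famReal_append (coversCheck_sound coverA3_state0) <| famReal_append (coversCheck_sound
  coverA3_state1) <| famReal_append (coversCheck_sound coverA3_state16) <| famReal_append
  (coversCheck_sound coverA3_state20) <| famReal_append (coversCheck_sound coverA3_state192) <|
  famReal_append (coversCheck_sound coverA3_state1026) <| famReal_append (coversCheck_sound
  coverA3_state1040) <| famReal_append (coversCheck_sound coverA3_state1044) <| famReal_append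
  (coversCheck_sound coverA3_state16416) <| famReal_append (coversCheck_sound coverA3_state16418)
  <| coversCheck_sound coverA3_state16576)

def octA4 : List ℕ := [1164129491150140087302, 1163985657439192620038, 1090342796334581947398,
  1755580479211312782342, 1755436645500365315078, 1681793784395754642438, 2347031467272485477382,
  2346887633561538010118, 2273244772456927337478, 2938482455333658172422, 2938338621622710705158,
  2864695760518100032518, 3529933443394830867462, 3529789609683883400198, 3456146748579272727558,
  4121384431456003562502, 4121240597745056095238, 4047597736640445422598, 4712835419517176257542,
  4712691585806228790278, 4639048724701618117638, 2273098119599239998470, 2347029493106886585350,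
  2347029211083229899782, 2273098401625048361990, 3456000095721585388550, 3529931469229231975430,
  3529931187205575289862, 3456000377747393752070, 4638902071843930778630, 4712833445351577365510,
  4712833163327920679942, 4638902353869739142150, 4047448827593504599046, 4121380201101151185926,
  4121379919077494500358, 4047449109619312962566, 4638899815654677294086, 4712831189162323880966,
  4712830907138667195398]

def coverA4_0_data : List (ℕ × ℕ × List ℕ) := [(20, 38, [17508726397580089, 17579232849671995,
  744780312451597, 16323285182471839]), (128, 30, [7950098493739889, 8020604945831795,
  8630429313092381, 7298510925790783]), (136, 38, [17509808767108033, 17580315219199939,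
  13973506068171773, 3649248935284359]), (2052, 12, [17232173432468249, 9407107301168971,
  7495230889978597, 11236434364989327]), (2068, 12, [9618054340600561, 5197083723019883,
  12309991127435901, 7004373290663703]), (2080, 16, [12143665929884513, 2105231295653667,
  3290089504754573, 7584408642826111]), (2088, 8, [12728596429067073, 17860715388614299,
  11456756248328781, 550264758959855]), (2176, 15, [7640042697093729, 395531533662203,
  14548536726637133, 5333716916096839]), (2184, 9, [2861044332872585, 4903539934377491,
  3276384293563093, 11239207760416375]), (2240, 16, [624094372926457, 676997976897083,
  7215402991438741, 4767452353031847]), (2560, 4, [2603226077942689, 10270206791022179,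
  10873437328685701, 5623413435506223]), (2576, 2, [7655432567214985, 983724049852235,
  12019660026551237, 18005536800649143]), (20518, 30, [4546615017026249, 15322501419619931,
  15387514608294669, 11515128365039271]), (20520, 19, [11603831398322913, 12800748866557499,
  11181306022341125, 13488222363278887]), (20608, 15, [14112915930321841, 2640749299377755,
  13408953102076925, 10108322562543175]), (20616, 5, [5130945301038073, 14183974271121315,
  17073019743906437, 16597062504111807])]

theorem coverA4_0 : simpleCovers F6 cA4 T6 S20 KW octA4 coverA4_0_data = true := by
  decide +kernel

def coverA4_1_data : List (ℕ × ℕ × List ℕ) := [(20736, 3, [613650029478505, 6033253709375331,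
  2174108904643349, 14351321802870455]), (20768, 3, [10745646563168969, 4331213025011555,
  16527655469280077, 4474435639545703]), (131328, 7, [11881976734942105, 2103032276731427,
  10325334036851661, 3927438352260959]), (131332, 4, [14409208489730809, 17864559384364763,
  8928962884848165, 8976932607417871]), (131336, 5, [16667050246607465, 13617711828321827,
  12292393625131781, 16572356690374599]), (131368, 11, [4558160967144057, 8562140152579627,
  9776107550419685, 13218831249731471]), (139532, 5, [15530128367399601, 9398839547992019,
  7805841851141069, 12919787627560663]), (139552, 19, [7388284510946065, 12513216910256099,
  10340715355015701, 5909823344140055]), (139560, 11, [332673338082225, 12799107182388883,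
  14813008974088925, 2227028587560583])]

theorem coverA4_1 : simpleCovers F6 cA4 T6 S20 KW octA4 coverA4_1_data = true := by
  decide +kernel

theorem coverA4_state0 : coversCheck F6 cA4 T6 S20 KW 0 [⟨[12, 45], [1114, 1013, 912, 205, 104,
  3], 0⟩, ⟨[12, 56], [1415, 507, 406], 0⟩, ⟨[12, 67], [1314, 1011, 708, 304, 1], 0⟩] [2, 1, 0, 2]
  [([6236553588523985, 6307060040615891, 6377566492707797, 10382125653872407] : List ℕ).map sixes
  ++ [(octs octA4).take 40]] = true := by decide +kernel

theorem coverA4_state2 : coversCheck F6 cA4 T6 S20 KW 2 [⟨[46, 57], [1214, 1014, 407, 106, 205,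
  5], 0⟩] [0] [([3695022828900953, 3765529280992859, 16503521051929325, 12090227610689407] : List
  ℕ).map sixes ++ [(octs octA4).take 40]] = true := by decide +kernel

theorem coverA4_state2064 : coversCheck F6 cA4 T6 S20 KW 2064 [⟨[20, 56], [1213, 305, 204], 0⟩]
  [0] [([6818146973889449, 17571537320969835, 12566137727851405, 13202361151315591] : List ℕ).map
  sixes ++ [(octs octA4).take 40]] = true := by decide +kernel

theorem famReal_cA4 : FamReal F5 cA4 := stepCheck_sound (F' := F6) (Ss := S20) (gens := [⟨[10],
  [], 1⟩, ⟨[12], [10, 111, 212, 313, 414, 515, 616, 717, 818, 919], 0⟩, ⟨[20], [], 1024⟩, ⟨[21],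
  [1000, 1101, 1202, 1303, 1404, 1505, 1606, 1707, 1808, 1909], 0⟩, ⟨[45], [104, 205, 306, 1114,
  1215, 1316], 0⟩, ⟨[46], [4, 207, 308, 1014, 1217, 1318], 0⟩, ⟨[47], [5, 107, 309, 1015, 1117,
  1319], 0⟩, ⟨[48], [6, 108, 209, 1016, 1118, 1219], 0⟩, ⟨[54], [401, 502, 603, 1411, 1512, 1613],
  0⟩, ⟨[56], [1, 507, 608, 1011, 1517, 1618], 0⟩, ⟨[57], [2, 407, 609, 1012, 1417, 1619], 0⟩,
  ⟨[58], [3, 408, 509, 1013, 1418, 1519], 0⟩, ⟨[67], [102, 405, 809, 1112, 1415, 1819], 0⟩, ⟨[68],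
  [103, 406, 709, 1113, 1416, 1719], 0⟩, ⟨[76], [201, 504, 908, 1211, 1514, 1918], 0⟩, ⟨[78],
  [203, 506, 708, 1213, 1516, 1718], 0⟩, ⟨[86], [301, 604, 907, 1311, 1614, 1917], 0⟩, ⟨[87],
  [302, 605, 807, 1312, 1615, 1817], 0⟩]) (sched := [0, 2, 16, 8, 14, 12, 13, 17, 15, 4, 5, 10, 7,
  9, 3, 1, 6, 8, 11, 16, 3, 14]) (kills := [(28, [41]), (44, [51]), (76, [61]), (140, [71]), (268,
  [81]), (26, [42]), (42, [52]), (74, [62]), (138, [72]), (266, [82])]) (h := by decide +kernel)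
  (hr := famReal_append (simpleCovers_sound coverA4_0) <| famReal_append (simpleCovers_sound
  coverA4_1) <| famReal_append (coversCheck_sound coverA4_state0) <| famReal_append
  (coversCheck_sound coverA4_state2) <| coversCheck_sound coverA4_state2064)

theorem coverA5_state0 : coversCheck F6 cA5 T6 S20 KW 0 [⟨[10, 56], [1819, 1214, 1113, 608, 507,
  1], 0⟩, ⟨[10, 65], [1918, 1412, 1311, 806, 705, 100], 0⟩, ⟨[10, 68], [1618, 1315, 1012, 709,
  406, 103], 0⟩, ⟨[10, 75], [1917, 1512, 1310, 906, 704, 200], 0⟩, ⟨[46, 84], [1519, 1217, 1116,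
  1913, 1811, 1710, 308, 207, 4, 902, 801, 600], 0⟩] [3, 1, 0, 2, 3, 0, 1, 4, 1, 2, 0, 2, 4, 0]
  [([11043571180651449, 11114077632743355, 11184584084835261, 11255090536927167] : List ℕ).map
  sixes ++ [octs [0, 4416818309742085065734, 4415810628776787229702, 3160276857893162593286,
  4564678800559534787590, 4416530360292225903622, 4711822662130342599686,
  4343032738617746840582]], ([13861124481311537, 12786994242230163, 14002137385495349,
  12928007146413975] : List ℕ).map sixes ++ [octs [4490023750521521276090, 3528051200498340574370,
  3528051200477912138810, 3233480879772174759074, 3454408058442713977874, 4342739713839965201418,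
  4416382855873020097538, 4710953176617471018170]]] = true := by decide +kernel

theorem coverA5_state1 : coversCheck F6 cA5 T6 S20 KW 1 [⟨[10, 54], [1714, 1613, 1512, 502, 401,
  300], 0⟩, ⟨[10, 67], [1617, 1314, 910, 708, 304, 1], 0⟩, ⟨[38, 76], [618, 417, 1716, 316, 114,
  1413, 13, 1009, 807, 403, 100], 0⟩, ⟨[38, 78], [618, 417, 1516, 316, 114, 1213, 13, 1011, 607,
  405, 102], 0⟩, ⟨[47, 57], [1618, 1318, 1117, 915, 1114, 912, 508, 208, 306, 6], 0⟩, ⟨[56, 45],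
  [1718, 1417, 1316, 1116, 1215, 1015, 1113, 1012, 507, 406, 205, 104, 3], 0⟩, ⟨[56, 86], [1718,
  1715, 1113, 1412, 1012, 1109, 507, 806, 406, 503, 200], 0⟩] [4, 1, 0, 6, 1, 2, 1, 5, 3]
  [([621314438357825, 691820890449731, 11719536316774965, 11790042768866871] : List ℕ).map sixes
  ++ [octs [0, 4121382457311921449990, 4194593533053468449798, 4564970132098554293254,
  4417110207523154570246, 4342167767671096523782, 1903587623999928540166,
  4564827429776458808326]], ([10757704664802281, 10828211116894187, 16532100810590845,
  16602607262682751] : List ℕ).map sixes ++ [octs [0, 3455425042899292154886,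
  4564392259033239170054, 4712111176724879277062, 4343175731748829408262, 4638468596545481112582,
  2272954567916246293510, 4416098860250303077382]]] = true := by decide +kernel

theorem coverA5_state20 : coversCheck F6 cA5 T6 S20 KW 20 [⟨[10, 47], [1318, 1117, 915, 208, 106,
  4], 0⟩, ⟨[10, 56], [1718, 1113, 1012, 507, 406, 1], 0⟩, ⟨[10, 58], [1518, 1014, 913, 408, 307,
  2], 0⟩, ⟨[10, 74], [1813, 1711, 1509, 802, 601, 400], 0⟩, ⟨[10, 78], [1516, 1213, 1011, 607,
  405, 302], 0⟩, ⟨[45, 67], [1617, 1417, 1317, 1316, 1215, 1314, 910, 708, 205, 104, 103], 0⟩] [2,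
  3, 1, 4, 5, 3, 1, 0, 3] [([16091448424547145, 16161954876639051, 1023497871977085,
  1094004324068991] : List ℕ).map sixes ++ [octs [0, 4416387368252064988166,
  2272954567916246293510, 4269100522339799989254, 4416961579407889677318, 2199024039380066532358,
  3973232606917739170822, 2125092948999883217926]], ([894022350803609, 964528802895515,
  7513875322141485, 7584381774233391] : List ℕ).map sixes ++ [octs [0, 4564392541056895855622,
  4637891852670013586438, 4638468596545481112582, 3086488472019040476166, 2051449806967908342790,
  4712546341976991616006, 4711822943056635141126]]] = true := by decide +kernel

theorem coverA5_state1026 : coversCheck F6 cA5 T6 S20 KW 1026 [⟨[10, 45], [1316, 1215, 1114, 104,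
  3], 0⟩, ⟨[10, 47], [1217, 1016, 814, 107], 0⟩, ⟨[12, 56], [1617, 1012, 911, 406, 305], 0⟩, ⟨[21,
  65], [1716, 1210, 1109, 604, 503], 0⟩, ⟨[38, 78], [517, 316, 1415, 215, 13, 1112, 910, 506, 304,
  1], 0⟩] [1, 0, 2, 4, 3, 1] [([11868766508196825, 4075005322024475, 12030661530823421,
  1963696534097511] : List ℕ).map sixes ++ [octs [0, 4417105695144647601158,
  4416386244555467979782, 4638757108943146212358, 4342022523828957654022, 4490750529316415097862,
  4564825735435503827974, 1755580761239270730758]], ([8482858002252505, 1251494817773275,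
  2999815327013845, 9557454343753703] : List ℕ).map sixes ++ [octs [0, 4639048724700542286854,
  2125092948999883217926, 4711823226177655970822, 4416961298481597135878, 4490749965264798370822,
  4121239188743497726982, 4564393107303224093702]], ([5948469729022561, 16739731063699203,
  2431930426968741, 8437601713090175] : List ℕ).map sixes ++ [octs [0, 4269245479749498235910,
  2347031467276786740230, 4637602214372450032646, 3234206821273919040518, 4491035940553355717638,
  3751870833607220673542, 4637748017859544001542]], ([606467850130161, 15045379379460051,
  15099429695961693, 8418906836058063] : List ℕ).map sixes ++ [octs [0, 4121379919081797856262,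
  4712832317261253979142, 3529931469233535331334, 2051450371015221713926, 3825655553145838251014,
  4195168867905856658438, 4490317898980821343238]]] = true := by decide +kernel

theorem coverA5_state1044 : coversCheck F6 cA5 T6 S20 KW 1044 [⟨[10, 47], [1217, 1016, 814, 107,
  5], 0⟩, ⟨[10, 48], [1117, 916, 815, 207, 6], 0⟩, ⟨[10, 56], [1617, 1012, 911, 406, 305], 0⟩,
  ⟨[10, 68], [1416, 1113, 810, 507, 204, 1], 0⟩, ⟨[10, 78], [1415, 1112, 910, 506, 304, 201], 0⟩,
  ⟨[45, 67], [1516, 1316, 1216, 1215, 1114, 1213, 809, 607, 104, 3, 2], 0⟩, ⟨[54, 76], [1615,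
  1613, 1612, 1512, 1312, 1411, 908, 706, 302, 401, 300], 0⟩] [1, 2, 0, 4, 3, 6, 5]
  [([12702187801522961, 960637615163107, 8064713457253221, 10395281069633055] : List ℕ).map sixes
  ++ [octs [0, 4269244638076557913094, 4416818027718428380166, 4490174066369383402502,
  4711245639525454109702, 4564681620800404999174, 4121237213463323360262,
  4194737929716523117574]]] = true := by decide +kernel

theorem coverA5_state1152 : coversCheck F6 cA5 T6 S20 KW 1152 [⟨[10, 45], [1316, 1215, 1114, 205,
  104, 3], 0⟩, ⟨[10, 54], [1613, 1512, 1411, 502, 401, 300], 0⟩, ⟨[10, 58], [1417, 913, 812, 407,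
  306], 0⟩, ⟨[10, 68], [1416, 1113, 810, 305, 2], 0⟩, ⟨[35, 41], [716, 615, 210, 109, 8], 2048⟩,
  ⟨[38, 76], [416, 1615, 315, 113, 1312, 12, 908, 706, 403, 100], 0⟩] [1, 3, 0, 4, 1, 5, 2]
  [([4284371823809305, 14476964071950075, 10892663781161541, 10671848039554703] : List ℕ).map
  sixes ++ [octs [0, 2938626289051060673542, 4416386525473187363846, 4712691304882083740678,
  4194449418416222145542, 4712834291426850778118, 4194592124026085743622,
  4343174603662809377798]]] = true := by decide +kernel

theorem coverA5_state1160 : coversCheck F6 cA5 T6 S20 KW 1160 [⟨[10, 45], [1316, 1215, 1114, 504,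
  103, 2], 0⟩, ⟨[10, 48], [1117, 916, 815, 107, 6], 0⟩, ⟨[10, 76], [1615, 1312, 908, 706, 302,
  100], 0⟩, ⟨[36, 72], [717, 415, 314, 512, 111], 512⟩, ⟨[37, 62], [617, 416, 214, 513, 11], 256⟩]
  [1, 0, 3, 4, 2] [([1168351582208865, 11944755427358483, 12864089163647621, 1112669180321383] :
  List ℕ).map sixes ++ [octs [0, 2051449806967908342790, 3455712428299686267910,
  2124948269209361075206, 4712113994766717844486, 4711822098083029228550, 2346453596406199905286,
  4637315389722981891078]]] = true := by decide +kernel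

theorem coverA5_state20518 : coversCheck F6 cA5 T6 S20 KW 20518 [⟨[10, 48], [1117, 916, 815, 307,
  106, 4], 0⟩, ⟨[10, 58], [1417, 913, 812, 307, 107, 306, 2], 0⟩, ⟨[10, 68], [1416, 1113, 810,
  507, 304, 102], 0⟩, ⟨[47, 56], [1617, 1217, 1017, 1016, 814, 1012, 911, 207, 406, 305, 5, 1],
  0⟩, ⟨[65, 74], [1716, 1712, 1710, 1610, 1210, 1109, 1408, 604, 702, 501, 500, 300], 0⟩] [2, 0,
  1, 3, 4] [([338745402684137, 5486223094089403, 16787169269332701, 16318926853791423] : List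
  ℕ).map sixes ++ [octs [0, 3455424760873483791366, 4415810628776787229702,
  4120662725796466031622, 3234208231400809180166, 4417248682778172070918, 4712255854314222283782,
  4268523778457885785094]]] = true := by decide +kernel

theorem coverA5_state20520 : coversCheck F6 cA5 T6 S20 KW 20520 [⟨[10, 48], [1117, 916, 815, 207,
  106, 4], 0⟩, ⟨[10, 56], [1617, 1012, 911, 406, 305, 1], 0⟩, ⟨[36, 51], [717, 415, 314, 312, 211,
  8], 1024⟩, ⟨[38, 42], [517, 316, 215, 213, 112, 10], 256⟩] [0, 1, 3, 2] [([3439385316323993,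
  8007463352530635, 14563428458187285, 269920348454447] : List ℕ).map sixes ++ [octs [0,
  4638034557191119735814, 3160276857893162593286, 4342456280068761623558, 3751724743687656713222,
  4637890443651237592070, 4711677981248907160582, 3973666646257042988038]]] = true := by
  decide +kernel

theorem famReal_cA5 : FamReal F5 cA5 := stepCheck_sound (F' := F6) (Ss := S20) (gens := [⟨[12],
  [10, 111, 212, 313, 414, 515, 616, 717, 818, 919], 0⟩, ⟨[21], [1000, 1101, 1202, 1303, 1404,
  1505, 1606, 1707, 1808, 1909], 0⟩, ⟨[45], [104, 205, 306, 1114, 1215, 1316], 0⟩, ⟨[46], [4, 207,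
  308, 1014, 1217, 1318], 0⟩, ⟨[47], [5, 107, 309, 1015, 1117, 1319], 0⟩, ⟨[54], [401, 502, 603,
  1411, 1512, 1613], 0⟩, ⟨[56], [1, 507, 608, 1011, 1517, 1618], 0⟩, ⟨[57], [2, 407, 609, 1012,
  1417, 1619], 0⟩, ⟨[58], [3, 408, 509, 1013, 1418, 1519], 0⟩, ⟨[64], [400, 702, 803, 1410, 1712,
  1813], 0⟩, ⟨[65], [100, 705, 806, 1110, 1715, 1816], 0⟩, ⟨[68], [103, 406, 709, 1113, 1416,
  1719], 0⟩, ⟨[74], [500, 701, 903, 1510, 1711, 1913], 0⟩, ⟨[75], [200, 704, 906, 1210, 1714,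
  1916], 0⟩, ⟨[76], [201, 504, 908, 1211, 1514, 1918], 0⟩, ⟨[78], [203, 506, 708, 1213, 1516,
  1718], 0⟩, ⟨[84], [600, 801, 902, 1610, 1811, 1912], 0⟩, ⟨[85], [300, 804, 905, 1310, 1814,
  1915], 0⟩, ⟨[86], [301, 604, 907, 1311, 1614, 1917], 0⟩, ⟨[87], [302, 605, 807, 1312, 1615,
  1817], 0⟩]) (sched := [9, 16, 17, 3, 13, 6, 7, 10, 4, 12, 8, 18, 11, 9, 2, 1, 15, 19, 0, 3, 5,
  17, 14, 11, 4, 3]) (kills := [(28, [41]), (44, [51]), (76, [61]), (140, [71]), (268, [81]), (26,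
  [42]), (42, [52]), (74, [62]), (138, [72]), (266, [82])]) (h := by decide +kernel) (hr :=
  famReal_append (coversCheck_sound coverA5_state0) <| famReal_append (coversCheck_sound
  coverA5_state1) <| famReal_append (coversCheck_sound coverA5_state20) <| famReal_append
  (coversCheck_sound coverA5_state1026) <| famReal_append (coversCheck_sound coverA5_state1044) <|
  famReal_append (coversCheck_sound coverA5_state1152) <| famReal_append (coversCheck_sound
  coverA5_state1160) <| famReal_append (coversCheck_sound coverA5_state20518) <| coversCheck_sound
  coverA5_state20520)

/-- The bits `{0, i, j}` with `3 ≤ i < j`. -/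
def S15 : List ℕ := [25, 41, 73, 137, 265, 49, 81, 145, 273, 97, 161, 289, 193, 321, 385]

theorem famReal_FB_c123 : FamReal FB c123 := stepCheck_sound (F' := F5) (Ss := S15) (gens :=
  [⟨[36], [6, 109, 312, 413], 0⟩, ⟨[45], [1, 609, 710, 811], 0⟩, ⟨[46], [2, 509, 712, 813], 0⟩,
  ⟨[57], [103, 507, 912, 1114], 0⟩, ⟨[64], [200, 905, 1207, 1308], 0⟩, ⟨[67], [203, 607, 910,
  1314], 0⟩, ⟨[68], [204, 608, 911, 1214], 0⟩, ⟨[74], [300, 1005, 1206, 1408], 0⟩, ⟨[75], [301,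
  705, 1209, 1411], 0⟩, ⟨[84], [400, 1105, 1306, 1407], 0⟩, ⟨[85], [401, 805, 1309, 1410], 0⟩])
  (sched := [4, 7, 9, 2, 10, 0, 8, 1, 4, 9, 7, 3, 6, 2, 5, 1, 7, 0, 6, 3, 10, 2, 7, 5, 0, 6, 1])
  (kills := []) (h := by decide +kernel) (hr := famReal_append (famReal_singleton famReal_cA0 (u
  := 16897) (by decide +kernel)) <| famReal_append (famReal_singleton famReal_cA1 (u := 513) (by
  decide +kernel)) <| famReal_append (famReal_singleton famReal_cA2 (u := 4128) (by
  decide +kernel)) <| famReal_append (famReal_singleton famReal_cA3 (u := 1) (by decide +kernel)) <|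
  famReal_append (famReal_singleton famReal_cA4 (u := 32) (by decide +kernel)) <|
  famReal_singleton famReal_cA5 (u := 0) (by decide +kernel))

theorem famReal_FB0 : FamReal FB0 c123 := stepCheck_sound (F' := FB) (Ss := []) (gens := [])
  (sched := []) (kills := [(22, [43]), (38, [53]), (70, [63]), (134, [73]), (262, [83])]) (reps :=
  [0]) (h := by decide +kernel) (hr := famReal_singleton famReal_FB_c123 (by decide +kernel))

/-! ### Forms of small rank -/

/-- Fixed bits: `{0, i, j}` except `{0, 7, 8}`. -/
def F2 : ℕ := 4271974072836481878627570469156775157618935711925097529888899929083554011066556928354519572031616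

/-- Fixed bits: all except `{i, 7, 8}`. -/
def F2' : ℕ := 9174135041811100876053037682048559663352018866491264770734336430850893809201148957552763081376422854944896

theorem famReal_F2' : FamReal F2' 0 := stepCheck_sound (F' := cubMask) (Ss := [385, 386, 388, 392,
  400, 416, 448]) (gens := [⟨[1], [1], 0⟩, ⟨[2], [2], 0⟩, ⟨[3], [3], 0⟩, ⟨[4], [4], 0⟩, ⟨[5], [5],
  0⟩, ⟨[10], [100], 0⟩, ⟨[20], [200], 0⟩, ⟨[26], [206], 0⟩, ⟨[30], [300], 0⟩, ⟨[40], [400], 0⟩,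
  ⟨[50], [500], 0⟩, ⟨[62], [602], 0⟩]) (sched := [5, 6, 10, 9, 8, 1, 11, 7, 0, 2, 3, 4]) (kills :=
  []) (h := by decide +kernel) (hr := leavesCheck_sound (l := [(0, []), (1, [0, 256, 128, 384, 1,
  257, 129, 385])]) (by decide +kernel))

theorem famReal_F2 : FamReal F2 0 := splitCheck_sound famReal_FB0 famReal_F2' (l := [(14, []),
  (22, [34, 43, 34]), (26, [34, 24, 43, 23, 34, 42, 24]), (28, [34, 24, 14, 43, 23, 13, 34, 42,
  12, 24, 41, 14]), (38, [45, 35, 54, 45, 43, 34]), (42, [45, 35, 25, 54, 45, 43, 23, 34, 42,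
  24]), (44, [45, 35, 25, 15, 54, 45, 43, 23, 13, 34, 42, 12, 24, 41, 14]), (50, [35, 24, 53, 35,
  42, 24]), (52, [35, 24, 14, 53, 35, 42, 12, 24, 41, 14]), (56, [45, 35, 25, 15, 54, 24, 45, 43,
  13, 34, 52, 25, 41, 14]), (70, [56, 46, 36, 65, 56, 54, 45, 43, 34]), (74, [56, 46, 36, 26, 65,
  56, 54, 45, 43, 23, 34, 42, 24]), (76, [56, 46, 36, 26, 16, 65, 56, 54, 45, 43, 23, 13, 34, 42,
  12, 24, 41, 14]), (82, [56, 36, 65, 56, 24, 53, 35, 42, 24]), (84, [56, 36, 65, 56, 24, 14, 53,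
  35, 42, 12, 24, 41, 14]), (88, [56, 46, 36, 26, 16, 65, 56, 54, 24, 45, 43, 13, 34, 52, 25, 41,
  14]), (98, [56, 46, 36, 26, 65, 45, 25, 56, 64, 46, 53, 35, 42, 24]), (100, [56, 46, 36, 26, 16,
  65, 45, 25, 15, 56, 64, 46, 53, 35, 42, 12, 24, 41, 14]), (104, [46, 36, 16, 25, 64, 46, 43, 13,
  34, 52, 25, 41, 14]), (112, [36, 25, 14, 63, 36, 52, 25, 41, 14]), (134, [67, 57, 47, 37, 76,
  67, 65, 56, 54, 45, 43, 34]), (138, [67, 57, 47, 37, 27, 76, 67, 65, 56, 54, 45, 43, 23, 34, 42,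
  24]), (140, [67, 57, 47, 37, 27, 17, 76, 67, 65, 56, 54, 45, 43, 23, 13, 34, 42, 12, 24, 41,
  14]), (146, [67, 57, 37, 76, 67, 65, 56, 24, 53, 35, 42, 24]), (148, [67, 57, 37, 76, 67, 65,
  56, 24, 14, 53, 35, 42, 12, 24, 41, 14]), (152, [67, 57, 47, 37, 27, 17, 76, 67, 65, 56, 54, 24,
  45, 43, 13, 34, 52, 25, 41, 14]), (162, [67, 57, 47, 37, 27, 76, 67, 65, 45, 25, 56, 64, 46, 53,
  35, 42, 24]), (164, [67, 57, 47, 37, 27, 17, 76, 67, 65, 45, 25, 15, 56, 64, 46, 53, 35, 42, 12,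
  24, 41, 14]), (168, [67, 47, 37, 17, 76, 67, 25, 64, 46, 43, 13, 34, 52, 25, 41, 14]), (176,
  [67, 37, 76, 67, 25, 14, 63, 36, 52, 25, 41, 14]), (194, [57, 37, 46, 26, 75, 57, 64, 46, 53,
  35, 42, 24]), (196, [57, 37, 46, 26, 16, 75, 57, 64, 46, 53, 35, 42, 12, 24, 41, 14]), (200,
  [67, 57, 47, 37, 27, 17, 76, 56, 26, 67, 75, 57, 64, 46, 43, 13, 34, 52, 25, 41, 14]), (208,
  [67, 57, 37, 27, 76, 56, 26, 67, 75, 57, 14, 63, 36, 52, 25, 41, 14]), (224, [67, 57, 47, 37,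
  27, 17, 76, 56, 46, 26, 16, 67, 75, 45, 15, 57, 74, 47, 63, 36, 52, 25, 41, 14]), (262, [78, 68,
  58, 48, 38, 87, 78, 76, 67, 65, 56, 54, 45, 43, 34]), (266, [78, 68, 58, 48, 38, 28, 87, 78, 76,
  67, 65, 56, 54, 45, 43, 23, 34, 42, 24]), (268, [78, 68, 58, 48, 38, 28, 18, 87, 78, 76, 67, 65,
  56, 54, 45, 43, 23, 13, 34, 42, 12, 24, 41, 14]), (274, [78, 68, 58, 38, 87, 78, 76, 67, 65, 56,
  24, 53, 35, 42, 24]), (276, [78, 68, 58, 38, 87, 78, 76, 67, 65, 56, 24, 14, 53, 35, 42, 12, 24,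
  41, 14]), (280, [78, 68, 58, 48, 38, 28, 18, 87, 78, 76, 67, 65, 56, 54, 24, 45, 43, 13, 34, 52,
  25, 41, 14]), (290, [78, 68, 58, 48, 38, 28, 87, 78, 76, 67, 65, 45, 25, 56, 64, 46, 53, 35, 42,
  24]), (292, [78, 68, 58, 48, 38, 28, 18, 87, 78, 76, 67, 65, 45, 25, 15, 56, 64, 46, 53, 35, 42,
  12, 24, 41, 14]), (296, [78, 68, 48, 38, 18, 87, 78, 76, 67, 25, 64, 46, 43, 13, 34, 52, 25, 41,
  14]), (304, [78, 68, 38, 87, 78, 76, 67, 25, 14, 63, 36, 52, 25, 41, 14]), (322, [78, 58, 38,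
  87, 78, 46, 26, 75, 57, 64, 46, 53, 35, 42, 24]), (324, [78, 58, 38, 87, 78, 46, 26, 16, 75, 57,
  64, 46, 53, 35, 42, 12, 24, 41, 14]), (328, [78, 68, 58, 48, 38, 28, 18, 87, 78, 76, 56, 26, 67,
  75, 57, 64, 46, 43, 13, 34, 52, 25, 41, 14]), (336, [78, 68, 58, 38, 28, 87, 78, 76, 56, 26, 67,
  75, 57, 14, 63, 36, 52, 25, 41, 14]), (352, [78, 68, 58, 48, 38, 28, 18, 87, 78, 76, 56, 46, 26,
  16, 67, 75, 45, 15, 57, 74, 47, 63, 36, 52, 25, 41, 14])]) (by decide +kernel)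

/-- Fixed bits: `{0, i, j}` with `1 ≤ i ≤ 4`. -/
def F4 : ℕ := 15241017953772506906432107330783537183323597787893875205446896291028680101625079936

/-- Fixed bits: those of `F4` and `{i, j, k}` with `1 ≤ i < j ≤ 4`. -/
def F4_0 : ℕ := 2110281183575242908648552767611174896527636592440073047371429910187710383436159543424

/-- Fixed bits. -/
def F4_3 : ℕ := 866844136320678542717130597004362747006643622856297031228257720280569462878733305911453063243251256704547849362761856

def F4_2 : ℕ := 236412037178366875286490162819373193024490860955650934736992186385534600884449039847158014651730479254246457942239360

def F4_1 : ℕ := 78804012392788958428830054273125804528952670480489410614175802911775885385877973331084252503850284891671110087108736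

theorem famReal_L4_2 : FamReal F4_2
  8543948146667579748038806677610501947304297333505967352649247926450892836644589025134600400142336 :=
  stepCheck_sound (F' := F4_3) (Ss := [100, 164, 292, 196, 324, 388]) (gens := [⟨[20], [], 12⟩,
  ⟨[21], [], 22⟩]) (sched := [0, 1]) (kills := []) (h := by decide +kernel) (hr :=
  wordsCheck_sound (l := [(0, [12, 2, 21, 12, 10, 1]), (1, [68, 57, 86, 68, 75, 57, 12, 2, 21, 12,
  10, 1]), (2, [78, 68, 58, 87, 78, 76, 56, 67, 75, 57, 12, 2, 21, 12, 10, 1]), (3, [68, 58, 87,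
  67, 78, 86, 76, 56, 67, 75, 57, 12, 2, 21, 12, 10, 1]), (4, [67, 57, 76, 56, 67, 75, 57, 12, 2,
  21, 12, 10, 1]), (5, [68, 57, 86, 75, 57, 12, 2, 21, 12, 10, 1]), (6, [78, 87, 67, 57, 76, 56,
  67, 75, 57, 12, 2, 21, 12, 10, 1]), (7, [78, 68, 57, 86, 76, 56, 75, 57, 12, 2, 21, 12, 10, 1]),
  (32, [12, 2, 21, 12, 10, 1]), (33, [68, 57, 86, 75, 12, 2, 21, 12, 10]), (34, [78, 58, 87, 78,
  76, 56, 75, 65, 56, 12, 2, 21, 12, 10, 1]), (35, [78, 68, 57, 86, 76, 56, 75, 12, 2, 21, 12,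
  10]), (36, [57, 76, 56, 75, 65, 56, 12, 2, 21, 12, 10, 1]), (37, [78, 68, 58, 87, 67, 78, 86,
  76, 56, 75, 65, 56, 12, 21, 1, 10, 1]), (38, [78, 87, 57, 76, 56, 75, 65, 56, 12, 2, 21, 12, 10,
  1]), (39, [68, 87, 67, 57, 86, 75, 65, 12, 21, 1, 10])]) (by decide +kernel) famReal_F2)

theorem famReal_L4_1 : FamReal F4_1
  994646472819573284310764496306195883671685663122367013727343286618523704913994820091904 := stepCheck_sound
  (F' := F4_2) (Ss := [98, 162, 290, 194, 322, 386]) (gens := [⟨[10], [], 12⟩, ⟨[58], [4, 105],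
  0⟩, ⟨[67], [1, 405], 0⟩, ⟨[76], [100, 504], 0⟩, ⟨[85], [400, 501], 0⟩, ⟨[75, 86], [300, 502,
  200, 503], 0⟩]) (sched := [0, 5, 1, 2, 3, 4, 1, 2]) (kills := []) (h := by decide +kernel) (hr
  := famReal_append (wordsCheck_sound (l := [(0, [1, 10, 1]), (1, [68, 57, 86, 68, 75, 57, 1, 10,
  1]), (4, [67, 57, 76, 56, 67, 75, 57, 1, 10, 1])]) (by decide +kernel) famReal_F2) <|
  famReal_singleton famReal_L4_2 (u := 22) (by decide +kernel))

theorem famReal_L4_0 : FamReal F4_0 0 := stepCheck_sound (F' := F4_1) (Ss := [97, 161, 289, 193,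
  321, 385]) (gens := [⟨[56], [103, 204], 0⟩, ⟨[57], [3, 205], 0⟩, ⟨[68], [2, 305], 0⟩, ⟨[75],
  [300, 502], 0⟩, ⟨[86], [200, 503], 0⟩, ⟨[87], [201, 403], 0⟩]) (sched := [3, 0, 1, 5, 3, 4, 2,
  0, 5]) (kills := []) (h := by decide +kernel) (hr := famReal_append (wordsCheck_sound (l := [(0,
  []), (1, [68, 57, 86, 68, 75, 57])]) (by decide +kernel) famReal_F2) <| famReal_singleton
  famReal_L4_1 (u := 12) (by decide +kernel))

theorem famReal_F4 : FamReal F4 0 := splitCheck_sound famReal_FB0 famReal_L4_0 (l := [(14, []),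
  (22, [34, 43, 34]), (26, [34, 24, 43, 23, 34, 42, 24]), (28, [34, 24, 14, 43, 23, 13, 34, 42,
  12, 24, 41, 14]), (38, [45, 35, 54, 45, 43, 34]), (42, [45, 35, 25, 54, 45, 43, 23, 34, 42,
  24]), (44, [45, 35, 25, 15, 54, 45, 43, 23, 13, 34, 42, 12, 24, 41, 14]), (50, [35, 24, 53, 35,
  42, 24]), (52, [35, 24, 14, 53, 35, 42, 12, 24, 41, 14]), (56, [45, 35, 25, 15, 54, 24, 45, 43,
  13, 34, 52, 25, 41, 14]), (70, [56, 46, 36, 65, 56, 54, 45, 43, 34]), (74, [56, 46, 36, 26, 65,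
  56, 54, 45, 43, 23, 34, 42, 24]), (76, [56, 46, 36, 26, 16, 65, 56, 54, 45, 43, 23, 13, 34, 42,
  12, 24, 41, 14]), (82, [56, 36, 65, 56, 24, 53, 35, 42, 24]), (84, [56, 36, 65, 56, 24, 14, 53,
  35, 42, 12, 24, 41, 14]), (88, [56, 46, 36, 26, 16, 65, 56, 54, 24, 45, 43, 13, 34, 52, 25, 41,
  14]), (134, [67, 57, 47, 37, 76, 67, 65, 56, 54, 45, 43, 34]), (138, [67, 57, 47, 37, 27, 76,
  67, 65, 56, 54, 45, 43, 23, 34, 42, 24]), (140, [67, 57, 47, 37, 27, 17, 76, 67, 65, 56, 54, 45,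
  43, 23, 13, 34, 42, 12, 24, 41, 14]), (146, [67, 57, 37, 76, 67, 65, 56, 24, 53, 35, 42, 24]),
  (148, [67, 57, 37, 76, 67, 65, 56, 24, 14, 53, 35, 42, 12, 24, 41, 14]), (152, [67, 57, 47, 37,
  27, 17, 76, 67, 65, 56, 54, 24, 45, 43, 13, 34, 52, 25, 41, 14]), (262, [78, 68, 58, 48, 38, 87,
  78, 76, 67, 65, 56, 54, 45, 43, 34]), (266, [78, 68, 58, 48, 38, 28, 87, 78, 76, 67, 65, 56, 54,
  45, 43, 23, 34, 42, 24]), (268, [78, 68, 58, 48, 38, 28, 18, 87, 78, 76, 67, 65, 56, 54, 45, 43,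
  23, 13, 34, 42, 12, 24, 41, 14]), (274, [78, 68, 58, 38, 87, 78, 76, 67, 65, 56, 24, 53, 35, 42,
  24]), (276, [78, 68, 58, 38, 87, 78, 76, 67, 65, 56, 24, 14, 53, 35, 42, 12, 24, 41, 14]), (280,
  [78, 68, 58, 48, 38, 28, 18, 87, 78, 76, 67, 65, 56, 54, 24, 45, 43, 13, 34, 52, 25, 41, 14])])
  (by decide +kernel)

/-! ### The case of three forms -/

/-- Fixed bits: those of `F5` and `{1, i, j}`. -/
def FE2 : ℕ := 236412037178366875286490162819371128464508473602465946353769431801110616692992199183215275522462134144152560218957952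

/-- Words acting on the covered families by translations. -/
def KW' : List (List ℕ) := [[30], [31], [32], [40], [41], [42], [50], [51], [52], [60], [61],
  [62], [70], [71], [72], [80], [81], [82]]

theorem coverE_state1356 : coversCheck F6
  78804012392788958424558080200287227728730577919942677449633275457387861273945866314567438021311245449392686540783616
  T6 [28, 44, 76, 140, 268, 52, 84, 148, 276, 100, 164, 292, 196, 324, 388] KW' 1356 [] [] [[octs
  [209508544154391043078, 1245129854763377769478, 4041115084854142721030], octs
  [3075092357789217384965, 3075083635852087585285, 3078972508449690495493], octs
  [1726854162718458144259, 250394350035741234691, 3128951692283993699843], octs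
  [4272723136664985087495, 1246734013663689989639, 3613531248768950623751]]] = true := by
  decide +kernel

theorem coverE_state1362 : coversCheck F6
  78804012392788958424558080200287227728730577919942677449633275457387861273945866314567438021311245449392686540783616
  T6 [28, 44, 76, 140, 268, 52, 84, 148, 276, 100, 164, 292, 196, 324, 388] KW' 1362 [] [] [[octs
  [579597727600054197254, 1391981825655884696582, 1091350773625807129606], octs
  [3223659085792374352389, 4255964594173233146373, 2708735516594014710277], octs
  [914619862654007617027, 3645598446839223285251, 3649918791449781970435], octs
  [4056403716572301934087, 1987475669138766867975, 213145780405730586119]]] = true := by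
  decide +kernel

theorem coverE_state6289 : coversCheck F6
  78804012392788958424558080200287227728730577919942677449633275457387861273945866314567438021311245449392686540783616
  T6 [28, 44, 76, 140, 268, 52, 84, 148, 276, 100, 164, 292, 196, 324, 388] KW' 6289 [] [] [[octs
  [1834839889863472028678, 1243406373021678279686, 1752838650766982618118, 4712545479969568590854,
  4704319936725205490694, 1828210894118846176262, 4114021874575259311110], octs
  [423656911439779920389, 1454656104408307685893, 2777783296502594492933, 497002524537586514437,
  1230129986640436242949, 418608385050369391109, 1233440135136801151493], octs
  [1140014029974314841603, 1506069154189198243331, 3424379375886143485443, 691953150996595504643,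
  1733328675942301447683, 3578003063003430143491, 3570811377325949482499], octs
  [2356999395687649893895, 2873644736359941717511, 2284211344410165603847, 217321471006400757255,
  3020653208429408411143, 2353246765232575864327, 3019209527128592604679]]] = true := by
  decide +kernel

theorem famReal_FE2_forms : FamReal FE2
  78804012392788958424558080200287227728730577919942677449633275457387861273945866314567438021311245449392686540783616
  := stepCheck_sound (F' := F6) (Ss := [28, 44, 76, 140, 268, 52, 84, 148, 276, 100, 164, 292,
  196, 324, 388]) (gens := [⟨[20], [], 16897⟩, ⟨[21], [], 692⟩, ⟨[65, 45, 63, 83, 47], [814, 612,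
  1311, 811, 1210, 710, 510, 609, 605, 1304, 1403, 1203, 3, 1302, 1301, 1101, 901, 201, 1, 800,
  600], 0⟩, ⟨[43, 47, 83, 85, 67], [1314, 814, 612, 1410, 910, 510, 1309, 607, 805, 804, 1403,
  703, 203, 3, 1302, 602, 1101, 801, 501, 401, 800], 0⟩, ⟨[10, 36, 54, 38, 74, 56, 10], [314,
  1113, 413, 213, 113, 1012, 312, 111, 109, 1408, 1108, 8, 1007, 1206, 906, 506, 6, 1005, 102,
  300, 100], 0⟩]) (sched := [0, 1, 2, 4, 3, 2, 4, 3, 2, 4, 2, 3, 4, 2, 3, 4, 2, 4, 2]) (kills :=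
  []) (h := by decide +kernel) (hr := famReal_append (wordsCheck_sound (l := [(0, [12, 2, 21, 12,
  10, 1]), (1, [46, 35, 64, 46, 53, 35, 12, 2, 21, 12, 10, 1]), (2, [56, 46, 36, 65, 56, 54, 34,
  45, 53, 35, 12, 2, 21, 12, 10, 1]), (4, [45, 35, 54, 34, 45, 53, 35, 12, 2, 21, 12, 10, 1]), (5,
  [46, 35, 64, 53, 35, 12, 2, 21, 12, 10, 1]), (16, [45, 35, 54, 34, 45, 53, 35, 12, 2, 21, 12,
  10, 1]), (17, [46, 35, 64, 46, 53, 35, 12, 2, 21, 12, 10, 1]), (20, [45, 35, 54, 34, 45, 53, 35,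
  12, 2, 21, 12, 10, 1]), (21, [46, 35, 64, 53, 35, 12, 2, 21, 12, 10, 1]), (37, [68, 48, 57, 37,
  86, 68, 75, 57, 64, 46, 53, 35, 12, 2, 21, 12, 10, 1]), (38, [68, 48, 57, 37, 86, 68, 75, 57,
  64, 46, 53, 35, 12, 2, 21, 12, 10, 1]), (39, [68, 48, 57, 37, 86, 68, 75, 57, 64, 46, 53, 35,
  12, 2, 21, 12, 10, 1]), (40, [78, 68, 58, 48, 38, 87, 78, 76, 56, 36, 67, 75, 57, 64, 46, 53,
  35, 12, 2, 21, 12, 10, 1]), (41, [78, 68, 58, 48, 38, 87, 78, 76, 56, 36, 67, 75, 57, 64, 46,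
  53, 35, 12, 2, 21, 12, 10, 1]), (48, [67, 57, 47, 37, 76, 56, 36, 67, 75, 57, 64, 46, 53, 35,
  12, 2, 21, 12, 10, 1]), (49, [67, 57, 47, 37, 76, 56, 36, 67, 75, 57, 64, 46, 53, 35, 12, 2, 21,
  12, 10, 1]), (50, [67, 57, 47, 37, 76, 56, 36, 67, 75, 57, 64, 46, 53, 35, 12, 2, 21, 12, 10,
  1]), (70, [68, 48, 57, 37, 86, 68, 75, 57, 64, 46, 53, 35, 12, 2, 21, 12, 10, 1]), (71, [68, 48,
  57, 37, 86, 68, 75, 57, 64, 46, 53, 35, 12, 2, 21, 12, 10, 1]), (72, [78, 68, 48, 87, 78, 76,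
  67, 35, 64, 46, 53, 35, 12, 2, 21, 12, 10, 1]), (75, [68, 48, 57, 86, 68, 75, 35, 64, 46, 53,
  35, 12, 2, 21, 12, 10, 1]), (76, [78, 68, 48, 87, 78, 76, 67, 35, 64, 46, 53, 35, 12, 2, 21, 12,
  10, 1]), (77, [78, 68, 48, 87, 78, 76, 67, 35, 64, 46, 53, 35, 12, 2, 21, 12, 10, 1]), (78, [68,
  48, 57, 86, 68, 75, 35, 64, 46, 53, 35, 12, 2, 21, 12, 10, 1]), (79, [68, 48, 57, 86, 68, 75,
  35, 64, 46, 53, 35, 12, 2, 21, 12, 10, 1]), (80, [67, 47, 76, 67, 35, 64, 46, 53, 35, 12, 2, 21,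
  12, 10, 1]), (81, [67, 47, 76, 67, 35, 64, 46, 53, 35, 12, 2, 21, 12, 10, 1]), (82, [78, 68, 48,
  38, 87, 67, 57, 47, 37, 86, 68, 75, 65, 45, 56, 64, 46, 53, 35, 12, 2, 21, 12, 10, 1]), (86,
  [78, 68, 48, 38, 87, 67, 57, 47, 37, 86, 68, 75, 65, 45, 56, 64, 46, 53, 35, 12, 2, 21, 12, 10,
  1]), (87, [78, 68, 48, 38, 87, 67, 57, 47, 37, 86, 68, 75, 65, 45, 56, 64, 46, 53, 35, 12, 2,
  21, 12, 10, 1]), (88, [78, 87, 67, 47, 76, 67, 35, 64, 46, 53, 35, 12, 2, 21, 12, 10, 1]), (89,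
  [78, 87, 67, 47, 76, 67, 35, 64, 46, 53, 35, 12, 2, 21, 12, 10, 1]), (94, [68, 48, 87, 67, 57,
  47, 86, 68, 75, 65, 45, 35, 64, 46, 53, 35, 12, 2, 21, 12, 10, 1]), (95, [68, 48, 87, 67, 57,
  47, 86, 68, 75, 65, 45, 35, 64, 46, 53, 35, 12, 2, 21, 12, 10, 1]), (144, [46, 35, 64, 46, 53,
  35, 12, 2, 21, 12, 10, 1]), (280, [46, 35, 64, 46, 53, 35, 12, 2, 21, 12, 10, 1]), (281, [46,
  35, 64, 46, 53, 35, 12, 2, 21, 12, 10, 1]), (282, [57, 76, 56, 46, 36, 75, 65, 45, 56, 64, 46,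
  53, 35, 12, 2, 21, 12, 10, 1]), (283, [57, 76, 56, 46, 36, 75, 65, 45, 56, 64, 46, 53, 35, 12,
  2, 21, 12, 10, 1]), (350, [68, 57, 86, 46, 75, 35, 64, 46, 53, 35, 12, 2, 21, 12, 10, 1]), (378,
  [68, 58, 87, 67, 78, 86, 76, 56, 46, 75, 65, 45, 35, 64, 46, 53, 35, 12, 2, 21, 12, 10, 1]),
  (379, [68, 58, 87, 67, 78, 86, 76, 56, 46, 75, 65, 45, 35, 64, 46, 53, 35, 12, 2, 21, 12, 10,
  1]), (1351, [68, 87, 67, 57, 47, 86, 76, 56, 67, 75, 65, 45, 35, 64, 54, 34, 53, 43, 12, 2, 21,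
  12, 10]), (1360, [78, 68, 58, 87, 67, 78, 86, 46, 36, 75, 65, 45, 56, 64, 53, 43, 12, 2, 21, 12,
  10]), (1371, [78, 68, 87, 67, 57, 86, 46, 75, 35, 64, 46, 53, 43, 34, 12, 21, 1, 10, 1])]) (by
  decide +kernel) famReal_F4) <| famReal_append (coversCheck_sound coverE_state1356) <|
  famReal_append (coversCheck_sound coverE_state1362) <| coversCheck_sound coverE_state6289)

theorem famReal_F5_forms : FamReal F5
  78804012392788958424558080200287227610159478540930893335896586808491443542994421222828690966094859810288443102068736
  := stepCheck_sound (F' := FE2) (Ss := [26, 42, 74, 138, 266, 50, 82, 146, 274, 98, 162, 290,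
  194, 322, 386]) (gens := [⟨[10], [], 16897⟩, ⟨[34], [408, 307, 206, 105], 0⟩, ⟨[43], [804, 703,
  602, 501], 0⟩, ⟨[56], [1113, 1012, 506, 102], 0⟩, ⟨[65], [1311, 1210, 605, 201], 0⟩, ⟨[78],
  [1213, 1011, 708, 304], 0⟩, ⟨[87], [1312, 1110, 807, 403], 0⟩, ⟨[35, 64], [411, 310, 209, 1308,
  1207, 905, 5, 200], 0⟩, ⟨[37, 84], [414, 212, 110, 1407, 7, 1306, 1105, 400], 0⟩, ⟨[67, 85],
  [1314, 1410, 910, 1309, 607, 805, 203, 401], 0⟩]) (sched := [0, 2, 1, 7, 2, 8, 2, 5, 1, 6, 9, 5,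
  3, 4, 8, 9, 5, 3, 2, 6, 9, 8, 5, 3, 7]) (kills := []) (h := by decide +kernel) (hr :=
  famReal_append (wordsCheck_sound (l := [(0, [1, 10, 1]), (1, [46, 35, 64, 46, 53, 35, 1, 10,
  1]), (2, [56, 46, 36, 65, 56, 54, 34, 45, 53, 35, 1, 10, 1]), (36, [68, 48, 57, 37, 86, 68, 75,
  57, 64, 46, 53, 35, 1, 10, 1]), (37, [68, 48, 57, 37, 86, 68, 75, 57, 64, 46, 53, 35, 1, 10,
  1]), (40, [78, 68, 58, 48, 38, 87, 78, 76, 56, 36, 67, 75, 57, 64, 46, 53, 35, 1, 10, 1])]) (by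
  decide +kernel) famReal_F4) <| famReal_singleton famReal_FE2_forms (u := 692) (by
  decide +kernel))

theorem famReal_FB_forms : FamReal FB 0 := stepCheck_sound (F' := F5) (Ss := [25, 41, 73, 137,
  265, 49, 81, 145, 273, 97, 161, 289, 193, 321, 385]) (gens := [⟨[34], [408, 307, 206, 105], 0⟩,
  ⟨[35], [411, 310, 209, 5], 0⟩, ⟨[37], [414, 212, 110, 7], 0⟩, ⟨[47], [814, 612, 510, 3], 0⟩,
  ⟨[53], [1104, 1003, 902, 500], 0⟩, ⟨[56], [1113, 1012, 506, 102], 0⟩, ⟨[65], [1311, 1210, 605,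
  201], 0⟩, ⟨[68], [1214, 911, 608, 204], 0⟩, ⟨[73], [1404, 1202, 1001, 700], 0⟩, ⟨[74], [1408,
  1206, 1005, 300], 0⟩, ⟨[76], [1413, 1009, 706, 302], 0⟩, ⟨[83], [1403, 1302, 1101, 800], 0⟩,
  ⟨[84], [1407, 1306, 1105, 400], 0⟩, ⟨[86], [1412, 1109, 806, 402], 0⟩]) (sched := [4, 8, 9, 11,
  12, 1, 0, 6, 4, 10, 13, 6, 3, 8, 7, 5, 1, 2, 11, 10, 7, 2, 5]) (kills := []) (h := by
  decide +kernel) (hr := famReal_append (wordsCheck_sound (l := [(0, []), (1, [46, 35, 64, 46, 53, 35]),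
  (36, [68, 48, 57, 37, 86, 68, 75, 57, 64, 46, 53, 35])]) (by decide +kernel) famReal_F4) <|
  famReal_singleton famReal_F5_forms (u := 16897) (by decide +kernel))

/-- Fixed bits: all `{0, 1, k}` and `{0, 2, k}`. -/
def FT : ℕ := 4631683569492647816942839400347516314144410681302460100117576214376916097443968

theorem famReal_FT : FamReal FT 0 := splitCheck_sound famReal_FB0 famReal_FB_forms (l := [(14,
  []), (22, [34, 43, 34]), (38, [45, 35, 54, 45, 43, 34]), (70, [56, 46, 36, 65, 56, 54, 45, 43,
  34]), (134, [67, 57, 47, 37, 76, 67, 65, 56, 54, 45, 43, 34]), (262, [78, 68, 58, 48, 38, 87,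
  78, 76, 67, 65, 56, 54, 45, 43, 34])]) (by decide +kernel)

/-! ### Alternating matrices of linear forms -/

section Adjugate

variable {ι : Type} [Fintype ι] [DecidableEq ι]

theorem adjugate_mul_comm_of_mulVec_eq_zero {R : Type} [CommRing R] {M : Matrix ι ι R} {x : ι → R}
    (h : M.mulVec x = 0) (i j k : ι) : M.adjugate i j * x k = x i * M.adjugate k j := by
  have key : (M.updateRow j (Pi.single i 1)).mulVec x = Pi.single j (x i) := by
    ext l
    rcases eq_or_ne l j with rfl | hl
    · simp [Matrix.mulVec, Matrix.updateRow_self]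
    · have := congrFun h l
      simpa [Matrix.mulVec, Matrix.updateRow_ne hl, hl] using this
  have h2 := congrArg (fun w => (M.updateRow j (Pi.single i 1)).adjugate.mulVec w k) key
  simp only [Matrix.mulVec_mulVec, Matrix.adjugate_mul, Matrix.smul_mulVec, Matrix.one_mulVec,
    Pi.smul_apply, smul_eq_mul, Matrix.mulVec_single] at h2
  rw [Matrix.adjugate_apply M i j, h2, Matrix.adjugate_apply M k j]
  simp [Matrix.adjugate_apply, Matrix.updateRow_idem, mul_comm]

/-- The matrix of linear forms attached to an array of coefficients. -/
noncomputable def formMatrix (t : ι → ι → ι → ZMod 2) : Matrix ι ι (MvPolynomial ι (ZMod 2)) :=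
  Matrix.of fun j k => ∑ l, C (t l j k) * X l

theorem isHomogeneous_adjugate_formMatrix (t : ι → ι → ι → ZMod 2) (i : ι) :
    ((formMatrix t).adjugate i i).IsHomogeneous (Fintype.card ι - 1) := by
  rw [Matrix.adjugate_apply, Matrix.det_apply]
  refine IsHomogeneous.sum _ _ _ fun σ _ => ?_
  have h : (∏ l, (formMatrix t).updateRow i (Pi.single i 1) (σ l) l).IsHomogeneous
      (∑ l, if σ l = i then 0 else 1) := by
    refine IsHomogeneous.prod _ _ _ fun l _ => ?_
    split_ifs with hl
    · rw [hl, Matrix.updateRow_self]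
      rcases eq_or_ne l i with rfl | h
      · simpa using isHomogeneous_one ι (ZMod 2)
      · simpa [h] using isHomogeneous_zero ι (ZMod 2) 0
    · rw [Matrix.updateRow_ne hl]
      exact IsHomogeneous.sum _ _ _ fun k _ => by
        simpa using (isHomogeneous_C ι (t k (σ l) l)).mul (isHomogeneous_X (ZMod 2) k)
  have hc : (∑ l, if σ l = i then 0 else 1) = Fintype.card ι - 1 := by
    rw [Equiv.sum_comp σ fun l => if l = i then 0 else 1]
    rw [Finset.sum_ite, Finset.sum_const_zero, zero_add, Finset.sum_const, smul_eq_mul, mul_one,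
      Finset.filter_ne', Finset.card_erase_of_mem (Finset.mem_univ i), Finset.card_univ]
  rw [hc] at h
  rcases Int.units_eq_one_or (Equiv.Perm.sign σ) with hs | hs
  · simpa [hs] using h
  · simpa [hs] using h.neg

theorem exists_adjugate_eq [Nontrivial ι] {t : ι → ι → ι → ZMod 2} (h₁ : ∀ i j k, t i j k = t i k j)
    (h₂ : ∀ i j k, t i j k = t k j i) (h₃ : ∀ i k, t i k i = 0) :
    ∃ q : MvPolynomial ι (ZMod 2), q.totalDegree < Fintype.card ι ∧ (3 < Fintype.card ι → eval 0 q = 0) ∧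
      ∀ i j, (formMatrix t).adjugate i j = q * X i * X j := by
  set A := (formMatrix t).adjugate with hA
  have hM : (formMatrix t).mulVec X = 0 := by
    ext1 j
    simp only [Matrix.mulVec, dotProduct, formMatrix, Matrix.of_apply, Pi.zero_apply, Finset.sum_mul]
    rw [← Finset.sum_product', ]
    refine Finset.sum_involution (fun p _ => (p.2, p.1)) ?_ ?_ ?_ ?_
    · rintro ⟨k, l⟩ -
      simp only
      rw [h₂ l j k, mul_assoc, mul_assoc, mul_comm (X l), ]
      exact CharTwo.add_self_eq_zero _
    · rintro ⟨k, l⟩ - h hkl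
      simp only [Prod.mk.injEq] at hkl
      obtain ⟨rfl, -⟩ := hkl
      simp [h₃] at h
    · simp
    · simp
  have hsymm : ∀ i j, A i j = A j i := by
    intro i j
    have : (formMatrix t).transpose = formMatrix t := by
      ext1 j k
      simp [formMatrix, h₁ _ j k]
    rw [hA, ← Matrix.transpose_apply (formMatrix t).adjugate, Matrix.adjugate_transpose, this]
  have hcomm : ∀ i j k, A i j * X k = X i * A k j := adjugate_mul_comm_of_mulVec_eq_zero hM
  obtain ⟨a, b, hab⟩ := exists_pair_ne ι
  have hdvd : (X a : MvPolynomial ι (ZMod 2)) ^ 2 ∣ A a a := by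
    have : A a a * X b ^ 2 = X a ^ 2 * A b b := by
      linear_combination X b * hcomm a a b + X a * hcomm a b b + X a * X b * hsymm b a
    refine (X_prime (i := a) (R := ZMod 2)).pow_dvd_of_dvd_mul_right 2 ?_ ⟨_, this⟩
    · intro h
      have := (X_prime (i := a) (R := ZMod 2)).dvd_of_dvd_pow h
      exact hab ((X_dvd_X (R := ZMod 2)).1 this)
  obtain ⟨q, hq⟩ := hdvd
  have hX : ∀ i, (X i : MvPolynomial ι (ZMod 2)) ≠ 0 := fun i => X_ne_zero i
  have h1 : ∀ j, A j a = q * X a * X j := by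
    intro j
    apply mul_left_cancel₀ (hX a)
    linear_combination X j * hq - hcomm a a j
  have h2 : ∀ i j, A i j = q * X i * X j := by
    intro i j
    apply mul_left_cancel₀ (hX a)
    linear_combination X i * h1 j + X i * hsymm a j - hcomm a j i
  refine ⟨q, ?_, ?_, h2⟩
  · rcases eq_or_ne q 0 with rfl | hq0
    · simpa using Fintype.card_pos
    · have hd := (isHomogeneous_adjugate_formMatrix t a).totalDegree_le
      rw [← hA, hq, totalDegree_mul_of_isDomain (pow_ne_zero _ (hX a)) hq0] at hd
      have := Fintype.one_lt_card (α := ι)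
      omega
  · intro hcard
    have hd := isHomogeneous_adjugate_formMatrix t a
    rw [← hA, hq] at hd
    have := hd.coeff_eq_zero (d := Finsupp.single a 2) (by simp; omega)
    rw [X_pow_eq_monomial, show Finsupp.single a 2 = Finsupp.single a 2 + 0 by simp,
      add_zero, coeff_monomial_mul', if_pos le_rfl] at this
    rw [eval_zero, constantCoeff_eq]; simpa using this

theorem exists_adjugate_eq_zero [Nontrivial ι] (hcard : 3 < Fintype.card ι) {t : ι → ι → ι → ZMod 2}
    (h₁ : ∀ i j k, t i j k = t i k j) (h₂ : ∀ i j k, t i j k = t k j i) (h₃ : ∀ i k, t i k i = 0) :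
    ∃ x : ι → ZMod 2, x ≠ 0 ∧ (Matrix.of fun j k => ∑ l, t l j k * x l).adjugate = 0 := by
  obtain ⟨q, hdeg, h0, hq⟩ := exists_adjugate_eq h₁ h₂ h₃
  have hsum : ∑ x : ι → ZMod 2, eval x q = 0 := by
    apply sum_eval_eq_zero
    simpa using hdeg
  by_contra! hne
  have h1 : ∀ x ∈ Finset.univ.erase (0 : ι → ZMod 2), eval x q = 1 := by
    intro x hx
    by_contra hq1
    have hq0 : eval x q = 0 := by
      generalize eval x q = y at hq1
      revert hq1; revert y; decide
    refine hne x (Finset.ne_of_mem_erase hx) ?_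
    ext i j
    have : (Matrix.of fun j k => ∑ l, t l j k * x l) = (eval x).mapMatrix (formMatrix t) := by
      ext j k; simp [formMatrix]
    rw [this, ← RingHom.map_adjugate, RingHom.mapMatrix_apply, Matrix.map_apply, hq]
    simp [hq0]
  rw [← Finset.sum_erase_add _ _ (Finset.mem_univ 0), h0 hcard, Finset.sum_congr rfl h1,
    Finset.sum_const, Finset.card_erase_of_mem (Finset.mem_univ _), Finset.card_univ,
    Fintype.card_fun, ZMod.card] at hsum
  have hpos : 0 < Fintype.card ι := Fintype.card_pos
  have hodd : Odd (2 ^ Fintype.card ι - 1) :=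
    Nat.Even.sub_odd Nat.one_le_two_pow ((Nat.even_pow.2 ⟨even_two, hpos.ne'⟩)) odd_one
  rw [nsmul_eq_mul, mul_one, add_zero, ZMod.natCast_eq_zero_iff] at hsum
  exact (Nat.not_even_iff_odd.2 hodd) (even_iff_two_dvd.2 hsum)

theorem det_eq_zero_of_odd_card (hcard : Odd (Fintype.card ι)) {M : Matrix ι ι (ZMod 2)}
    (hs : ∀ i j, M i j = M j i) (h0 : ∀ i, M i i = 0) : M.det = 0 := by
  rw [Matrix.det_apply]
  have hinv : ∀ σ : Equiv.Perm ι, Equiv.Perm.sign σ⁻¹ • ∏ i, M (σ⁻¹ i) i =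
      Equiv.Perm.sign σ • ∏ i, M (σ i) i := by
    intro σ
    rw [Equiv.Perm.sign_inv, ← Equiv.prod_comp σ]
    simp [hs]
  refine Finset.sum_involution (fun σ _ => σ⁻¹) ?_ ?_ ?_ ?_
  · intro σ _
    rw [hinv]
    exact CharTwo.add_self_eq_zero _
  · intro σ _ hne h
    apply hne
    have h2 : σ ^ 2 = 1 := by rw [pow_two]; nth_rewrite 1 [← h]; exact inv_mul_cancel σ
    obtain ⟨i, hi⟩ : ∃ i, σ i = i := Equiv.Perm.exists_fixed_point_of_prime (p := 2) (n := 1)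
      (fun h => Nat.not_even_iff_odd.2 hcard (even_iff_two_dvd.2 h)) (by simpa using h2)
    rw [Finset.prod_eq_zero (Finset.mem_univ i) (by rw [hi, h0]), smul_zero]
  · simp
  · simp

end Adjugate

/-! ### Trilinear forms of Boolean functions -/

section Trilinear

open Matrix

variable {ι : Type} [Fintype ι] [DecidableEq ι]

theorem eq_one_of_ne_zero {a : ZMod 2} (h : a ≠ 0) : a = 1 := by
  revert h; revert a; decide

theorem mul_self_zmod_two (a : ZMod 2) : a * a = a := by
  revert a; decide

/-- The trilinear form `∑ f(v) (a·v) (b·v) (c·v)`. -/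
def tri (f : (ι → ZMod 2) → ZMod 2) (a b c : ι → ZMod 2) : ZMod 2 :=
  ∑ v, f v * (a ⬝ᵥ v) * (b ⬝ᵥ v) * (c ⬝ᵥ v)

theorem tri_swap_left (f : (ι → ZMod 2) → ZMod 2) (a b c : ι → ZMod 2) : tri f a b c = tri f b a c :=
  Finset.sum_congr rfl fun _ _ => by ring

theorem tri_swap_right (f : (ι → ZMod 2) → ZMod 2) (a b c : ι → ZMod 2) : tri f a b c = tri f a c b :=
  Finset.sum_congr rfl fun _ _ => by ring

theorem tri_eq_sum_right (f : (ι → ZMod 2) → ZMod 2) (a b c : ι → ZMod 2) :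
    tri f a b c = ∑ k, c k * tri f a b (Pi.single k 1) := by
  simp only [tri, Finset.mul_sum, single_one_dotProduct]
  rw [Finset.sum_comm]
  refine Finset.sum_congr rfl fun v _ => ?_
  rw [show c ⬝ᵥ v = ∑ k, c k * v k from rfl, Finset.mul_sum]
  exact Finset.sum_congr rfl fun _ _ => by ring

theorem tri_eq_sum_mid (f : (ι → ZMod 2) → ZMod 2) (a b c : ι → ZMod 2) :
    tri f a b c = ∑ k, b k * tri f a (Pi.single k 1) c := by
  rw [tri_swap_right, tri_eq_sum_right]
  exact Finset.sum_congr rfl fun _ _ => by rw [tri_swap_right]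

theorem tri_eq_sum_left (f : (ι → ZMod 2) → ZMod 2) (a b c : ι → ZMod 2) :
    tri f a b c = ∑ k, a k * tri f (Pi.single k 1) b c := by
  rw [tri_swap_left, tri_eq_sum_mid]
  exact Finset.sum_congr rfl fun _ _ => by rw [tri_swap_left]

theorem tri_eq_zero_of_span {κ : Type} {f : (ι → ZMod 2) → ZMod 2} {b : κ → ι → ZMod 2}
    (hb : ⊤ ≤ Submodule.span (ZMod 2) (Set.range b)) {y z : ι → ZMod 2} (h : ∀ i, tri f (b i) y z = 0)
    (a : ι → ZMod 2) : tri f a y z = 0 := by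
  induction hb (Submodule.mem_top (x := a)) using Submodule.span_induction with
  | mem a ha => obtain ⟨i, rfl⟩ := ha; exact h i
  | zero => simp [tri]
  | add a c _ _ ha hc =>
    have : tri f (a + c) y z = tri f a y z + tri f c y z := by
      rw [tri, tri, tri, ← Finset.sum_add_distrib]
      exact Finset.sum_congr rfl fun _ _ => by rw [add_dotProduct]; ring
    rw [this, ha, hc, add_zero]
  | smul r a _ ha =>
    have : tri f (r • a) y z = r * tri f a y z := by
      rw [tri, tri, Finset.mul_sum]
      exact Finset.sum_congr rfl fun _ _ => by rw [smul_dotProduct, smul_eq_mul]; ring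
    rw [this, ha, mul_zero]

theorem tri_eq_zero_of_spans {κ : Type} {f : (ι → ZMod 2) → ZMod 2} {b : κ → ι → ZMod 2}
    (hb : ⊤ ≤ Submodule.span (ZMod 2) (Set.range b)) (h : ∀ i j k, tri f (b i) (b j) (b k) = 0)
    (x y z : ι → ZMod 2) : tri f x y z = 0 := by
  refine tri_eq_zero_of_span hb (fun i => ?_) x
  rw [tri_swap_left]
  refine tri_eq_zero_of_span hb (fun j => ?_) y
  rw [tri_swap_right, tri_swap_left]
  refine tri_eq_zero_of_span hb (fun k => ?_) z
  rw [tri_swap_left, tri_swap_right, tri_swap_left]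
  exact h i j k

/-- Kernel vectors of the alternating forms `tri f x` may be tested away from one coordinate. -/
theorem tri_eq_zero_of_forall_ne {f : (ι → ZMod 2) → ZMod 2} {x y w : ι → ZMod 2} {i : ι}
    (hw : tri f x y w = 0) (hi : w i ≠ 0)
    (h : ∀ l ≠ i, w l ≠ 0 → tri f x y (Pi.single l 1) = 0) : tri f x y (Pi.single i 1) = 0 := by
  rw [tri_eq_sum_right, Finset.sum_eq_single i] at hw
  · rwa [eq_one_of_ne_zero hi, one_mul] at hw
  · intro l _ hl
    rcases eq_or_ne (w l) 0 with h0 | h0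
    · rw [h0, zero_mul]
    · rw [h l hl h0, mul_zero]
  · simp

theorem tri_eq_zero_of_single {f : (ι → ZMod 2) → ZMod 2} {x y : ι → ZMod 2}
    (h : ∀ l, tri f x y (Pi.single l 1) = 0) (w : ι → ZMod 2) : tri f x y w = 0 := by
  rw [tri_eq_sum_right]
  simp [h]

theorem exists_isotropic (hodd : Odd (Fintype.card ι)) (hcard : 3 < Fintype.card ι)
    {f : (ι → ZMod 2) → ZMod 2} (halt : ∀ a c, tri f a a c = 0) :
    ∃ x y z, LinearIndependent (ZMod 2) ![x, y, z] ∧ (∀ w, tri f x y w = 0) ∧ ∀ w, tri f x z w = 0 := by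
  have : Nontrivial ι := Fintype.one_lt_card_iff_nontrivial.1 (by omega)
  have hxx : ∀ x y, tri f x y x = 0 := fun x y => by rw [tri_swap_right, halt]
  have hyy : ∀ x y, tri f x y y = 0 := fun x y => by rw [tri_swap_left, tri_swap_right, halt]
  obtain ⟨x, hx, hadj⟩ := exists_adjugate_eq_zero hcard
    (t := fun i j k => tri f (Pi.single i 1) (Pi.single j 1) (Pi.single k 1))
    (fun i j k => tri_swap_right ..) (fun i j k => by rw [tri_swap_left, tri_swap_right, tri_swap_left])
    (fun i k => hxx _ _)
  set M : Matrix ι ι (ZMod 2) := Matrix.of fun j k => tri f x (Pi.single k 1) (Pi.single j 1) with hM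
  have hadj : M.adjugate = 0 := by
    rw [← hadj]
    congr 1
    ext j k
    simp only [hM, Matrix.of_apply]
    rw [tri_eq_sum_left]
    exact Finset.sum_congr rfl fun l _ => by rw [tri_swap_right, mul_comm]
  have hMv : ∀ y l, (M *ᵥ y) l = tri f x y (Pi.single l 1) := by
    intro y l
    rw [tri_eq_sum_mid, Matrix.mulVec, dotProduct]
    exact Finset.sum_congr rfl fun _ _ => mul_comm _ _
  obtain ⟨i, hi⟩ : ∃ i, x i ≠ 0 := Function.ne_iff.1 hx
  have hdet : (M.updateRow i (Pi.single i 1)).det = 0 := by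
    rw [← Matrix.adjugate_apply, hadj]; rfl
  obtain ⟨y, hy0, hy⟩ := Matrix.exists_mulVec_eq_zero_iff.2 hdet
  have hyi : y i = 0 := by
    have := congrFun hy i
    simpa [Matrix.mulVec, Matrix.updateRow_self] using this
  have hxy : ∀ w, tri f x y w = 0 := by
    have hne : ∀ l ≠ i, tri f x y (Pi.single l 1) = 0 := by
      intro l hl
      rw [← hMv]
      have := congrFun hy l
      simpa [Matrix.mulVec, Matrix.updateRow_ne hl] using this
    apply tri_eq_zero_of_single
    intro l
    rcases eq_or_ne l i with rfl | hl
    · exact tri_eq_zero_of_forall_ne (hxx x y) hi fun l hl _ => hne l hl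
    · exact hne l hl
  obtain ⟨j, hj⟩ : ∃ j, y j ≠ 0 := Function.ne_iff.1 hy0
  have hij : i ≠ j := by rintro rfl; exact hj hyi
  let s : Finset ι := {i, j}ᶜ
  have hs : Odd (Fintype.card s) := by
    rw [Fintype.card_coe, Finset.card_compl, Finset.card_pair hij]
    exact Nat.Odd.sub_even (by omega) hodd even_two
  obtain ⟨u, hu0, hu⟩ := Matrix.exists_mulVec_eq_zero_iff.2
    (det_eq_zero_of_odd_card hs (M := M.submatrix ((↑) : s → ι) (↑))
      (fun a b => by simp only [hM, Matrix.submatrix_apply, Matrix.of_apply]; rw [tri_swap_right])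
      (fun a => hyy _ _))
  let z : ι → ZMod 2 := fun l => if h : l ∈ s then u ⟨l, h⟩ else 0
  have hzi : z i = 0 := dif_neg (by simp [s])
  have hzj : z j = 0 := dif_neg (by simp [s])
  have hz0 : z ≠ 0 := by
    intro h
    apply hu0
    ext l
    have := congrFun h l
    simpa [z] using this
  have hne : ∀ l, l ≠ i → l ≠ j → tri f x z (Pi.single l 1) = 0 := by
    intro l hli hlj
    have hl : l ∈ s := by simp [s, hli, hlj]
    rw [← hMv]
    have := congrFun hu ⟨l, hl⟩
    refine Eq.trans ?_ this
    rw [Matrix.mulVec, Matrix.mulVec, dotProduct, dotProduct,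
      ← Finset.sum_subset (Finset.subset_univ s), ← Finset.sum_coe_sort s]
    · refine Finset.sum_congr rfl fun k _ => ?_
      simp [z]
    · intro k _ hk
      simp [z, hk]
  have hnej : tri f x z (Pi.single j 1) = 0 := by
    refine tri_eq_zero_of_forall_ne (w := y) (by rw [tri_swap_right, hxy]) hj fun l hl hyl => ?_
    refine hne l ?_ hl
    rintro rfl
    exact hyl hyi
  have hxz : ∀ w, tri f x z w = 0 := by
    have hne' : ∀ l, l ≠ i → tri f x z (Pi.single l 1) = 0 := by
      intro l hl
      rcases eq_or_ne l j with rfl | hlj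
      exacts [hnej, hne l hl hlj]
    apply tri_eq_zero_of_single
    intro l
    rcases eq_or_ne l i with rfl | hl
    · exact tri_eq_zero_of_forall_ne (hxx x z) hi fun l hl _ => hne' l hl
    · exact hne' l hl
  refine ⟨x, y, z, ?_, hxy, hxz⟩
  rw [Fintype.linearIndependent_iff]
  intro g hg
  simp only [Fin.sum_univ_three, Matrix.cons_val] at hg
  have h0 : g 0 = 0 := by
    have := congrFun hg i
    simpa [hyi, hzi, hi] using this
  have h1 : g 1 = 0 := by
    have := congrFun hg j
    simpa [h0, hzj, hj] using this
  have h2 : g 2 = 0 := by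
    rw [h0, h1] at hg
    simpa [hz0] using hg
  intro k
  fin_cases k
  exacts [h0, h1, h2]

theorem exists_linearIndependent_extension {n m : ℕ} (hnm : n ≤ m) {v : Fin n → Fin m → ZMod 2}
    (hv : LinearIndependent (ZMod 2) v) :
    ∃ w : Fin m → Fin m → ZMod 2, LinearIndependent (ZMod 2) w ∧ ∀ i, w (Fin.castLE hnm i) = v i := by
  obtain ⟨d, rfl⟩ := Nat.exists_eq_add_of_le hnm
  suffices ∀ e ≤ d, ∃ w : Fin (n + e) → Fin (n + d) → ZMod 2, LinearIndependent (ZMod 2) w ∧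
      ∀ i, w (Fin.castAdd e i) = v i from this d le_rfl
  intro e he
  induction e with
  | zero => exact ⟨v, hv, fun _ => rfl⟩
  | succ e ih =>
    obtain ⟨w, hw, hwv⟩ := ih (by omega)
    obtain ⟨x, hx⟩ := exists_linearIndependent_snoc_of_lt_finrank hw (by simp; omega)
    refine ⟨_, hx, fun i => ?_⟩
    rw [← hwv i]
    exact Fin.snoc_castSucc (α := fun _ => Fin (n + d) → ZMod 2) x w (Fin.castAdd e i)

end Trilinear

/-! ### Degree and weight of Boolean functions -/

section Degree

open Matrix

variable {m : ℕ}

/-- The exponent of the squarefree monomial with support `A`. -/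
noncomputable def indicatorExponent (A : Finset (Fin m)) : Fin m →₀ ℕ := ∑ i ∈ A, Finsupp.single i 1

theorem indicatorExponent_apply (A : Finset (Fin m)) (i : Fin m) :
    indicatorExponent A i = if i ∈ A then 1 else 0 := by
  simp [indicatorExponent, Finsupp.finsetSum_apply, Finsupp.single_apply]

theorem indicatorExponent_injective : Function.Injective (indicatorExponent (m := m)) := by
  intro A B h
  ext i
  have := DFunLike.congr_fun h i
  rw [indicatorExponent_apply, indicatorExponent_apply] at this
  split_ifs at this <;> simp_all

theorem degree_indicatorExponent (A : Finset (Fin m)) : (indicatorExponent A).degree = A.card := by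
  simp [indicatorExponent, map_sum]

theorem repPoly_eq_sum (f : BF m) :
    repPoly f = ∑ A : Finset (Fin m), monomial (indicatorExponent A) (∑ v, f v * ∏ i ∈ Aᶜ, (v i + 1)) := by
  have h : ∀ v : Fin m → ZMod 2, ∏ i, (X i + C (v i + 1)) =
      ∑ A : Finset (Fin m), monomial (indicatorExponent A) (∏ i ∈ Aᶜ, (v i + 1)) := by
    intro v
    rw [Finset.prod_add]
    refine Finset.sum_congr (by simp) fun A _ => ?_
    rw [← Finset.compl_eq_univ_sdiff, ← mul_one (∏ i ∈ Aᶜ, (v i + 1)), ← C_mul_monomial,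
      indicatorExponent, monomial_sum_one, map_prod, mul_comm]
    rfl
  simp only [repPoly, h, Finset.smul_sum, smul_monomial, smul_eq_mul]
  rw [Finset.sum_comm]
  exact Finset.sum_congr rfl fun A _ => (map_sum _ _ _).symm

theorem coeff_repPoly (f : BF m) (A : Finset (Fin m)) :
    coeff (indicatorExponent A) (repPoly f) = ∑ v, f v * ∏ i ∈ Aᶜ, (v i + 1) := by
  rw [repPoly_eq_sum, coeff_sum]
  simp only [coeff_monomial, indicatorExponent_injective.eq_iff, Finset.sum_ite_eq', Finset.mem_univ, if_true]

theorem deg_le_iff (f : BF m) (d : ℕ) :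
    deg f ≤ d ↔ ∀ B : Finset (Fin m), B.card + d < m → ∑ v, f v * ∏ i ∈ B, (v i + 1) = 0 := by
  constructor
  · intro h B hB
    have := coeff_repPoly f Bᶜ
    rw [compl_compl] at this
    rw [← this]
    apply coeff_eq_zero_of_totalDegree_lt
    have hd := degree_indicatorExponent Bᶜ
    rw [Finset.card_compl, Fintype.card_fin, Finsupp.degree_apply] at hd
    have : (repPoly f).totalDegree ≤ d := h
    omega
  · intro h
    rw [deg, repPoly_eq_sum]
    refine totalDegree_finsetSum_le fun A _ => ?_
    by_cases hA : A.card ≤ d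
    · refine (totalDegree_monomial_le _ _).trans ?_
      exact (degree_indicatorExponent A).trans_le hA
    · have := h Aᶜ (by
        have := Finset.card_le_univ A
        rw [Fintype.card_fin] at this
        rw [Finset.card_compl, Fintype.card_fin]
        omega)
      rw [this]
      simp

/-- Sums against products of few coordinates detect the degree. -/
theorem deg_le_iff_sum_prod (f : BF m) (d : ℕ) :
    deg f ≤ d ↔ ∀ B : Finset (Fin m), B.card + d < m → ∑ v, f v * ∏ i ∈ B, v i = 0 := by
  have expand : ∀ (u : (Fin m → ZMod 2) → Fin m → ZMod 2)
      (_ : ∀ B : Finset (Fin m), B.card + d < m → ∑ v, f v * ∏ i ∈ B, u v i = 0)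
      (B : Finset (Fin m)), B.card + d < m → ∑ v, f v * ∏ i ∈ B, (u v i + 1) = 0 := by
    intro u hu B hB
    simp only [Finset.prod_add_one, Finset.mul_sum]
    rw [Finset.sum_comm]
    refine Finset.sum_eq_zero fun C hC => hu C ?_
    have := Finset.card_le_card (Finset.mem_powerset.1 hC)
    omega
  rw [deg_le_iff]
  constructor
  · intro h B hB
    have := expand _ h B hB
    simpa [add_assoc, CharTwo.add_self_eq_zero] using this
  · exact fun h => expand _ h

theorem tri_single (f : BF m) (i j k : Fin m) :
    tri f (Pi.single i 1) (Pi.single j 1) (Pi.single k 1) = ∑ v, f v * (v i * v j * v k) := by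
  simp [tri, mul_assoc]

theorem deg_le_of_tri {f : BF m} {d : ℕ} (hd : m ≤ d + 4) (h0 : ∑ v, f v = 0)
    (h : ∀ x y z, tri f x y z = 0) : deg f ≤ d := by
  rw [deg_le_iff_sum_prod]
  intro B hB
  have key : ∀ i j k : Fin m, ∑ v, f v * (v i * v j * v k) = 0 := fun i j k => by
    rw [← tri_single, h]
  have hc : B.card = 0 ∨ B.card = 1 ∨ B.card = 2 ∨ B.card = 3 := by omega
  rcases hc with hc | hc | hc | hc
  · rw [Finset.card_eq_zero] at hc
    simpa [hc] using h0
  · obtain ⟨i, rfl⟩ := Finset.card_eq_one.1 hc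
    simpa [mul_self_zmod_two] using key i i i
  · obtain ⟨i, j, hij, rfl⟩ := Finset.card_eq_two.1 hc
    simpa [mul_self_zmod_two, Finset.prod_pair hij] using key i i j
  · obtain ⟨i, j, k, hij, hik, hjk, rfl⟩ := Finset.card_eq_three.1 hc
    simpa [Finset.prod_insert, hij, hik, hjk, mul_assoc] using key i j k

theorem sum_eq_zero_of_deg_le {f : BF m} {d : ℕ} (hd : d < m) (h : deg f ≤ d) : ∑ v, f v = 0 := by
  simpa using (deg_le_iff_sum_prod f d).1 h ∅ (by simpa using hd)

theorem tri_self_of_deg_le {f : BF m} {d : ℕ} (hd : d + 2 < m) (h : deg f ≤ d) (a c : Fin m → ZMod 2) :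
    tri f a a c = 0 := by
  have key : ∀ i j, ∑ v, f v * (v i * v j) = 0 := by
    intro i j
    rcases eq_or_ne i j with rfl | hij
    · simpa [mul_self_zmod_two] using (deg_le_iff_sum_prod f d).1 h {i} (by simp; omega)
    · simpa [Finset.prod_pair hij] using (deg_le_iff_sum_prod f d).1 h {i, j} (by
        rw [Finset.card_pair hij]; omega)
  have hab : tri f a a c = ∑ i, ∑ j, a i * c j * ∑ v, f v * (v i * v j) := by
    have hv : ∀ v, f v * (a ⬝ᵥ v) * (a ⬝ᵥ v) * (c ⬝ᵥ v) = ∑ i, ∑ j, a i * c j * (f v * (v i * v j)) := by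
      intro v
      rw [mul_assoc (f v), mul_self_zmod_two, mul_assoc, dotProduct, dotProduct, Finset.sum_mul_sum,
        Finset.mul_sum]
      refine Finset.sum_congr rfl fun i _ => ?_
      rw [Finset.mul_sum]
      exact Finset.sum_congr rfl fun j _ => by ring
    simp only [tri, hv, Finset.mul_sum]
    rw [Finset.sum_comm]
    exact Finset.sum_congr rfl fun i _ => Finset.sum_comm
  simp [hab, key]

/-- The sum of the indicator functions of a list of points. -/
def pointSum (P : List (Fin m → ZMod 2)) : BF m := (P.map fun u => Pi.single u 1).sum

theorem wt_pointSum_le (P : List (Fin m → ZMod 2)) : wt (pointSum P) ≤ P.length := by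
  have h : (Finset.univ.filter fun v => pointSum P v = 1) ⊆ P.toFinset := by
    intro v hv
    rw [List.mem_toFinset]
    by_contra hvP
    have : pointSum P v = 0 := by
      clear hv
      induction P with
      | nil => rfl
      | cons u P ih =>
        rw [List.mem_cons, not_or] at hvP
        have := ih hvP.2
        simp only [pointSum, List.map_cons, List.sum_cons, Pi.add_apply] at this ⊢
        rw [this, Pi.single_eq_of_ne hvP.1, add_zero]
    rw [Finset.mem_filter, this] at hv
    exact zero_ne_one hv.2
  exact (Finset.card_le_card h).trans P.toFinset_card_le

theorem sum_pointSum_mul (P : List (Fin m → ZMod 2)) (g : (Fin m → ZMod 2) → ZMod 2) :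
    ∑ v, pointSum P v * g v = (P.map g).sum := by
  induction P with
  | nil => simp [pointSum]
  | cons u P ih =>
    rw [List.map_cons, List.sum_cons, ← ih]
    simp [pointSum, add_mul, Finset.sum_add_distrib, Pi.single_apply]

theorem distRM_le_of_deg_add_pointSum_le {f : BF m} {d n : ℕ} {P : List (Fin m → ZMod 2)}
    (hP : P.length ≤ n) (h : deg (f + pointSum P) ≤ d) : distRM m d f ≤ n := by
  have hmem : distRM m d f ≤ wt (f + (f + pointSum P)) := Nat.sInf_le ⟨f + pointSum P, h, rfl⟩
  refine hmem.trans (le_trans ?_ hP)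
  rw [← add_assoc, CharTwo.add_self_eq_zero, zero_add]
  exact wt_pointSum_le P

end Degree

/-! ### Codes of Boolean functions -/

section Code

open Matrix

/-- Bit `i` of a natural number, as an element of the field. -/
def bitOf (c i : ℕ) : ZMod 2 := cond (c.testBit i) 1 0

theorem bitOf_xor (a b i : ℕ) : bitOf (a ^^^ b) i = bitOf a i + bitOf b i := by
  rw [bitOf, Nat.testBit_xor, bitOf, bitOf]
  cases a.testBit i <;> cases b.testBit i <;> decide

theorem testBit_eq_false_of_bitOf {c i : ℕ} (h : bitOf c i = 0) : c.testBit i = false := by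
  rw [bitOf] at h
  cases hc : c.testBit i
  · rfl
  · rw [hc] at h; exact absurd h (by decide)

theorem bitOf_codeOf (D : List ℕ) (i : ℕ) : bitOf (codeOf D) i = (D.map fun p => bitOf (mono p) i).sum := by
  induction D with
  | nil => simp [codeOf, bitOf]
  | cons p D ih =>
    rw [show codeOf (p :: D) = mono p ^^^ codeOf D from rfl, bitOf_xor, ih, List.map_cons, List.sum_cons]

theorem mono_bits : (forceList ((List.range 512).filter (tb lowMask)) fun Ss =>
    allOf (List.range 512) fun p => force (mono p) fun c => allOf Ss fun S =>
      Nat.beq (bitAt c S) (cond (Nat.beq (Nat.land p S) S) (nat_lit 1) (nat_lit 0))) = true := by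
  decide +kernel

theorem testBit_mono {p S : ℕ} (hp : p < 512) (hS : S < 512) (h : lowMask.testBit S = true) :
    (mono p).testBit S = (p &&& S == S) := by
  have h1 := mono_bits
  simp only [allOf_iff, force_eq, forceList_eq, List.mem_range, List.mem_filter, tb_eq] at h1
  have h2 := h1 p hp S ⟨hS, h⟩
  rw [Nat.beq_eq, bitAt_eq, land_eq] at h2
  rw [show Nat.beq (p &&& S) S = (p &&& S == S) by rw [Bool.eq_iff_iff, Nat.beq_eq, beq_iff_eq]] at h2
  cases h3 : (mono p).testBit S <;> cases h4 : (p &&& S == S) <;> simp_all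

/-- The position of the monomial `l_i l_j l_k`. -/
def tripleBit (i j k : Fin 9) : ℕ := 2 ^ (i : ℕ) ||| 2 ^ (j : ℕ) ||| 2 ^ (k : ℕ)

theorem tripleBit_lt (i j k : Fin 9) : tripleBit i j k < 512 := by
  have h : ∀ i : Fin 9, 2 ^ (i : ℕ) < 2 ^ 9 := fun i => Nat.pow_lt_pow_right (by norm_num) i.2
  exact Nat.or_lt_two_pow (Nat.or_lt_two_pow (h i) (h j)) (h k)

theorem testBit_lowMask_tripleBit : ∀ i j k : Fin 9, lowMask.testBit (tripleBit i j k) = true := by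
  decide +kernel

theorem and_tripleBit_beq (p : ℕ) (i j k : Fin 9) :
    (p &&& tripleBit i j k == tripleBit i j k) = (p.testBit i && p.testBit j && p.testBit k) := by
  rw [Bool.eq_iff_iff, beq_iff_eq]
  simp only [Bool.and_eq_true]
  constructor
  · intro h
    have hb : ∀ l, (tripleBit i j k).testBit l = true → p.testBit l = true := by
      intro l hl
      rw [← h, Nat.testBit_and, Bool.and_eq_true] at hl
      exact hl.1
    refine ⟨⟨hb _ ?_, hb _ ?_⟩, hb _ ?_⟩ <;> simp [tripleBit]
  · rintro ⟨⟨hi, hj⟩, hk⟩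
    refine Nat.eq_of_testBit_eq fun l => ?_
    simp only [tripleBit, Nat.testBit_and, Nat.testBit_or, Nat.testBit_two_pow]
    by_cases h1 : (i : ℕ) = l
    · subst h1; simp [hi]
    by_cases h2 : (j : ℕ) = l
    · subst h2; simp [hj]
    by_cases h3 : (k : ℕ) = l
    · subst h3; simp [hk]
    simp [h1, h2, h3]

/-- The number of a point with respect to the linear forms `b i`. -/
def index (b : Fin 9 → Fin 9 → ZMod 2) (v : Fin 9 → ZMod 2) : ℕ := Nat.ofBits fun i => b i ⬝ᵥ v == 1

theorem index_lt (b : Fin 9 → Fin 9 → ZMod 2) (v : Fin 9 → ZMod 2) : index b v < 512 :=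
  Nat.ofBits_lt_two_pow _

theorem bitOf_mono_index (b : Fin 9 → Fin 9 → ZMod 2) (v : Fin 9 → ZMod 2) (i j k : Fin 9) :
    bitOf (mono (index b v)) (tripleBit i j k) = (b i ⬝ᵥ v) * (b j ⬝ᵥ v) * (b k ⬝ᵥ v) := by
  rw [bitOf, testBit_mono (index_lt b v) (tripleBit_lt i j k) (testBit_lowMask_tripleBit i j k),
    and_tripleBit_beq, index]
  simp only [Nat.testBit_ofBits_lt _ _ (Fin.is_lt _), Fin.eta]
  generalize b i ⬝ᵥ v = x
  generalize b j ⬝ᵥ v = y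
  generalize b k ⬝ᵥ v = z
  revert x y z
  decide

theorem bitOf_mono_index_zero (b : Fin 9 → Fin 9 → ZMod 2) (v : Fin 9 → ZMod 2) :
    bitOf (mono (index b v)) 0 = 1 := by
  rw [bitOf, testBit_mono (index_lt b v) (by norm_num) (by decide +kernel)]
  simp

/-- The code of a Boolean function with respect to the linear forms `b i`. -/
noncomputable def codeFn (b : Fin 9 → Fin 9 → ZMod 2) (f : BF 9) : ℕ :=
  codeOf ((Finset.univ.filter fun v => f v = 1).toList.map (index b))

theorem bitOf_codeFn (b : Fin 9 → Fin 9 → ZMod 2) (f : BF 9) (S : ℕ) :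
    bitOf (codeFn b f) S = ∑ v, f v * bitOf (mono (index b v)) S := by
  rw [codeFn, bitOf_codeOf, List.map_map, ← Multiset.sum_coe, ← Multiset.map_coe, Finset.coe_toList]
  refine (Finset.sum_filter _ _).trans (Finset.sum_congr rfl fun v _ => ?_)
  split_ifs with h
  · rw [h, one_mul]; rfl
  · rw [show f v = 0 from by_contra fun h0 => h (eq_one_of_ne_zero h0), zero_mul]

theorem bitOf_codeFn_tripleBit (b : Fin 9 → Fin 9 → ZMod 2) (f : BF 9) (i j k : Fin 9) :
    bitOf (codeFn b f) (tripleBit i j k) = tri f (b i) (b j) (b k) := by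
  rw [bitOf_codeFn, tri]
  exact Finset.sum_congr rfl fun v _ => by rw [bitOf_mono_index]; ring

theorem bitOf_codeFn_zero (b : Fin 9 → Fin 9 → ZMod 2) (f : BF 9) :
    bitOf (codeFn b f) 0 = ∑ v, f v := by
  rw [bitOf_codeFn]
  exact Finset.sum_congr rfl fun v _ => by rw [bitOf_mono_index_zero, mul_one]

theorem codeFn_add_pointSum (b : Fin 9 → Fin 9 → ZMod 2) (f : BF 9) (P : List (Fin 9 → ZMod 2)) (S : ℕ) :
    bitOf (codeFn b (f + pointSum P)) S = bitOf (codeFn b f) S + bitOf (codeOf (P.map (index b))) S := by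
  rw [bitOf_codeFn, bitOf_codeFn, bitOf_codeOf, List.map_map]
  simp only [Pi.add_apply, add_mul, Finset.sum_add_distrib, sum_pointSum_mul]
  rfl

theorem quadratic_positions : ∀ S : Fin 512, lowMask.testBit S = true → cubMask.testBit S = false →
    (S : ℕ) = 0 ∨ ∃ i j : Fin 9, (S : ℕ) = tripleBit i i j := by
  decide +kernel

set_option exponentiation.threshold 600 in
theorem lowMask_lt : lowMask < 2 ^ 512 := by decide +kernel

set_option exponentiation.threshold 600 in
theorem cubic_codeFn {b : Fin 9 → Fin 9 → ZMod 2} {f : BF 9} (h0 : ∑ v, f v = 0)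
    (halt : ∀ a c, tri f a a c = 0) : Cubic (codeFn b f) := by
  refine Nat.eq_of_testBit_eq fun S => ?_
  rw [Nat.testBit_and]
  cases hS : (codeFn b f).testBit S
  · rfl
  rw [Bool.true_and]
  have hlow : lowMask.testBit S = true := by
    rw [codeFn, ← codeOf_and_lowMask, Nat.testBit_and, Bool.and_eq_true] at hS
    exact hS.2
  have hlt : S < 512 := by
    by_contra hge
    rw [Nat.testBit_lt_two_pow (lowMask_lt.trans_le (Nat.pow_le_pow_right (by norm_num) (not_lt.1 hge)))] at hlow
    exact Bool.noConfusion hlow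
  by_contra hcub
  rw [Bool.not_eq_true] at hcub
  have hbit : bitOf (codeFn b f) S = 0 := by
    rcases quadratic_positions ⟨S, hlt⟩ hlow hcub with h | ⟨i, j, h⟩
    · rw [show S = 0 from h, bitOf_codeFn_zero, h0]
    · rw [show S = _ from h, bitOf_codeFn_tripleBit, halt]
  rw [testBit_eq_false_of_bitOf hbit] at hS
  exact Bool.noConfusion hS

theorem dotProduct_bijective {b : Fin 9 → Fin 9 → ZMod 2} (hb : LinearIndependent (ZMod 2) b) :
    Function.Bijective fun (v : Fin 9 → ZMod 2) i => b i ⬝ᵥ v := by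
  have hu : IsUnit (Matrix.of b) := Matrix.linearIndependent_rows_iff_isUnit.1 hb
  have := (Matrix.mulVec_injective_iff_isUnit).2 hu
  exact ⟨this, Finite.injective_iff_surjective.1 this⟩

theorem exists_index_eq {b : Fin 9 → Fin 9 → ZMod 2} (hb : LinearIndependent (ZMod 2) b) {p : ℕ}
    (hp : p < 512) : ∃ v, index b v = p := by
  obtain ⟨v, hv⟩ := (dotProduct_bijective hb).2 fun i => bitOf p i
  refine ⟨v, Nat.eq_of_testBit_eq fun i => ?_⟩
  rcases lt_or_ge i 9 with hi | hi
  · rw [index, Nat.testBit_ofBits_lt _ _ hi, show b ⟨i, hi⟩ ⬝ᵥ v = bitOf p i from congrFun hv ⟨i, hi⟩, bitOf]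
    cases p.testBit i <;> rfl
  · rw [Nat.testBit_lt_two_pow ((index_lt b v).trans_le (Nat.pow_le_pow_right (n := 2) (by norm_num) hi)),
      Nat.testBit_lt_two_pow (hp.trans_le (Nat.pow_le_pow_right (n := 2) (by norm_num) hi))]

theorem distRM_le_of_real_codeFn {b : Fin 9 → Fin 9 → ZMod 2} (hb : LinearIndependent (ZMod 2) b)
    {f : BF 9} (h : Real (codeFn b f)) : distRM 9 5 f ≤ 32 := by
  obtain ⟨D, hlen, hlt, hD⟩ := h
  choose! pt hpt using fun p (hp : p < 512) => exists_index_eq hb hp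
  have hmap : (D.map pt).map (index b) = D := by
    rw [List.map_map]
    exact (List.map_congr_left fun p hp => hpt p (hlt p hp)).trans (List.map_id D)
  have hbit : ∀ S, bitOf (codeFn b (f + pointSum (D.map pt))) S = 0 := fun S => by
    rw [codeFn_add_pointSum, hmap, hD, CharTwo.add_self_eq_zero]
  refine distRM_le_of_deg_add_pointSum_le (P := D.map pt) (by simpa using hlen)
    (deg_le_of_tri (by norm_num) ?_ ?_)
  · rw [← bitOf_codeFn_zero b, hbit]
  · refine tri_eq_zero_of_spans (b := b) ?_ fun i j k => ?_
    · exact (hb.span_eq_top_of_card_eq_finrank' (by simp)).ge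
    · rw [← bitOf_codeFn_tripleBit, hbit]

end Code

theorem fixed_positions : ∀ S : Fin 512, FT.testBit S = true →
    ∃ k : Fin 9, (S : ℕ) = tripleBit 0 1 k ∨ (S : ℕ) = tripleBit 0 2 k := by
  decide +kernel

set_option exponentiation.threshold 600 in
theorem FT_lt : FT < 2 ^ 512 := by decide +kernel

set_option exponentiation.threshold 600 in
theorem real_codeFn {b : Fin 9 → Fin 9 → ZMod 2} {f : BF 9} (h0 : ∑ v, f v = 0)
    (halt : ∀ a c, tri f a a c = 0) (h1 : ∀ w, tri f (b 0) (b 1) w = 0)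
    (h2 : ∀ w, tri f (b 0) (b 2) w = 0) : Real (codeFn b f) := by
  refine famReal_FT _ ⟨cubic_codeFn h0 halt, Nat.eq_of_testBit_eq fun S => ?_⟩
  rw [Nat.testBit_and, Nat.zero_testBit]
  cases hS : FT.testBit S
  · exact Bool.and_false _
  rw [Bool.and_true]
  have hlt : S < 512 := by
    by_contra hge
    rw [Nat.testBit_lt_two_pow (FT_lt.trans_le (Nat.pow_le_pow_right (by norm_num) (not_lt.1 hge)))] at hS
    exact Bool.noConfusion hS
  apply testBit_eq_false_of_bitOf
  obtain ⟨k, h | h⟩ := fixed_positions ⟨S, hlt⟩ hS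
  · rw [show S = _ from h, bitOf_codeFn_tripleBit, h1]
  · rw [show S = _ from h, bitOf_codeFn_tripleBit, h2]

theorem distRM_le {f : BF 9} (hf : deg f ≤ 6) : distRM 9 5 f ≤ 32 := by
  have halt : ∀ a c, tri f a a c = 0 := tri_self_of_deg_le (by norm_num) hf
  obtain ⟨x, y, z, hli, hxy, hxz⟩ := exists_isotropic (by decide) (by decide) halt
  obtain ⟨b, hb, hbv⟩ := exists_linearIndependent_extension (by norm_num : 3 ≤ 9) hli
  have hb0 : b 0 = x := hbv 0
  have hb1 : b 1 = y := hbv 1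
  have hb2 : b 2 = z := hbv 2
  exact distRM_le_of_real_codeFn hb (real_codeFn (sum_eq_zero_of_deg_le (by norm_num) hf) halt
    (fun w => by rw [hb0, hb1, hxy]) (fun w => by rw [hb0, hb2, hxz]))

end Cover

/-- The covering radius of `RM(5,9)` in `RM(6,9)` is at most 32. -/
theorem stmt9 : ∀ f : BF 9, deg f ≤ 6 → distRM 9 5 f ≤ 32 := by
  exact fun _ hf => Cover.distRM_le hf
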